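/- For every ε > 0 there exists a constant C(ε) such that for every squarefree integer q ≥ 1, every real X > 0, and every finite set S of pairwise SL₂(ℤ)-inequivalent elements x ∈ V̂_ℤ with 0 < |Disc(x)| < q⁸·X, one has both Σ_{x∈S} |Φ̂'_q(x)|/#Stab(x) ≤ C(ε)·q^{2+ε}·X and Σ_{x∈S} |Φ̂'_q(x)|/#Stab(x) ≤ C(ε)·(q^{1+ε}·X + q^{−1+ε}). -/

import Mathlib

open scoped Classical

noncomputable section

/-- An integral binary cubic form `a u³ + b u²v + c uv² + d v³`, recorded by its
coefficient quadruple `(a, b, c, d)`. -/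
abbrev BCF := ℤ × ℤ × ℤ × ℤ

namespace BCF

/-- The discriminant of a binary cubic form. -/
def disc (f : BCF) : ℤ :=
  f.2.1 ^ 2 * f.2.2.1 ^ 2 - 4 * f.1 * f.2.2.1 ^ 3 - 4 * f.2.1 ^ 3 * f.2.2.2
    - 27 * f.1 ^ 2 * f.2.2.2 ^ 2 + 18 * f.1 * f.2.1 * f.2.2.1 * f.2.2.2

/-- The (twisted) action of a matrix `γ` with `det γ = ±1` on binary cubic forms:
`(γ·f)(u,v) = (det γ)⁻¹ · f((u,v)·γ)`, written out on coefficients (for `det γ = ±1`,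
dividing by the determinant is the same as multiplying by it). -/
def act (γ : Matrix (Fin 2) (Fin 2) ℤ) (f : BCF) : BCF :=
  let a := f.1; let b := f.2.1; let c := f.2.2.1; let d := f.2.2.2
  let α := γ 0 0; let β := γ 1 0; let g := γ 0 1; let δ := γ 1 1
  (γ.det * (a * α ^ 3 + b * α ^ 2 * g + c * α * g ^ 2 + d * g ^ 3),
   γ.det * (3 * a * α ^ 2 * β + b * (α ^ 2 * δ + 2 * α * β * g)
      + c * (2 * α * g * δ + β * g ^ 2) + 3 * d * g ^ 2 * δ),
   γ.det * (3 * a * α * β ^ 2 + b * (2 * α * β * δ + β ^ 2 * g)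
      + c * (α * δ ^ 2 + 2 * β * g * δ) + 3 * d * g * δ ^ 2),
   γ.det * (a * β ^ 3 + b * β ^ 2 * δ + c * β * δ ^ 2 + d * δ ^ 3))

/-- `SL₂(ℤ)`-equivalence of binary cubic forms. -/
def SLeq (f g : BCF) : Prop := ∃ γ : Matrix (Fin 2) (Fin 2) ℤ, γ.det = 1 ∧ act γ f = g

/-- `GL₂(ℤ)`-equivalence of binary cubic forms. -/
def GLeq (f g : BCF) : Prop :=
  ∃ γ : Matrix (Fin 2) (Fin 2) ℤ, (γ.det = 1 ∨ γ.det = -1) ∧ act γ f = g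

/-- The Davenport–Heilbronn set `U_p`: `f` is not a multiple of `p`, and no
`GL₂(ℤ)`-transform of `f` has leading coefficient divisible by `p²` and second
coefficient divisible by `p`. -/
def inUp (p : ℕ) (f : BCF) : Prop :=
  (¬ ((p:ℤ) ∣ f.1 ∧ (p:ℤ) ∣ f.2.1 ∧ (p:ℤ) ∣ f.2.2.1 ∧ (p:ℤ) ∣ f.2.2.2)) ∧
  ∀ γ : Matrix (Fin 2) (Fin 2) ℤ, (γ.det = 1 ∨ γ.det = -1) →
    ¬ ((p:ℤ) ^ 2 ∣ (act γ f).1 ∧ (p:ℤ) ∣ (act γ f).2.1)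

/-- Membership in the dual lattice `V̂_ℤ`: the middle coefficients are divisible by 3. -/
def inDual (x : BCF) : Prop := (3:ℤ) ∣ x.2.1 ∧ (3:ℤ) ∣ x.2.2.1

/-- The pairing `[x, y] = x₄y₁ − x₃y₂/3 + x₂y₃/3 − x₁y₄` (an integer for `x ∈ V̂_ℤ`). -/
def pairQ (x y : BCF) : ℚ :=
  (x.2.2.2 * y.1 : ℤ) - ((x.2.2.1 * y.2.1 : ℤ) : ℚ) / 3
    + ((x.2.1 * y.2.2.1 : ℤ) : ℚ) / 3 - (x.1 * y.2.2.2 : ℤ)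

/-- `Φ_q`, the characteristic function of forms nonmaximal at every prime `p | q`. -/
def nonmaxAll (q : ℕ) (f : BCF) : Prop := ∀ p : ℕ, p.Prime → p ∣ q → ¬ inUp p f

/-- The cubic Gauss sum `Φ̂_q(x) = q⁻⁸ Σ_y Φ_q(y) exp(2πi [x,y]/q²)`, the sum running
over forms `y` with coefficients in `{0, …, q² − 1}`. -/
noncomputable def PhiHat (q : ℕ) (x : BCF) : ℂ :=
  ((q : ℂ) ^ 8)⁻¹ *
    ∑ y1 ∈ Finset.range (q ^ 2), ∑ y2 ∈ Finset.range (q ^ 2),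
    ∑ y3 ∈ Finset.range (q ^ 2), ∑ y4 ∈ Finset.range (q ^ 2),
      (if nonmaxAll q ((y1 : ℤ), (y2 : ℤ), (y3 : ℤ), (y4 : ℤ)) then 1 else 0) *
        Complex.exp (2 * Real.pi * Complex.I *
          ((pairQ x ((y1 : ℤ), (y2 : ℤ), (y3 : ℤ), (y4 : ℤ)) : ℚ) : ℂ) / (q : ℂ) ^ 2)

/-- The order of the stabilizer of `x` in `SL₂(ℤ)`. -/
noncomputable def stabCard (x : BCF) : ℕ :=
  Nat.card {γ : Matrix (Fin 2) (Fin 2) ℤ // γ.det = 1 ∧ act γ x = x}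

/-- The Davenport–Heilbronn set `V_p ⊆ U_p`: additionally, the reduction of `f` mod `p`
is not a scalar multiple of the cube of a linear form over `𝔽_p` (i.e. `p` is not
totally ramified in the associated maximal cubic ring). -/
def inVp (p : ℕ) (f : BCF) : Prop :=
  inUp p f ∧ ¬ ∃ s l₁ l₂ : ZMod p,
    (f.1 : ZMod p) = s * l₁ ^ 3 ∧ (f.2.1 : ZMod p) = 3 * s * l₁ ^ 2 * l₂ ∧
    (f.2.2.1 : ZMod p) = 3 * s * l₁ * l₂ ^ 2 ∧ (f.2.2.2 : ZMod p) = s * l₂ ^ 3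

/-- `Φ'_q`, the characteristic function of forms outside `V_p` for every prime `p | q`. -/
def outVpAll (q : ℕ) (f : BCF) : Prop := ∀ p : ℕ, p.Prime → p ∣ q → ¬ inVp p f

/-- The Gauss sum `Φ̂'_q(x) = q⁻⁸ Σ_y Φ'_q(y) exp(2πi [x,y]/q²)`. -/
noncomputable def PhiHat' (q : ℕ) (x : BCF) : ℂ :=
  ((q : ℂ) ^ 8)⁻¹ *
    ∑ y1 ∈ Finset.range (q ^ 2), ∑ y2 ∈ Finset.range (q ^ 2),
    ∑ y3 ∈ Finset.range (q ^ 2), ∑ y4 ∈ Finset.range (q ^ 2),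
      (if outVpAll q ((y1 : ℤ), (y2 : ℤ), (y3 : ℤ), (y4 : ℤ)) then 1 else 0) *
        Complex.exp (2 * Real.pi * Complex.I *
          ((pairQ x ((y1 : ℤ), (y2 : ℤ), (y3 : ℤ), (y4 : ℤ)) : ℚ) : ℂ) / (q : ℂ) ^ 2)

end BCF


namespace BCF

lemma act_eq (γ : Matrix (Fin 2) (Fin 2) ℤ) (h : γ.det = 1) (a b c d : ℤ) : act γ (a, b, c, d) =
  ((a * γ 0 0 ^ 3 + b * γ 0 0 ^ 2 * γ 0 1 + c * γ 0 0 * γ 0 1 ^ 2 + d * γ 0 1 ^ 3),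
   (3 * a * γ 0 0 ^ 2 * γ 1 0 + b * (γ 0 0 ^ 2 * γ 1 1 + 2 * γ 0 0 * γ 1 0 * γ 0 1)
      + c * (2 * γ 0 0 * γ 0 1 * γ 1 1 + γ 1 0 * γ 0 1 ^ 2) + 3 * d * γ 0 1 ^ 2 * γ 1 1),
   (3 * a * γ 0 0 * γ 1 0 ^ 2 + b * (2 * γ 0 0 * γ 1 0 * γ 1 1 + γ 1 0 ^ 2 * γ 0 1)
      + c * (γ 0 0 * γ 1 1 ^ 2 + 2 * γ 1 0 * γ 0 1 * γ 1 1) + 3 * d * γ 0 1 * γ 1 1 ^ 2),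
   (a * γ 1 0 ^ 3 + b * γ 1 0 ^ 2 * γ 1 1 + c * γ 1 0 * γ 1 1 ^ 2 + d * γ 1 1 ^ 3)) := by
  simp [act, h]

lemma act_mul (γ₁ γ₂ : Matrix (Fin 2) (Fin 2) ℤ) (f : BCF) :
    act (γ₁ * γ₂) f = act γ₁ (act γ₂ f) := by
  obtain ⟨a, b, c, d⟩ := f
  simp only [act, Matrix.det_mul, Matrix.mul_apply, Fin.sum_univ_two]
  ext <;> simp only <;> ring

lemma act_one (f : BCF) : act 1 f = f := by
  obtain ⟨a, b, c, d⟩ := f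
  simp [act]

lemma act_smul (γ : Matrix (Fin 2) (Fin 2) ℤ) (k : ℤ) (f : BCF) :
    act γ (k • f) = k • act γ f := by
  obtain ⟨a, b, c, d⟩ := f
  simp only [act, Prod.smul_mk, smul_eq_mul]
  ext <;> simp only <;> ring

lemma det_two (γ : Matrix (Fin 2) (Fin 2) ℤ) (h : γ.det = 1) :
    γ 0 0 * γ 1 1 - γ 0 1 * γ 1 0 = 1 := by
  rw [← h, Matrix.det_fin_two]

lemma act_adj (γ : Matrix (Fin 2) (Fin 2) ℤ) (h : γ.det = 1) (f : BCF) :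
    act γ.adjugate (act γ f) = f := by
  rw [← act_mul, Matrix.adjugate_mul, h, one_smul, act_one]

lemma det_adj (γ : Matrix (Fin 2) (Fin 2) ℤ) (h : γ.det = 1) : γ.adjugate.det = 1 := by
  rw [Matrix.det_adjugate, h]; simp

lemma SLeq_symm {f g : BCF} (h : SLeq f g) : SLeq g f := by
  obtain ⟨γ, h1, h2⟩ := h
  exact ⟨γ.adjugate, det_adj γ h1, by rw [← h2, act_adj γ h1]⟩

lemma SLeq_trans {f g k : BCF} (h : SLeq f g) (h' : SLeq g k) : SLeq f k := by
  obtain ⟨γ, h1, h2⟩ := h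
  obtain ⟨γ', h1', h2'⟩ := h'
  exact ⟨γ' * γ, by rw [Matrix.det_mul, h1, h1']; rfl, by rw [act_mul, h2, h2']⟩

lemma disc_smul (k : ℤ) (f : BCF) : disc (k • f) = k ^ 4 * disc f := by
  obtain ⟨a, b, c, d⟩ := f
  simp only [disc, Prod.smul_mk, smul_eq_mul]
  ring

lemma disc_act (γ : Matrix (Fin 2) (Fin 2) ℤ) (h : γ.det = 1) (f : BCF) :
    disc (act γ f) = disc f := by
  obtain ⟨a, b, c, d⟩ := f
  have h1 := det_two γ h
  rw [act_eq γ h]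
  have : disc (a, b, c, d) = (γ 0 0 * γ 1 1 - γ 0 1 * γ 1 0) ^ 6 * disc (a, b, c, d) := by
    rw [h1]; ring
  rw [this]
  simp only [disc]
  ring

/-- Hessian coefficients. -/
def hA (f : BCF) : ℤ := f.2.1 ^ 2 - 3 * f.1 * f.2.2.1
def hB (f : BCF) : ℤ := f.2.1 * f.2.2.1 - 9 * f.1 * f.2.2.2
def hC (f : BCF) : ℤ := f.2.2.1 ^ 2 - 3 * f.2.1 * f.2.2.2

lemma hA_act (γ : Matrix (Fin 2) (Fin 2) ℤ) (h : γ.det = 1) (f : BCF) :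
    hA (act γ f) = hA f * γ 0 0 ^ 2 + hB f * γ 0 0 * γ 0 1 + hC f * γ 0 1 ^ 2 := by
  obtain ⟨a, b, c, d⟩ := f
  have h1 := det_two γ h
  rw [act_eq γ h]
  have : hA (a, b, c, d) * γ 0 0 ^ 2 + hB (a, b, c, d) * γ 0 0 * γ 0 1 + hC (a, b, c, d) * γ 0 1 ^ 2
    = (γ 0 0 * γ 1 1 - γ 0 1 * γ 1 0) ^ 2 * (hA (a, b, c, d) * γ 0 0 ^ 2 + hB (a, b, c, d) * γ 0 0 * γ 0 1 + hC (a, b, c, d) * γ 0 1 ^ 2) := by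
    rw [h1]; ring
  rw [this]
  simp only [hA, hB, hC]
  ring

lemma hC_act (γ : Matrix (Fin 2) (Fin 2) ℤ) (h : γ.det = 1) (f : BCF) :
    hC (act γ f) = hA f * γ 1 0 ^ 2 + hB f * γ 1 0 * γ 1 1 + hC f * γ 1 1 ^ 2 := by
  obtain ⟨a, b, c, d⟩ := f
  have h1 := det_two γ h
  rw [act_eq γ h]
  have : hA (a, b, c, d) * γ 1 0 ^ 2 + hB (a, b, c, d) * γ 1 0 * γ 1 1 + hC (a, b, c, d) * γ 1 1 ^ 2
    = (γ 0 0 * γ 1 1 - γ 0 1 * γ 1 0) ^ 2 * (hA (a, b, c, d) * γ 1 0 ^ 2 + hB (a, b, c, d) * γ 1 0 * γ 1 1 + hC (a, b, c, d) * γ 1 1 ^ 2) := by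
    rw [h1]; ring
  rw [this]
  simp only [hA, hB, hC]
  ring

lemma hess_disc (f : BCF) : 4 * hA f * hC f - hB f ^ 2 = 3 * disc f := by
  simp only [hA, hB, hC, disc]; ring

lemma syz (a b c d : ℤ) : 4 * (b ^ 2 - 3 * a * c) ^ 3 - (2 * b ^ 3 - 9 * a * b * c + 27 * a ^ 2 * d) ^ 2
    = 27 * a ^ 2 * disc (a, b, c, d) := by
  simp only [disc]; ring

lemma inDual_act (γ : Matrix (Fin 2) (Fin 2) ℤ) (f : BCF) (hf : inDual f) : inDual (act γ f) := by
  obtain ⟨a, b, c, d⟩ := f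
  obtain ⟨⟨b, rfl⟩, ⟨c, rfl⟩⟩ := hf
  constructor
  · refine ⟨γ.det * (a * γ 0 0 ^ 2 * γ 1 0 + b * (γ 0 0 ^ 2 * γ 1 1 + 2 * γ 0 0 * γ 1 0 * γ 0 1)
      + c * (2 * γ 0 0 * γ 0 1 * γ 1 1 + γ 1 0 * γ 0 1 ^ 2) + d * γ 0 1 ^ 2 * γ 1 1), ?_⟩
    simp only [act]; ring
  · refine ⟨γ.det * (a * γ 0 0 * γ 1 0 ^ 2 + b * (2 * γ 0 0 * γ 1 0 * γ 1 1 + γ 1 0 ^ 2 * γ 0 1)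
      + c * (γ 0 0 * γ 1 1 ^ 2 + 2 * γ 1 0 * γ 0 1 * γ 1 1) + d * γ 0 1 * γ 1 1 ^ 2), ?_⟩
    simp only [act]; ring

/-- Positions. -/
lemma pos_stable {P Q R : ℤ} (γ : Matrix (Fin 2) (Fin 2) ℤ) (k : ℤ) (hk : k ∣ γ 0 1)
    (h1 : Q ∣ P) (h1' : R ∣ Q) (hPQ : P ∣ Q * k) (hQR : Q ∣ R * k) (hR : R ∣ k)
    (f : BCF) (ha : P ∣ f.1) (hb : Q ∣ f.2.1) (hc : R ∣ f.2.2.1) :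
    P ∣ (act γ f).1 ∧ Q ∣ (act γ f).2.1 ∧ R ∣ (act γ f).2.2.1 := by
  obtain ⟨a, b, c, d⟩ := f
  simp only at ha hb hc
  obtain ⟨g, hg⟩ := hk
  have e1 : P ∣ b * (k * g) := by
    have := mul_dvd_mul_right hb k
    rw [← mul_assoc]; exact (hPQ.trans this).mul_right g
  have e2 : Q ∣ c * (k * g) := by
    have := mul_dvd_mul_right hc k
    rw [← mul_assoc]; exact (hQR.trans this).mul_right g
  have e3 : R ∣ k * g := hR.mul_right g
  have e4 : Q ∣ (k * g) * (k * g) := by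
    have := mul_dvd_mul_right hR k
    calc Q ∣ R * k := hQR
      _ ∣ k * k := this
      _ ∣ _ := ⟨g * g, by ring⟩
  have e4' : Q ∣ k * k := hQR.trans (mul_dvd_mul_right hR k)
  have e5 : P ∣ c * (k * g) * (k * g) := by
    have h := mul_dvd_mul_right ((hQR.trans (mul_dvd_mul_right hc k))) k
    refine (hPQ.trans h).trans ⟨g * g, by ring⟩
  have e6 : P ∣ (k * g) * (k * g) * (k * g) := by
    have h := mul_dvd_mul_right e4' k
    refine (hPQ.trans h).trans ⟨g * g * g, by ring⟩
  simp only [act, hg]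
  refine ⟨Dvd.dvd.mul_left ?_ _, Dvd.dvd.mul_left ?_ _, Dvd.dvd.mul_left ?_ _⟩
  · have : a * γ 0 0 ^ 3 + b * γ 0 0 ^ 2 * (k * g) + c * γ 0 0 * (k * g) ^ 2 + d * (k * g) ^ 3
      = a * γ 0 0 ^ 3 + b * (k * g) * γ 0 0 ^ 2 + c * (k * g) * (k * g) * γ 0 0
        + (k * g) * (k * g) * (k * g) * d := by ring
    rw [this]
    exact ((((ha.mul_right _).add (e1.mul_right _)).add (e5.mul_right _)).add (e6.mul_right _))
  · have : 3 * a * γ 0 0 ^ 2 * γ 1 0 + b * (γ 0 0 ^ 2 * γ 1 1 + 2 * γ 0 0 * γ 1 0 * (k * g)) +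
      c * (2 * γ 0 0 * (k * g) * γ 1 1 + γ 1 0 * (k * g) ^ 2) + 3 * d * (k * g) ^ 2 * γ 1 1
      = a * (3 * γ 0 0 ^ 2 * γ 1 0) + b * (γ 0 0 ^ 2 * γ 1 1 + 2 * γ 0 0 * γ 1 0 * (k * g)) +
      c * (k * g) * (2 * γ 0 0 * γ 1 1 + γ 1 0 * (k * g)) + (k * g) * (k * g) * (3 * d * γ 1 1) := by ring
    rw [this]
    exact (((((h1.trans ha).mul_right _).add (hb.mul_right _)).add (e2.mul_right _)).add (e4.mul_right _))
  · have : 3 * a * γ 0 0 * γ 1 0 ^ 2 + b * (2 * γ 0 0 * γ 1 0 * γ 1 1 + γ 1 0 ^ 2 * (k * g)) +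
      c * (γ 0 0 * γ 1 1 ^ 2 + 2 * γ 1 0 * (k * g) * γ 1 1) + 3 * d * (k * g) * γ 1 1 ^ 2
      = a * (3 * γ 0 0 * γ 1 0 ^ 2) + b * (2 * γ 0 0 * γ 1 0 * γ 1 1 + γ 1 0 ^ 2 * (k * g)) +
      c * (γ 0 0 * γ 1 1 ^ 2 + 2 * γ 1 0 * (k * g) * γ 1 1) + (k * g) * (3 * d * γ 1 1 ^ 2) := by ring
    rw [this]
    exact ((((((h1'.trans h1).trans ha).mul_right _).add ((h1'.trans hb).mul_right _)).add (hc.mul_right _)).add (e3.mul_right _))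

end BCF

namespace BCF

def dvdAll (k : ℤ) (f : BCF) : Prop := k ∣ f.1 ∧ k ∣ f.2.1 ∧ k ∣ f.2.2.1 ∧ k ∣ f.2.2.2

lemma dvdAll_iff (k : ℤ) (f : BCF) : dvdAll k f ↔ ∃ g : BCF, f = k • g := by
  obtain ⟨a, b, c, d⟩ := f
  constructor
  · rintro ⟨⟨a, rfl⟩, ⟨b, rfl⟩, ⟨c, rfl⟩, ⟨d, rfl⟩⟩
    exact ⟨(a, b, c, d), rfl⟩
  · rintro ⟨⟨a', b', c', d'⟩, h⟩
    simp only [Prod.smul_mk, smul_eq_mul, Prod.mk.injEq] at h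
    obtain ⟨rfl, rfl, rfl, rfl⟩ := h
    exact ⟨⟨_, rfl⟩, ⟨_, rfl⟩, ⟨_, rfl⟩, ⟨_, rfl⟩⟩

lemma dvdAll_act (k : ℤ) (γ : Matrix (Fin 2) (Fin 2) ℤ) (f : BCF) (h : dvdAll k f) :
    dvdAll k (act γ f) := by
  rw [dvdAll_iff] at *
  obtain ⟨g, rfl⟩ := h
  exact ⟨act γ g, act_smul _ _ _⟩

lemma dvdAll_act_iff (k : ℤ) (γ : Matrix (Fin 2) (Fin 2) ℤ) (hγ : γ.det = 1) (f : BCF) :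
    dvdAll k (act γ f) ↔ dvdAll k f :=
  ⟨fun h => by simpa [act_adj γ hγ] using dvdAll_act k γ.adjugate _ h, dvdAll_act k γ f⟩

lemma act_add (γ : Matrix (Fin 2) (Fin 2) ℤ) (f g : BCF) : act γ (f + g) = act γ f + act γ g := by
  obtain ⟨a, b, c, d⟩ := f
  obtain ⟨a', b', c', d'⟩ := g
  simp only [act, Prod.mk_add_mk]
  ext <;> simp only <;> ring

def Mr (p r : ℕ) : Matrix (Fin 2) (Fin 2) ℤ := if r = p then !![0, 1; -1, 0] else !![1, (r : ℤ); 0, 1]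

lemma Mr_det (p r : ℕ) : (Mr p r).det = 1 := by
  unfold Mr; split_ifs <;> simp [Matrix.det_fin_two]

def isL (p : ℕ) (f : BCF) : Prop := (p : ℤ) ^ 2 ∣ f.1 ∧ (p : ℤ) ∣ f.2.1
def isT (p : ℕ) (f : BCF) : Prop := (p : ℤ) ∣ f.1 ∧ (p : ℤ) ∣ f.2.1 ∧ (p : ℤ) ∣ f.2.2.1

lemma exists_inv_mod {p : ℕ} (hp : p.Prime) (α g : ℤ) (h : ¬ (p : ℤ) ∣ α) :
    ∃ r < p, (p : ℤ) ∣ g - α * r := by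
  have := Fact.mk hp
  have hα : (α : ZMod p) ≠ 0 := by rwa [Ne, ZMod.intCast_zmod_eq_zero_iff_dvd]
  refine ⟨((g : ZMod p) * (α : ZMod p)⁻¹).val, ZMod.val_lt _, ?_⟩
  rw [← ZMod.intCast_zmod_eq_zero_iff_dvd]
  push_cast
  rw [ZMod.natCast_val, ZMod.cast_id]
  field_simp
  simp

lemma exists_Mr {p : ℕ} (hp : p.Prime) (γ : Matrix (Fin 2) (Fin 2) ℤ) :
    ∃ r ∈ Finset.range (p + 1), ∃ τ : Matrix (Fin 2) (Fin 2) ℤ, (p : ℤ) ∣ τ 0 1 ∧ γ = τ * Mr p r := by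
  have key : ∀ r, γ = (γ * (Mr p r).adjugate) * Mr p r := by
    intro r; rw [Matrix.mul_assoc, Matrix.adjugate_mul, Mr_det]; simp
  by_cases h : (p : ℤ) ∣ γ 0 0
  · refine ⟨p, by simp, _, ?_, key p⟩
    simpa [Mr, Matrix.adjugate_fin_two, Matrix.mul_apply] using h
  · obtain ⟨r, hr, h'⟩ := exists_inv_mod hp (γ 0 0) (γ 0 1) h
    refine ⟨r, by simp; omega, _, ?_, key r⟩
    have : r ≠ p := by omega
    simp only [Mr, this, if_false]
    simp only [Matrix.adjugate_fin_two, Matrix.mul_apply, Fin.sum_univ_two]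
    simp
    have e : -(γ 0 0 * (r : ℤ)) + γ 0 1 = γ 0 1 - γ 0 0 * r := by ring
    rw [e]; exact h'

lemma uniq_aux {p : ℕ} (hp : p.Prime) (γ : Matrix (Fin 2) (Fin 2) ℤ) (hγ : γ.det = 1)
    (hg : ¬ (p : ℤ) ∣ γ 0 1) (f : BCF) (h1 : (p : ℤ) ∣ f.1) (h2 : (p : ℤ) ∣ f.2.1)
    (h3 : (p : ℤ) ∣ (act γ f).1) (h4 : (p : ℤ) ∣ (act γ f).2.1) : dvdAll p f := by
  obtain ⟨a, b, c, d⟩ := f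
  have := Fact.mk hp
  have hd := det_two γ hγ
  rw [act_eq γ hγ] at h3 h4
  simp only at h1 h2 h3 h4
  simp only [dvdAll]
  simp only [← ZMod.intCast_zmod_eq_zero_iff_dvd] at *
  have hd' : (γ 0 0 : ZMod p) * γ 1 1 - γ 0 1 * γ 1 0 = 1 := by exact_mod_cast congrArg (Int.cast : ℤ → ZMod p) hd
  push_cast at *
  rw [h1, h2] at h3 h4
  have e1 : (c : ZMod p) * γ 0 0 + d * γ 0 1 = 0 := by
    have : (γ 0 1 : ZMod p) ^ 2 * ((c : ZMod p) * γ 0 0 + d * γ 0 1) = 0 := by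
      rw [← h3]; ring
    rcases mul_eq_zero.mp this with h | h
    · exact absurd (pow_eq_zero_iff (two_ne_zero) |>.mp h) hg
    · exact h
  have e2 : (c : ZMod p) * (2 * γ 0 0 * γ 1 1 + γ 1 0 * γ 0 1) + 3 * d * γ 0 1 * γ 1 1 = 0 := by
    have : (γ 0 1 : ZMod p) * ((c : ZMod p) * (2 * γ 0 0 * γ 1 1 + γ 1 0 * γ 0 1) + 3 * d * γ 0 1 * γ 1 1) = 0 := by
      rw [← h4]; ring
    rcases mul_eq_zero.mp this with h | h
    · exact absurd h hg
    · exact h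
  have e3 : (c : ZMod p) = 0 := by
    linear_combination (3 * (γ 1 1 : ZMod p)) * e1 - e2 - (c : ZMod p) * hd'
  have e4 : (d : ZMod p) = 0 := by
    rw [e3] at e1
    have : (d : ZMod p) * γ 0 1 = 0 := by rw [← e1]; ring
    rcases mul_eq_zero.mp this with h | h
    · exact h
    · exact absurd h hg
  exact ⟨h1, h2, e3, e4⟩

lemma Mr_uniq {p : ℕ} (hp : p.Prime) {r s : ℕ} (hr : r ∈ Finset.range (p + 1))
    (hs : s ∈ Finset.range (p + 1)) (hrs : r ≠ s) (f : BCF)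
    (h1 : (p : ℤ) ∣ (act (Mr p r) f).1) (h2 : (p : ℤ) ∣ (act (Mr p r) f).2.1)
    (h3 : (p : ℤ) ∣ (act (Mr p s) f).1) (h4 : (p : ℤ) ∣ (act (Mr p s) f).2.1) : dvdAll p f := by
  rw [← dvdAll_act_iff p (Mr p r) (Mr_det p r)]
  have e : act (Mr p s * (Mr p r).adjugate) (act (Mr p r) f) = act (Mr p s) f := by
    rw [act_mul, act_adj _ (Mr_det p r)]
  refine uniq_aux hp (Mr p s * (Mr p r).adjugate) ?_ ?_ _ h1 h2 (by rwa [e]) (by rwa [e])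
  · rw [Matrix.det_mul, Mr_det, det_adj _ (Mr_det p r)]; rfl
  · rw [Finset.mem_range] at hr hs
    intro hd
    have hp2 := hp.two_le
    unfold Mr at hd
    split_ifs at hd with h h' h'
    · omega
    · simp [Matrix.adjugate_fin_two, Matrix.mul_apply] at hd
      have := Int.le_of_dvd one_pos hd; omega
    · simp [Matrix.adjugate_fin_two, Matrix.mul_apply] at hd
      have := Int.le_of_dvd one_pos hd; omega
    · simp [Matrix.adjugate_fin_two, Matrix.mul_apply] at hd
      have h5 : (s : ℤ) - r ≠ 0 := by omega
      rw [show (-(r : ℤ) + s) = s - r by ring] at hd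
      have := Int.le_of_dvd (abs_pos.mpr h5) ((dvd_abs _ _).mpr hd)
      have h6 : |(s : ℤ) - r| < p := by rw [abs_lt]; omega
      omega

lemma isL_stable {p : ℕ} (τ : Matrix (Fin 2) (Fin 2) ℤ) (hτ : (p : ℤ) ∣ τ 0 1) (f : BCF)
    (h : isL p f) : isL p (act τ f) := by
  have := pos_stable (P := (p : ℤ) ^ 2) (Q := p) (R := 1) τ p hτ (dvd_pow_self _ two_ne_zero)
    (one_dvd _) (by rw [sq]) (by simp) (one_dvd _) f h.1 h.2 (one_dvd _)
  exact ⟨this.1, this.2.1⟩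

lemma isL_of_act {p : ℕ} (hp : p.Prime) (γ : Matrix (Fin 2) (Fin 2) ℤ)
    (hγ : γ.det = 1 ∨ γ.det = -1) (f : BCF) (h : isL p (act γ f)) :
    ∃ r ∈ Finset.range (p + 1), isL p (act (Mr p r) f) := by
  obtain ⟨r, hr, τ, hτ, e⟩ := exists_Mr hp γ
  refine ⟨r, hr, ?_⟩
  have hd : τ.det = γ.det := by rw [e, Matrix.det_mul, Mr_det, mul_one]
  have h2 : act τ.adjugate (act γ f) = act (Mr p r) f ∨ act (-τ.adjugate) (act γ f) = act (Mr p r) f := by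
    rw [e, act_mul]
    rcases hγ with h | h
    · left; exact act_adj τ (hd.trans h) _
    · right
      rw [← act_mul, Matrix.neg_mul, Matrix.adjugate_mul, hd, h]; simp [act_one]
  rcases h2 with h2 | h2
  · rw [← h2]; refine isL_stable _ ?_ _ h
    simpa [Matrix.adjugate_fin_two] using hτ
  · rw [← h2]; refine isL_stable _ ?_ _ h
    simpa [Matrix.adjugate_fin_two] using hτ

lemma isT_iff {p : ℕ} (hp : p.Prime) (f : BCF) :
    (∃ s l₁ l₂ : ZMod p,
    (f.1 : ZMod p) = s * l₁ ^ 3 ∧ (f.2.1 : ZMod p) = 3 * s * l₁ ^ 2 * l₂ ∧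
    (f.2.2.1 : ZMod p) = 3 * s * l₁ * l₂ ^ 2 ∧ (f.2.2.2 : ZMod p) = s * l₂ ^ 3) ↔
    ∃ r ∈ Finset.range (p + 1), isT p (act (Mr p r) f) := by
  obtain ⟨a, b, c, d⟩ := f
  have := Fact.mk hp
  simp only
  constructor
  · rintro ⟨s, l₁, l₂, h1, h2, h3, h4⟩
    by_cases hl : l₂ = 0
    · refine ⟨p, by simp, ?_⟩
      subst hl
      simp only [ne_eq, OfNat.ofNat_ne_zero, not_false_eq_true, zero_pow, mul_zero] at h2 h3 h4
      rw [ZMod.intCast_zmod_eq_zero_iff_dvd] at h2 h3 h4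
      simp [isT, Mr, act, Matrix.det_fin_two, h2, h3, h4]
    · obtain ⟨r, hr, hrv⟩ : ∃ r : ℕ, r < p ∧ (r : ZMod p) = -l₁ * l₂⁻¹ :=
        ⟨(-l₁ * l₂⁻¹).val, ZMod.val_lt _, by rw [ZMod.natCast_val, ZMod.cast_id]⟩
      refine ⟨r, by simp; omega, ?_⟩
      rw [isT, act_eq _ (Mr_det _ _)]
      have hne : r ≠ p := by omega
      simp only [← ZMod.intCast_zmod_eq_zero_iff_dvd]
      simp only [Mr, hne, if_false]
      simp
      simp only [hrv, h1, h2, h3, h4]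
      refine ⟨?_, ?_, ?_⟩ <;> field_simp <;> ring
  · rintro ⟨r, hr, h1, h2, h3⟩
    rw [act_eq _ (Mr_det _ _)] at h1 h2 h3
    simp only [← ZMod.intCast_zmod_eq_zero_iff_dvd] at h1 h2 h3
    unfold Mr at h1 h2 h3
    split_ifs at h1 h2 h3 with h
    · simp at h1 h2 h3
      exact ⟨a, 1, 0, by simp [h1, h2, h3]⟩
    · simp at h1 h2 h3
      refine ⟨d, -r, 1, ?_, ?_, ?_, by ring⟩
      · linear_combination h1 - r * h2 + r ^ 2 * h3
      · linear_combination h2 - 2 * r * h3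
      · linear_combination h3

lemma not_inVp_iff {p : ℕ} (hp : p.Prime) (f : BCF) : ¬ inVp p f ↔
    dvdAll p f ∨ ∃ r ∈ Finset.range (p + 1), isL p (act (Mr p r) f) ∨ isT p (act (Mr p r) f) := by
  rw [inVp, isT_iff hp, inUp]
  constructor
  · intro h
    by_contra hc
    push Not at hc
    apply h
    refine ⟨⟨hc.1, fun γ hγ hL => ?_⟩, ?_⟩
    · obtain ⟨r, hr, h'⟩ := isL_of_act hp γ hγ f hL
      exact (hc.2 r hr).1 h'
    · rintro ⟨r, hr, h'⟩
      exact (hc.2 r hr).2 h'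
  · rintro (h | ⟨r, hr, h | h⟩) ⟨⟨h1, h2⟩, h3⟩
    · exact h1 h
    · exact h2 _ (Or.inl (Mr_det p r)) h
    · exact h3 ⟨r, hr, h⟩

def ind (P : Prop) : ℂ := if P then 1 else 0

lemma ind_identity {p : ℕ} (hp : p.Prime) (f : BCF) :
    ind (¬ inVp p f) = ind (dvdAll p f) + ∑ r ∈ Finset.range (p + 1),
      (ind (isL p (act (Mr p r) f)) + ind (isT p (act (Mr p r) f))
        - ind (isL p (act (Mr p r) f) ∧ isT p (act (Mr p r) f)) - ind (dvdAll p (act (Mr p r) f))) := by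
  rw [not_inVp_iff hp]
  by_cases h : dvdAll p f
  · have : ∀ r, isT p (act (Mr p r) f) := fun r => by
      have := dvdAll_act p (Mr p r) f h
      exact ⟨this.1, this.2.1, this.2.2.1⟩
    have h' : ∀ r, dvdAll p (act (Mr p r) f) := fun r => dvdAll_act p (Mr p r) f h
    simp [ind, h, this, h']
  · have h' : ∀ r, ¬ dvdAll p (act (Mr p r) f) := fun r => by rwa [dvdAll_act_iff _ _ (Mr_det p r)]
    have hs : ∀ r, (ind (isL p (act (Mr p r) f)) + ind (isT p (act (Mr p r) f))
        - ind (isL p (act (Mr p r) f) ∧ isT p (act (Mr p r) f)) - ind (dvdAll p (act (Mr p r) f)))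
        = ind (isL p (act (Mr p r) f) ∨ isT p (act (Mr p r) f)) := by
      intro r
      by_cases h1 : isL p (act (Mr p r) f) <;> by_cases h2 : isT p (act (Mr p r) f) <;>
        simp [ind, h1, h2, h']
    simp only [hs, h, false_or]
    have hE : ∀ r, isL p (act (Mr p r) f) ∨ isT p (act (Mr p r) f) →
        (p : ℤ) ∣ (act (Mr p r) f).1 ∧ (p : ℤ) ∣ (act (Mr p r) f).2.1 := by
      rintro r (h | h)
      · exact ⟨(dvd_pow_self _ two_ne_zero).trans h.1, h.2⟩
      · exact ⟨h.1, h.2.1⟩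
    by_cases hex : ∃ r ∈ Finset.range (p + 1), isL p (act (Mr p r) f) ∨ isT p (act (Mr p r) f)
    · have hex' := hex
      obtain ⟨r, hr, hr'⟩ := hex'
      rw [Finset.sum_eq_single r]
      · simp only [ind, if_pos hex, if_pos hr', if_false, zero_add]
      · intro s hs' hsr
        have : ¬ (isL p (act (Mr p s) f) ∨ isT p (act (Mr p s) f)) := fun hc =>
          h (Mr_uniq hp hs' hr hsr f (hE s hc).1 (hE s hc).2 (hE r hr').1 (hE r hr').2)
        simp [ind, this]
      · intro hc; exact absurd hr hc
    · rw [Finset.sum_eq_zero]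
      · simp only [ind, if_neg hex, if_false, zero_add]
      · intro r hr
        push Not at hex
        have := hex r hr
        simp [ind, this]

end BCF

namespace BCF

/-- The periodic box. -/
def box (n : ℕ) : Finset (ℕ × ℕ × ℕ × ℕ) :=
  Finset.range n ×ˢ Finset.range n ×ˢ Finset.range n ×ˢ Finset.range n

def toB (y : ℕ × ℕ × ℕ × ℕ) : BCF := (y.1, y.2.1, y.2.2.1, y.2.2.2)

lemma box_card (n : ℕ) : (box n).card = n ^ 4 := by
  simp [box, Finset.card_product]; ring

def Per (n : ℕ) (F : BCF → ℂ) : Prop := ∀ f g : BCF, dvdAll n (f - g) → F f = F g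

lemma sum_perm {ι : Type*} (n : ℕ) (hn : 0 < n) (F : BCF → ℂ) (hF : Per n F) (s : Finset ι)
    (hs : s.card = n ^ 4) (φ : ι → BCF)
    (hφ : ∀ i ∈ s, ∀ j ∈ s, dvdAll n (φ i - φ j) → i = j) :
    ∑ i ∈ s, F (φ i) = ∑ y ∈ box n, F (toB y) := by
  have hn' : (0:ℤ) < n := by exact_mod_cast hn
  set ρ : ι → ℕ × ℕ × ℕ × ℕ := fun i => (((φ i).1 % n).toNat, ((φ i).2.1 % n).toNat,
    ((φ i).2.2.1 % n).toNat, ((φ i).2.2.2 % n).toNat) with hρ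
  have hmod : ∀ z : ℤ, ((z % n).toNat : ℤ) = z % n := fun z =>
    Int.toNat_of_nonneg (Int.emod_nonneg _ hn'.ne')
  have hlt : ∀ z : ℤ, (z % n).toNat < n := fun z => by
    have h1 := hmod z; have h2 := Int.emod_lt_of_pos z hn'; omega
  have hd : ∀ z : ℤ, (n : ℤ) ∣ z - ((z % n).toNat : ℤ) := fun z => by
    rw [hmod]; exact Int.dvd_self_sub_emod
  have hto : ∀ i, dvdAll n (φ i - toB (ρ i)) := fun i => ⟨hd _, hd _, hd _, hd _⟩
  have hinj : Set.InjOn ρ s := by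
    intro i hi j hj hij
    apply hφ i hi j hj
    have h1 := hto i
    have h2 := hto j
    rw [hij] at h1
    have e : ∀ a b c : ℤ, (n : ℤ) ∣ a - c → (n : ℤ) ∣ b - c → (n : ℤ) ∣ a - b := by
      intro a b c h h'
      have := dvd_sub h h'
      simpa using this
    exact ⟨e _ _ _ h1.1 h2.1, e _ _ _ h1.2.1 h2.2.1, e _ _ _ h1.2.2.1 h2.2.2.1, e _ _ _ h1.2.2.2 h2.2.2.2⟩
  have him : s.image ρ = box n := by
    apply Finset.eq_of_subset_of_card_le
    · intro y hy
      obtain ⟨i, hi, rfl⟩ := Finset.mem_image.1 hy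
      simp [box, hρ, hlt]
    · rw [Finset.card_image_of_injOn hinj, hs, box_card]
  rw [← him, Finset.sum_image hinj]
  exact Finset.sum_congr rfl fun i _ => hF _ _ (hto i)

lemma toB_inj {n : ℕ} {y z : ℕ × ℕ × ℕ × ℕ} (hy : y ∈ box n) (hz : z ∈ box n)
    (h : dvdAll n (toB y - toB z)) : y = z := by
  simp only [box, Finset.mem_product, Finset.mem_range] at hy hz
  have e : ∀ a b : ℕ, a < n → b < n → (n : ℤ) ∣ (a : ℤ) - b → a = b := by
    intro a b ha hb h
    have := Int.eq_zero_of_abs_lt_dvd h (by rw [abs_lt]; omega)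
    omega
  obtain ⟨h1, h2, h3, h4⟩ := h
  ext
  · exact e _ _ hy.1 hz.1 h1
  · exact e _ _ hy.2.1 hz.2.1 h2
  · exact e _ _ hy.2.2.1 hz.2.2.1 h3
  · exact e _ _ hy.2.2.2 hz.2.2.2 h4

lemma act_sub (γ : Matrix (Fin 2) (Fin 2) ℤ) (f g : BCF) : act γ (f - g) = act γ f - act γ g := by
  obtain ⟨a, b, c, d⟩ := f
  obtain ⟨a', b', c', d'⟩ := g
  simp only [act, Prod.mk_sub_mk]
  ext <;> simp only <;> ring

lemma sum_act (n : ℕ) (hn : 0 < n) (F : BCF → ℂ) (hF : Per n F) (γ : Matrix (Fin 2) (Fin 2) ℤ)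
    (hγ : γ.det = 1) : ∑ y ∈ box n, F (act γ (toB y)) = ∑ y ∈ box n, F (toB y) := by
  apply sum_perm n hn F hF (box n) (box_card n) (fun y => act γ (toB y))
  intro i hi j hj h
  rw [← act_sub, dvdAll_act_iff _ _ hγ] at h
  exact toB_inj hi hj h

/-- additive character -/
def ee (n : ℕ) (k : ℤ) : ℂ := Complex.exp (2 * Real.pi * Complex.I * (k : ℂ) / (n : ℂ))

lemma ee_add (n : ℕ) (k l : ℤ) : ee n (k + l) = ee n k * ee n l := by
  rw [ee, ee, ee, ← Complex.exp_add]; congr 1; push_cast; ring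

lemma ee_norm (n : ℕ) (k : ℤ) : ‖ee n k‖ = 1 := by
  rw [ee, show (2 * Real.pi * Complex.I * (k : ℂ) / (n : ℂ)) = ((2 * Real.pi * k / n : ℝ) : ℂ) * Complex.I by
    push_cast; ring]
  exact Complex.norm_exp_ofReal_mul_I _

lemma ee_eq_one_iff {n : ℕ} (hn : 0 < n) (k : ℤ) : ee n k = 1 ↔ (n : ℤ) ∣ k := by
  have hn' : (n : ℂ) ≠ 0 := by exact_mod_cast hn.ne'
  have hp : (2 * Real.pi * Complex.I : ℂ) ≠ 0 := Complex.two_pi_I_ne_zero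
  rw [ee, Complex.exp_eq_one_iff]
  constructor
  · rintro ⟨m, hm⟩
    refine ⟨m, ?_⟩
    rw [div_eq_iff hn'] at hm
    have : (k : ℂ) = n * m := mul_left_cancel₀ hp (by rw [hm]; ring)
    exact_mod_cast this
  · rintro ⟨m, rfl⟩
    refine ⟨m, ?_⟩
    push_cast
    field_simp

lemma ee_congr {n : ℕ} (hn : 0 < n) {k l : ℤ} (h : (n : ℤ) ∣ k - l) : ee n k = ee n l := by
  have := ee_add n (k - l) l
  rw [sub_add_cancel, (ee_eq_one_iff hn _).2 h, one_mul] at this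
  exact this

lemma ee_mul_nat (n : ℕ) (k : ℤ) (j : ℕ) : ee n (k * j) = ee n k ^ j := by
  rw [ee, ee, ← Complex.exp_nat_mul]; congr 1; push_cast; ring

lemma sum1 (D E : ℕ) (hD : 0 < D) (hE : 0 < E) (k : ℤ) :
    ∑ y ∈ Finset.range (D * E), ind ((D : ℤ) ∣ (y : ℤ)) * ee (D * E) (k * y)
      = if (E : ℤ) ∣ k then (E : ℂ) else 0 := by
  have h1 : ∑ y ∈ Finset.range (D * E), ind ((D : ℤ) ∣ (y : ℤ)) * ee (D * E) (k * y)
      = ∑ j ∈ Finset.range E, ee E k ^ j := by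
    have : ∀ y ∈ Finset.range (D * E), ind ((D : ℤ) ∣ (y : ℤ)) * ee (D * E) (k * y) =
        if D ∣ y then ee (D * E) (k * y) else 0 := by
      intro y _
      by_cases h : D ∣ y
      · simp [ind, Int.natCast_dvd_natCast, h]
      · simp [ind, Int.natCast_dvd_natCast, h]
    rw [Finset.sum_congr rfl this, ← Finset.sum_filter]
    symm
    refine Finset.sum_bij (fun j _ => D * j) ?_ ?_ ?_ ?_
    · intro j hj
      simp only [Finset.mem_filter, Finset.mem_range] at *
      exact ⟨Nat.mul_lt_mul_of_pos_left hj hD, dvd_mul_right _ _⟩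
    · intro i _ j _ h
      exact Nat.eq_of_mul_eq_mul_left hD h
    · intro y hy
      simp only [Finset.mem_filter, Finset.mem_range] at *
      obtain ⟨h, j, rfl⟩ := hy
      exact ⟨j, Nat.lt_of_mul_lt_mul_left h, rfl⟩
    · intro j _
      rw [← ee_mul_nat, ee, ee]
      congr 1
      have : (D : ℂ) ≠ 0 := by exact_mod_cast hD.ne'
      have : (E : ℂ) ≠ 0 := by exact_mod_cast hE.ne'
      push_cast
      field_simp
  rw [h1]
  split_ifs with h
  · simp [(ee_eq_one_iff hE k).2 h]
  · have hne : ee E k ≠ 1 := fun hc => h ((ee_eq_one_iff hE k).1 hc)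
    rw [geom_sum_eq hne, ← ee_mul_nat, (ee_eq_one_iff hE _).2 (dvd_mul_left _ _)]
    simp

def pairZ (x y : BCF) : ℤ :=
  x.2.2.2 * y.1 + (-(x.2.2.1 / 3)) * y.2.1 + (x.2.1 / 3) * y.2.2.1 + (-x.1) * y.2.2.2

lemma pairQ_eq (x y : BCF) (hx : inDual x) : pairQ x y = pairZ x y := by
  obtain ⟨a, b, c, d⟩ := x
  obtain ⟨⟨b, rfl⟩, ⟨c, rfl⟩⟩ := hx
  simp only [pairQ, pairZ]
  rw [Int.mul_ediv_cancel_left _ (by norm_num), Int.mul_ediv_cancel_left _ (by norm_num)]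
  push_cast
  ring

lemma pairZ_act (γ : Matrix (Fin 2) (Fin 2) ℤ) (hγ : γ.det = 1) (x y : BCF) (hx : inDual x) :
    pairZ (act γ x) (act γ y) = pairZ x y := by
  have h3 : ∀ x y, inDual x → 3 * pairZ x y =
      3 * x.2.2.2 * y.1 - x.2.2.1 * y.2.1 + x.2.1 * y.2.2.1 - 3 * x.1 * y.2.2.2 := by
    rintro ⟨a, b, c, d⟩ y ⟨⟨b, rfl⟩, ⟨c, rfl⟩⟩
    simp only [pairZ]
    rw [Int.mul_ediv_cancel_left _ (by norm_num), Int.mul_ediv_cancel_left _ (by norm_num)]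
    ring
  have : 3 * pairZ (act γ x) (act γ y) = 3 * pairZ x y := by
    rw [h3 _ _ hx, h3 _ _ (inDual_act γ x hx)]
    obtain ⟨a, b, c, d⟩ := x
    obtain ⟨a', b', c', d'⟩ := y
    have h1 := det_two γ hγ
    rw [act_eq γ hγ, act_eq γ hγ]
    simp only
    have e : 3 * d * a' - c * b' + b * c' - 3 * a * d' = (γ 0 0 * γ 1 1 - γ 0 1 * γ 1 0) ^ 3 *
      (3 * d * a' - c * b' + b * c' - 3 * a * d') := by rw [h1]; ring
    rw [e]; ring
  omega

lemma pairZ_lin (x y z : BCF) (k l : ℤ) :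
    pairZ x (k • y + l • z) = k * pairZ x y + l * pairZ x z := by
  simp only [pairZ, Prod.fst_add, Prod.snd_add, Prod.smul_fst, Prod.smul_snd, smul_eq_mul]; ring

lemma pairZ_sub_dvd (n : ℤ) (x y z : BCF) (h : dvdAll n (y - z)) : n ∣ pairZ x y - pairZ x z := by
  have : pairZ x y - pairZ x z = x.2.2.2 * (y - z).1 + (-(x.2.2.1 / 3)) * (y - z).2.1
    + (x.2.1 / 3) * (y - z).2.2.1 + (-x.1) * (y - z).2.2.2 := by
    simp only [pairZ, Prod.fst_sub, Prod.snd_sub]; ring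
  rw [this]
  exact dvd_add (dvd_add (dvd_add (h.1.mul_left _) (h.2.1.mul_left _)) (h.2.2.1.mul_left _))
    (h.2.2.2.mul_left _)

lemma PhiHat'_eq (q : ℕ) (x : BCF) (hx : inDual x) : PhiHat' q x =
    ((q : ℂ) ^ 8)⁻¹ * ∑ y ∈ box (q ^ 2), ind (outVpAll q (toB y)) * ee (q ^ 2) (pairZ x (toB y)) := by
  rw [PhiHat', box, Finset.sum_product]
  congr 1
  apply Finset.sum_congr rfl; intro y1 _
  rw [Finset.sum_product]
  apply Finset.sum_congr rfl; intro y2 _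
  rw [Finset.sum_product]
  apply Finset.sum_congr rfl; intro y3 _
  apply Finset.sum_congr rfl; intro y4 _
  rw [pairQ_eq _ _ hx]
  by_cases h : outVpAll q ((y1 : ℤ), (y2 : ℤ), (y3 : ℤ), (y4 : ℤ)) <;> simp [ind, toB, ee, h]

lemma notV_congr {p : ℕ} (hp : p.Prime) (k : ℤ) (hk : ¬ (p : ℤ) ∣ k) (f g : BCF)
    (h : dvdAll ((p : ℤ) ^ 2) (f - k • g)) : inVp p f ↔ inVp p g := by
  rw [← not_iff_not, not_inVp_iff hp, not_inVp_iff hp]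
  have hpp : Prime (p : ℤ) := Nat.prime_iff_prime_int.1 hp
  have c1 : ∀ a b : ℤ, (p : ℤ) ^ 2 ∣ a - k * b → ((p : ℤ) ∣ a ↔ (p : ℤ) ∣ b) := by
    intro a b h
    have h' : (p : ℤ) ∣ a - k * b := (dvd_pow_self _ two_ne_zero).trans h
    rw [dvd_iff_dvd_of_dvd_sub h', hpp.dvd_mul]
    tauto
  have c2 : ∀ a b : ℤ, (p : ℤ) ^ 2 ∣ a - k * b → ((p : ℤ) ^ 2 ∣ a ↔ (p : ℤ) ^ 2 ∣ b) := by
    intro a b h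
    rw [dvd_iff_dvd_of_dvd_sub h]
    have : IsCoprime ((p : ℤ) ^ 2) k :=
      IsCoprime.pow_left ((Prime.coprime_iff_not_dvd hpp).2 hk)
    exact ⟨fun h => this.dvd_of_dvd_mul_left h, fun h => h.mul_left _⟩
  have key : ∀ γ, dvdAll ((p : ℤ) ^ 2) (act γ f - k • act γ g) := fun γ => by
    rw [← act_smul, ← act_sub]; exact dvdAll_act _ _ _ h
  refine or_congr ?_ (exists_congr fun r => and_congr_right fun _ => or_congr ?_ ?_)
  · exact and_congr (c1 _ _ h.1) (and_congr (c1 _ _ h.2.1) (and_congr (c1 _ _ h.2.2.1) (c1 _ _ h.2.2.2)))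
  · have h := key (Mr p r)
    exact and_congr (c2 _ _ h.1) (c1 _ _ h.2.1)
  · have h := key (Mr p r)
    exact and_congr (c1 _ _ h.1) (and_congr (c1 _ _ h.2.1) (c1 _ _ h.2.2.1))

end BCF

namespace BCF

lemma dvdAll_mono {k l : ℤ} (h : k ∣ l) {f : BCF} (hf : dvdAll l f) : dvdAll k f :=
  ⟨h.trans hf.1, h.trans hf.2.1, h.trans hf.2.2.1, h.trans hf.2.2.2⟩

lemma outVpAll_congr (m : ℕ) (k : ℤ) (hk : ∀ p : ℕ, p.Prime → p ∣ m → ¬ (p : ℤ) ∣ k) (f g : BCF)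
    (h : dvdAll ((m : ℤ) ^ 2) (f - k • g)) : outVpAll m f ↔ outVpAll m g := by
  refine forall_congr' fun p => forall_congr' fun hp => forall_congr' fun hpm => not_congr ?_
  exact notV_congr hp k (hk p hp hpm) f g
    (dvdAll_mono (pow_dvd_pow_of_dvd (Int.natCast_dvd_natCast.2 hpm) 2) h)

lemma Per_Phi (m : ℕ) (hm : 0 < m) (x : BCF) :
    Per (m ^ 2) (fun y => ind (outVpAll m y) * ee (m ^ 2) (pairZ x y)) := by
  intro f g h
  simp only
  rw [ee_congr (pow_pos hm 2) (pairZ_sub_dvd _ x f g h)]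
  congr 1
  have : outVpAll m f ↔ outVpAll m g := by
    apply outVpAll_congr m 1 (fun p hp _ h => hp.one_lt.ne' (by
      have := Int.natCast_dvd_natCast.1 (by exact_mod_cast h : (p : ℤ) ∣ ((1 : ℕ) : ℤ))
      simpa using this))
    rw [one_smul]; exact_mod_cast h
  simp only [ind, this]

lemma dvdAll_cancel {n k : ℤ} (h : IsCoprime n k) {f : BCF} (hf : dvdAll n (k • f)) : dvdAll n f :=
  ⟨h.dvd_of_dvd_mul_left hf.1, h.dvd_of_dvd_mul_left hf.2.1, h.dvd_of_dvd_mul_left hf.2.2.1,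
    h.dvd_of_dvd_mul_left hf.2.2.2⟩

lemma dvdAll_sub {n : ℤ} {f g : BCF} (hf : dvdAll n f) (hg : dvdAll n g) : dvdAll n (f - g) :=
  ⟨dvd_sub hf.1 hg.1, dvd_sub hf.2.1 hg.2.1, dvd_sub hf.2.2.1 hg.2.2.1, dvd_sub hf.2.2.2 hg.2.2.2⟩

lemma dvdAll_smul (n : ℤ) (f : BCF) : dvdAll n (n • f) := (dvdAll_iff _ _).2 ⟨f, rfl⟩

lemma Phi_mul (m n : ℕ) (hm : 0 < m) (hn : 0 < n) (h : Nat.Coprime m n) (x : BCF) (hx : inDual x) :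
    PhiHat' (m * n) x = PhiHat' m x * PhiHat' n x := by
  rw [PhiHat'_eq _ x hx, PhiHat'_eq _ x hx, PhiHat'_eq _ x hx]
  have hc : IsCoprime ((m : ℤ) ^ 2) ((n : ℤ) ^ 2) := (Nat.isCoprime_iff_coprime.2 h).pow
  have hmn : 0 < m * n := Nat.mul_pos hm hn
  have key := sum_perm ((m * n) ^ 2) (pow_pos hmn 2) _ (Per_Phi (m * n) hmn x)
    (box (m ^ 2) ×ˢ box (n ^ 2)) (by rw [Finset.card_product, box_card, box_card]; ring)
    (fun y => ((n : ℤ) ^ 2) • toB y.1 + ((m : ℤ) ^ 2) • toB y.2) (by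
      rintro ⟨y, z⟩ hi ⟨y', z'⟩ hj h
      simp only [Finset.mem_product] at hi hj h
      have h' : dvdAll (((m : ℤ) ^ 2) * ((n : ℤ) ^ 2)) ((n : ℤ) ^ 2 • (toB y - toB y') + (m : ℤ) ^ 2 • (toB z - toB z')) := by
        convert h using 1
        · push_cast; ring
        · rw [smul_sub, smul_sub]; abel
      have h1 : dvdAll ((m : ℤ) ^ 2) ((n : ℤ) ^ 2 • (toB y - toB y')) := by
        have := dvdAll_sub (dvdAll_mono (dvd_mul_right _ _) h') (dvdAll_smul ((m : ℤ) ^ 2) (toB z - toB z'))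
        simpa using this
      have h2 : dvdAll ((n : ℤ) ^ 2) ((m : ℤ) ^ 2 • (toB z - toB z')) := by
        have := dvdAll_sub (dvdAll_mono (dvd_mul_left _ _) h') (dvdAll_smul ((n : ℤ) ^ 2) (toB y - toB y'))
        simpa using this
      have e1 := toB_inj hi.1 hj.1 (by have := dvdAll_cancel hc h1; exact_mod_cast this)
      have e2 := toB_inj hi.2 hj.2 (by have := dvdAll_cancel hc.symm h2; exact_mod_cast this)
      rw [e1, e2])
  rw [← key, Finset.sum_product, mul_mul_mul_comm, Finset.sum_mul_sum]
  have e8 : (((m * n : ℕ) : ℂ) ^ 8)⁻¹ = ((m : ℂ) ^ 8)⁻¹ * ((n : ℂ) ^ 8)⁻¹ := by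
    push_cast; rw [mul_pow, mul_inv]
  rw [e8]
  congr 1
  apply Finset.sum_congr rfl; intro y _
  apply Finset.sum_congr rfl; intro z _
  have nd : ∀ {p m n : ℕ}, p.Prime → p ∣ m → Nat.Coprime m n → ¬ (p : ℤ) ∣ (n : ℤ) ^ 2 := by
    intro p m n hp hpm h hd
    have : p ∣ n := hp.dvd_of_dvd_pow (by exact_mod_cast hd)
    have := Nat.dvd_gcd hpm this
    rw [h] at this
    exact hp.one_lt.ne' (by simpa using this)
  have hout : outVpAll (m * n) ((n : ℤ) ^ 2 • toB y + (m : ℤ) ^ 2 • toB z) ↔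
      outVpAll m (toB y) ∧ outVpAll n (toB z) := by
    have h1 := outVpAll_congr m ((n : ℤ) ^ 2) (fun p hp hpm => nd hp hpm h)
      ((n : ℤ) ^ 2 • toB y + (m : ℤ) ^ 2 • toB z) (toB y) (by
        rw [add_sub_cancel_left]; exact dvdAll_smul _ _)
    have h2 := outVpAll_congr n ((m : ℤ) ^ 2) (fun p hp hpm => nd hp hpm h.symm)
      ((n : ℤ) ^ 2 • toB y + (m : ℤ) ^ 2 • toB z) (toB z) (by
        rw [add_sub_cancel_right]; exact dvdAll_smul _ _)
    rw [← h1, ← h2]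
    constructor
    · intro h
      exact ⟨fun p hp hd => h p hp (hd.mul_right _), fun p hp hd => h p hp (hd.mul_left _)⟩
    · rintro ⟨h, h'⟩ p hp hd
      rcases (hp.dvd_mul).1 hd with hd | hd
      · exact h p hp hd
      · exact h' p hp hd
  have hee : ee ((m * n) ^ 2) (pairZ x ((n : ℤ) ^ 2 • toB y + (m : ℤ) ^ 2 • toB z)) =
      ee (m ^ 2) (pairZ x (toB y)) * ee (n ^ 2) (pairZ x (toB z)) := by
    rw [pairZ_lin, ee_add]
    have : (m : ℂ) ≠ 0 := by exact_mod_cast hm.ne'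
    have : (n : ℂ) ≠ 0 := by exact_mod_cast hn.ne'
    congr 1
    · rw [ee, ee]; congr 1; push_cast; field_simp
    · rw [ee, ee]; congr 1; push_cast; field_simp
  simp only [hee, ind, hout]
  by_cases h1 : outVpAll m (toB y) <;> by_cases h2 : outVpAll n (toB z) <;> simp [h1, h2]

lemma Phi_one (x : BCF) (hx : inDual x) : PhiHat' 1 x = 1 := by
  rw [PhiHat'_eq _ x hx]
  have : outVpAll 1 (0, 0, 0, 0) := fun p hp hd => absurd (Nat.dvd_one.1 hd) hp.one_lt.ne'
  simp [box, ind, toB, ee, pairZ, this]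

lemma Phi_prod (s : Finset ℕ) (hs : ∀ p ∈ s, p.Prime) (x : BCF) (hx : inDual x) :
    PhiHat' (∏ p ∈ s, p) x = ∏ p ∈ s, PhiHat' p x := by
  induction s using Finset.induction_on with
  | empty => simpa using Phi_one x hx
  | insert a s ha ih =>
    have hs' : ∀ p ∈ s, p.Prime := fun p hp => hs p (Finset.mem_insert_of_mem hp)
    have hpa : a.Prime := hs a (Finset.mem_insert_self _ _)
    rw [Finset.prod_insert ha, Finset.prod_insert ha, Phi_mul _ _ hpa.pos
      (Finset.prod_pos fun p hp => (hs' p hp).pos) ?_ x hx, ih hs']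
    apply Nat.Coprime.prod_right
    intro p hp
    exact (Nat.coprime_primes hpa (hs' p hp)).2 (fun e => ha (e ▸ hp))

lemma ind_norm (P : Prop) : ‖ind P‖ ≤ 1 := by unfold ind; split_ifs <;> simp

lemma Phi_le_one (q : ℕ) (hq : 0 < q) (x : BCF) (hx : inDual x) : ‖PhiHat' q x‖ ≤ 1 := by
  rw [PhiHat'_eq _ x hx, norm_mul]
  have h : ‖∑ y ∈ box (q ^ 2), ind (outVpAll q (toB y)) * ee (q ^ 2) (pairZ x (toB y))‖ ≤ (q : ℝ) ^ 8 := by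
    refine (norm_sum_le _ _).trans ((Finset.sum_le_card_nsmul _ _ 1 fun y _ => ?_).trans ?_)
    · rw [norm_mul, ee_norm, mul_one]; exact ind_norm _
    · rw [box_card]; simp; apply le_of_eq; ring
  have hq' : (0:ℝ) < (q : ℝ) ^ 8 := by positivity
  rw [norm_inv, norm_pow, Complex.norm_natCast]
  calc _ ≤ ((q : ℝ) ^ 8)⁻¹ * (q : ℝ) ^ 8 := by gcongr
    _ = 1 := inv_mul_cancel₀ hq'.ne'

end BCF

namespace BCF

def rind (P : Prop) : ℝ := if P then 1 else 0

lemma rind_nonneg (P : Prop) : 0 ≤ rind P := by unfold rind; split_ifs <;> simp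
lemma rind_le (P : Prop) : rind P ≤ 1 := by unfold rind; split_ifs <;> simp
lemma rind_mono {P Q : Prop} (h : P → Q) : rind P ≤ rind Q := by
  unfold rind; split_ifs <;> first | simp | tauto

lemma ind_and (P Q : Prop) : ind (P ∧ Q) = ind P * ind Q := by
  by_cases h : P <;> by_cases h' : Q <;> simp [ind, h, h']

lemma sum_mul_prod {α β : Type*} (s : Finset α) (t : Finset β) (f : α → ℂ) (g : β → ℂ) :
    (∑ a ∈ s, f a) * (∑ b ∈ t, g b) = ∑ x ∈ s ×ˢ t, f x.1 * g x.2 := by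
  rw [Finset.sum_mul_sum, Finset.sum_product]

/-- lattice Fourier transform -/
lemma lat_sum (n D1 E1 D2 E2 D3 E3 D4 E4 : ℕ) (hn : 0 < n) (h1 : D1 * E1 = n) (h2 : D2 * E2 = n)
    (h3 : D3 * E3 = n) (h4 : D4 * E4 = n) (z : BCF) :
    ∑ y ∈ box n, ind ((D1 : ℤ) ∣ (toB y).1 ∧ (D2 : ℤ) ∣ (toB y).2.1 ∧ (D3 : ℤ) ∣ (toB y).2.2.1 ∧
      (D4 : ℤ) ∣ (toB y).2.2.2) * ee n (pairZ z (toB y)) =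
    (if (E1 : ℤ) ∣ z.2.2.2 then (E1 : ℂ) else 0) * ((if (E2 : ℤ) ∣ -(z.2.2.1 / 3) then (E2 : ℂ) else 0) *
    ((if (E3 : ℤ) ∣ z.2.1 / 3 then (E3 : ℂ) else 0) * (if (E4 : ℤ) ∣ -z.1 then (E4 : ℂ) else 0))) := by
  have pos : ∀ {D E : ℕ}, D * E = n → 0 < D ∧ 0 < E := by
    intro D E h; rw [← h] at hn; exact ⟨Nat.pos_of_mul_pos_right hn, Nat.pos_of_mul_pos_left hn⟩
  have s1 := sum1 D1 E1 (pos h1).1 (pos h1).2 z.2.2.2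
  have s2 := sum1 D2 E2 (pos h2).1 (pos h2).2 (-(z.2.2.1 / 3))
  have s3 := sum1 D3 E3 (pos h3).1 (pos h3).2 (z.2.1 / 3)
  have s4 := sum1 D4 E4 (pos h4).1 (pos h4).2 (-z.1)
  rw [h1] at s1; rw [h2] at s2; rw [h3] at s3; rw [h4] at s4
  rw [← s1, ← s2, ← s3, ← s4, box, sum_mul_prod, sum_mul_prod, sum_mul_prod]
  apply Finset.sum_congr rfl
  rintro ⟨y1, y2, y3, y4⟩ _
  simp only [toB, ind_and, pairZ, ee_add]
  ring


lemma Per_ind (n : ℕ) (hn : 0 < n) (P : BCF → Prop) (hP : ∀ f g, dvdAll n (f - g) → (P f ↔ P g)) (z : BCF) :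
    Per n (fun y => ind (P y) * ee n (pairZ z y)) := by
  intro f g h
  simp only
  rw [ee_congr hn (pairZ_sub_dvd _ z f g h)]
  congr 1
  simp only [ind, hP f g h]

lemma sum_act_ind (n : ℕ) (hn : 0 < n) (P : BCF → Prop) (hP : ∀ f g, dvdAll n (f - g) → (P f ↔ P g))
    (γ : Matrix (Fin 2) (Fin 2) ℤ) (hγ : γ.det = 1) (x : BCF) (hx : inDual x) :
    ∑ y ∈ box n, ind (P (act γ (toB y))) * ee n (pairZ x (toB y)) =
      ∑ y ∈ box n, ind (P (toB y)) * ee n (pairZ (act γ x) (toB y)) := by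
  rw [← sum_act n hn _ (Per_ind n hn P hP (act γ x)) γ hγ]
  apply Finset.sum_congr rfl
  intro y _
  rw [pairZ_act γ hγ _ _ hx]

def Ls (p : ℕ) (z : BCF) : Prop := (p : ℤ) ^ 2 ∣ z.1 ∧ (p : ℤ) ^ 2 ∣ z.2.1 ∧ (p : ℤ) ∣ z.2.2.1
def LTs (p : ℕ) (z : BCF) : Prop := (p : ℤ) ^ 2 ∣ z.1 ∧ (p : ℤ) ∣ z.2.1 ∧ (p : ℤ) ∣ z.2.2.1
def Ts (p : ℕ) (z : BCF) : Prop := (p : ℤ) ^ 2 ∣ z.1 ∧ dvdAll p z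

lemma dvd3 {x : ℤ} {E : ℤ} (h3 : 3 ∣ x) (h : E ∣ x / 3) : E ∣ x := by
  obtain ⟨k, rfl⟩ := h3
  rw [Int.mul_ediv_cancel_left _ (by norm_num)] at h
  exact h.mul_left _

lemma ite_norm (E1 E2 E3 E4 : ℕ) (P1 P2 P3 P4 Q : Prop) [Decidable P1] [Decidable P2]
    [Decidable P3] [Decidable P4] (h : P1 ∧ P2 ∧ P3 ∧ P4 → Q) (t : ℝ)
    (ht : (E1 : ℝ) * (E2 * (E3 * E4)) = t) :
    ‖(if P1 then (E1 : ℂ) else 0) * ((if P2 then (E2 : ℂ) else 0) *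
    ((if P3 then (E3 : ℂ) else 0) * (if P4 then (E4 : ℂ) else 0)))‖ ≤ t * rind Q := by
  subst ht
  by_cases h1 : P1
  · by_cases h2 : P2
    · by_cases h3 : P3
      · by_cases h4 : P4
        · have := h ⟨h1, h2, h3, h4⟩
          simp [h1, h2, h3, h4, this, rind]
        all_goals simp [h1, h2, h3, h4]; exact mul_nonneg (by positivity) (rind_nonneg _)
      all_goals simp [h1, h2, h3]; exact mul_nonneg (by positivity) (rind_nonneg _)
    all_goals simp [h1, h2]; exact mul_nonneg (by positivity) (rind_nonneg _)
  all_goals simp [h1]; exact mul_nonneg (by positivity) (rind_nonneg _)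

lemma sum_pV {p : ℕ} (hp : 0 < p) (z : BCF) (hz : inDual z) :
    ‖∑ y ∈ box (p ^ 2), ind (dvdAll p (toB y)) * ee (p ^ 2) (pairZ z (toB y))‖ ≤ p ^ 4 * rind (dvdAll p z) := by
  have := lat_sum (p ^ 2) p p p p p p p p (by positivity) (sq p).symm (sq p).symm (sq p).symm (sq p).symm z
  simp only [dvdAll]
  rw [this]
  apply ite_norm
  · rintro ⟨h1, h2, h3, h4⟩
    exact ⟨(dvd_neg.1 h4), dvd3 hz.1 h3, dvd3 hz.2 (dvd_neg.1 h2), h1⟩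
  · ring

lemma sum_L {p : ℕ} (hp : 0 < p) (z : BCF) (hz : inDual z) :
    ‖∑ y ∈ box (p ^ 2), ind (isL p (toB y)) * ee (p ^ 2) (pairZ z (toB y))‖ ≤ p ^ 5 * rind (Ls p z) := by
  have := lat_sum (p ^ 2) (p ^ 2) 1 p p 1 (p ^ 2) 1 (p ^ 2) (by positivity) (mul_one _) (sq p).symm (one_mul _) (one_mul _) z
  have e : ∀ y, isL p y ↔ (((p ^ 2 : ℕ) : ℤ) ∣ y.1 ∧ (p : ℤ) ∣ y.2.1 ∧ ((1 : ℕ) : ℤ) ∣ y.2.2.1 ∧ ((1 : ℕ) : ℤ) ∣ y.2.2.2) := by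
    intro y; simp [isL]
  simp only [e]
  rw [this]
  apply ite_norm
  · rintro ⟨h1, h2, h3, h4⟩
    exact ⟨by exact_mod_cast (dvd_neg.1 h4), by exact_mod_cast dvd3 hz.1 h3, dvd3 hz.2 (dvd_neg.1 h2)⟩
  · push_cast; ring

lemma sum_LT {p : ℕ} (hp : 0 < p) (z : BCF) (hz : inDual z) :
    ‖∑ y ∈ box (p ^ 2), ind (isL p (toB y) ∧ isT p (toB y)) * ee (p ^ 2) (pairZ z (toB y))‖ ≤ p ^ 4 * rind (LTs p z) := by
  have := lat_sum (p ^ 2) (p ^ 2) 1 p p p p 1 (p ^ 2) (by positivity) (mul_one _) (sq p).symm (sq p).symm (one_mul _) z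
  have e : ∀ y, (isL p y ∧ isT p y) ↔ (((p ^ 2 : ℕ) : ℤ) ∣ y.1 ∧ (p : ℤ) ∣ y.2.1 ∧ (p : ℤ) ∣ y.2.2.1 ∧ ((1 : ℕ) : ℤ) ∣ y.2.2.2) := by
    intro y; simp only [isL, isT]
    have : (p : ℤ) ^ 2 ∣ y.1 → (p : ℤ) ∣ y.1 := fun h => (dvd_pow_self _ two_ne_zero).trans h
    push_cast
    simp only [one_dvd]
    tauto
  simp only [e]
  rw [this]
  apply ite_norm
  · rintro ⟨h1, h2, h3, h4⟩
    exact ⟨by exact_mod_cast (dvd_neg.1 h4), dvd3 hz.1 h3, dvd3 hz.2 (dvd_neg.1 h2)⟩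
  · push_cast; ring

lemma sum_T {p : ℕ} (hp : 0 < p) (z : BCF) (hz : inDual z) :
    ‖∑ y ∈ box (p ^ 2), ind (isT p (toB y)) * ee (p ^ 2) (pairZ z (toB y))‖ ≤ p ^ 5 * rind (Ts p z) := by
  have := lat_sum (p ^ 2) p p p p p p 1 (p ^ 2) (by positivity) (sq p).symm (sq p).symm (sq p).symm (one_mul _) z
  have e : ∀ y, isT p y ↔ ((p : ℤ) ∣ y.1 ∧ (p : ℤ) ∣ y.2.1 ∧ (p : ℤ) ∣ y.2.2.1 ∧ ((1 : ℕ) : ℤ) ∣ y.2.2.2) := by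
    intro y; simp [isT]
  simp only [e]
  rw [this]
  apply ite_norm
  · rintro ⟨h1, h2, h3, h4⟩
    have h : (p : ℤ) ^ 2 ∣ z.1 := by exact_mod_cast (dvd_neg.1 h4)
    exact ⟨h, (dvd_pow_self _ two_ne_zero).trans h, dvd3 hz.1 h3, dvd3 hz.2 (dvd_neg.1 h2), h1⟩
  · push_cast; ring

lemma isL_congr {p : ℕ} (f g : BCF) (h : dvdAll ((p ^ 2 : ℕ) : ℤ) (f - g)) : isL p f ↔ isL p g := by
  have h' := dvdAll_mono (k := (p : ℤ)) (by exact_mod_cast dvd_pow_self p two_ne_zero) h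
  push_cast at h
  exact and_congr (dvd_iff_dvd_of_dvd_sub h.1) (dvd_iff_dvd_of_dvd_sub h'.2.1)

lemma isT_congr {p : ℕ} (f g : BCF) (h : dvdAll ((p ^ 2 : ℕ) : ℤ) (f - g)) : isT p f ↔ isT p g := by
  have h' := dvdAll_mono (k := (p : ℤ)) (by exact_mod_cast dvd_pow_self p two_ne_zero) h
  exact and_congr (dvd_iff_dvd_of_dvd_sub h'.1) (and_congr (dvd_iff_dvd_of_dvd_sub h'.2.1) (dvd_iff_dvd_of_dvd_sub h'.2.2.1))

lemma Phi_bd {p : ℕ} (hp : p.Prime) (x : BCF) (hx : inDual x) :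
    (p : ℝ) ^ 8 * ‖PhiHat' p x‖ ≤ p ^ 4 * rind (dvdAll p x) + ∑ r ∈ Finset.range (p + 1),
      (p ^ 5 * rind (Ls p (act (Mr p r) x)) + p ^ 5 * rind (Ts p (act (Mr p r) x))
        + p ^ 4 * rind (LTs p (act (Mr p r) x)) + p ^ 4 * rind (dvdAll p x)) := by
  have hp0 := hp.pos
  have hp2 : 0 < p ^ 2 := by positivity
  rw [PhiHat'_eq _ x hx, norm_mul, norm_inv, norm_pow, Complex.norm_natCast, mul_inv_cancel_left₀ (by positivity)]
  have h1 : ∀ f, outVpAll p f ↔ ¬ inVp p f := fun f =>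
    ⟨fun h => h p hp dvd_rfl, fun h p' hp' hd => by rwa [(Nat.prime_dvd_prime_iff_eq hp' hp).1 hd]⟩
  simp only [h1, ind_identity hp]
  have h2 : ∑ y ∈ box (p ^ 2), (ind (dvdAll p (toB y)) + ∑ r ∈ Finset.range (p + 1),
      (ind (isL p (act (Mr p r) (toB y))) + ind (isT p (act (Mr p r) (toB y)))
        - ind (isL p (act (Mr p r) (toB y)) ∧ isT p (act (Mr p r) (toB y))) - ind (dvdAll p (act (Mr p r) (toB y)))))
        * ee (p ^ 2) (pairZ x (toB y)) =
      ∑ y ∈ box (p ^ 2), ind (dvdAll p (toB y)) * ee (p ^ 2) (pairZ x (toB y)) +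
      ∑ r ∈ Finset.range (p + 1), (∑ y ∈ box (p ^ 2), ind (isL p (toB y)) * ee (p ^ 2) (pairZ (act (Mr p r) x) (toB y))
      + ∑ y ∈ box (p ^ 2), ind (isT p (toB y)) * ee (p ^ 2) (pairZ (act (Mr p r) x) (toB y))
      - ∑ y ∈ box (p ^ 2), ind (isL p (toB y) ∧ isT p (toB y)) * ee (p ^ 2) (pairZ (act (Mr p r) x) (toB y))
      - ∑ y ∈ box (p ^ 2), ind (dvdAll p (toB y)) * ee (p ^ 2) (pairZ x (toB y))) := by
    simp only [add_mul, Finset.sum_mul, Finset.sum_add_distrib]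
    rw [Finset.sum_comm]
    congr 1
    simp only [← Finset.sum_add_distrib]
    apply Finset.sum_congr rfl
    intro r _
    rw [Finset.sum_add_distrib, ← sum_act_ind _ hp2 (isL p) isL_congr (Mr p r) (Mr_det p r) x hx,
      ← sum_act_ind _ hp2 (isT p) isT_congr (Mr p r) (Mr_det p r) x hx,
      ← sum_act_ind _ hp2 (fun f => isL p f ∧ isT p f) (fun f g h => and_congr (isL_congr f g h) (isT_congr f g h)) (Mr p r) (Mr_det p r) x hx]
    simp only [dvdAll_act_iff _ _ (Mr_det p r), sub_mul, add_mul, Finset.sum_add_distrib, Finset.sum_sub_distrib]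
  rw [h2]
  refine (norm_add_le _ _).trans (add_le_add (sum_pV hp0 x hx) ((norm_sum_le _ _).trans (Finset.sum_le_sum fun r _ => ?_)))
  have hz := inDual_act (Mr p r) x hx
  have a1 := sum_L hp0 _ hz
  have a2 := sum_T hp0 _ hz
  have a3 := sum_LT hp0 _ hz
  have a4 := sum_pV hp0 _ hx
  refine (norm_sub_le _ _).trans (add_le_add ((norm_sub_le _ _).trans (add_le_add ((norm_add_le _ _).trans (add_le_add a1 a2)) a3)) a4)

end BCF

namespace BCF

lemma root_count {p : ℕ} (hp : p.Prime) (f : BCF) (hf : ¬ dvdAll p f) :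
    ((Finset.range (p + 1)).filter (fun r => (p : ℤ) ∣ (act (Mr p r) f).1)).card ≤ 4 := by
  have := Fact.mk hp
  obtain ⟨a, b, c, d⟩ := f
  let P : Polynomial (ZMod p) := Polynomial.C (d : ZMod p) * Polynomial.X ^ 3 + Polynomial.C (c : ZMod p) * Polynomial.X ^ 2
    + Polynomial.C (b : ZMod p) * Polynomial.X + Polynomial.C (a : ZMod p)
  have hP : P ≠ 0 := by
    intro h
    apply hf
    have hc : ∀ a b c d : ZMod p, ∀ P, P = Polynomial.C d * Polynomial.X ^ 3 + Polynomial.C c * Polynomial.X ^ 2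
      + Polynomial.C b * Polynomial.X + Polynomial.C a → P.coeff 0 = a ∧ P.coeff 1 = b ∧ P.coeff 2 = c ∧ P.coeff 3 = d := by
      rintro a b c d P rfl
      exact ⟨Cubic.coeff_eq_d (P := ⟨d, c, b, a⟩), Cubic.coeff_eq_c (P := ⟨d, c, b, a⟩),
        Cubic.coeff_eq_b (P := ⟨d, c, b, a⟩), Cubic.coeff_eq_a (P := ⟨d, c, b, a⟩)⟩
    obtain ⟨e0, e1, e2, e3⟩ := hc a b c d P rfl
    rw [h] at e0 e1 e2 e3
    simp only [Polynomial.coeff_zero] at e0 e1 e2 e3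
    refine ⟨?_, ?_, ?_, ?_⟩ <;> simp only <;> rw [← ZMod.intCast_zmod_eq_zero_iff_dvd]
    exacts [e0.symm, e1.symm, e2.symm, e3.symm]
  have hdeg : P.natDegree ≤ 3 := Polynomial.natDegree_cubic_le
  have hsub : (Finset.range (p + 1)).filter (fun r => (p : ℤ) ∣ (act (Mr p r) (a, b, c, d)).1) ⊆
      insert p (P.roots.toFinset.image ZMod.val) := by
    intro r hr
    simp only [Finset.mem_filter, Finset.mem_range, Finset.mem_insert, Finset.mem_image, Multiset.mem_toFinset] at *
    by_cases hrp : r = p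
    · exact Or.inl hrp
    · right
      have hlt : r < p := by omega
      refine ⟨(r : ZMod p), ?_, ZMod.val_cast_of_lt hlt⟩
      rw [Polynomial.mem_roots hP, Polynomial.IsRoot.def]
      have h := hr.2
      rw [act_eq _ (Mr_det p r), ← ZMod.intCast_zmod_eq_zero_iff_dvd] at h
      simp only [Mr, if_neg hrp] at h
      simp at h
      simp [P]
      linear_combination h
  refine (Finset.card_le_card hsub).trans ((Finset.card_insert_le _ _).trans ?_)
  have h1 : (P.roots.toFinset.image ZMod.val).card ≤ 3 :=
    Finset.card_image_le.trans ((Multiset.toFinset_card_le _).trans ((Polynomial.card_roots' P).trans hdeg))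
  omega

lemma sum_rind_le {p : ℕ} (hp : p.Prime) (f : BCF) (hf : ¬ dvdAll p f) (P : ℕ → Prop)
    (hP : ∀ r, P r → (p : ℤ) ∣ (act (Mr p r) f).1) : ∑ r ∈ Finset.range (p + 1), rind (P r) ≤ 4 := by
  calc _ ≤ ∑ r ∈ Finset.range (p + 1), rind ((p : ℤ) ∣ (act (Mr p r) f).1) :=
        Finset.sum_le_sum fun r _ => rind_mono (hP r)
    _ = (((Finset.range (p + 1)).filter (fun r => (p : ℤ) ∣ (act (Mr p r) f).1)).card : ℝ) := by
        rw [Finset.card_filter]; push_cast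
        refine Finset.sum_congr rfl fun r _ => ?_
        by_cases h : (p : ℤ) ∣ (act (Mr p r) f).1 <;> simp [rind, h]
    _ ≤ 4 := by exact_mod_cast root_count hp f hf

lemma Phi_bd' {p : ℕ} (hp : p.Prime) (x : BCF) (hx : inDual x) :
    (p : ℝ) ^ 8 * ‖PhiHat' p x‖ ≤ p ^ 4 * rind (dvdAll p x) +
      (p ^ 5 * ∑ r ∈ Finset.range (p + 1), rind (Ls p (act (Mr p r) x))
        + p ^ 5 * ∑ r ∈ Finset.range (p + 1), rind (Ts p (act (Mr p r) x))
        + p ^ 4 * ∑ r ∈ Finset.range (p + 1), rind (LTs p (act (Mr p r) x))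
        + p ^ 4 * ((p + 1) * rind (dvdAll p x))) := by
  have := Phi_bd hp x hx
  simpa only [Finset.sum_add_distrib, ← Finset.mul_sum, Finset.sum_const, Finset.card_range, nsmul_eq_mul,
    Nat.cast_add, Nat.cast_one] using this

lemma sum_rind_le' {p : ℕ} (P : ℕ → Prop) : ∑ r ∈ Finset.range (p + 1), rind (P r) ≤ p + 1 := by
  calc _ ≤ ∑ r ∈ Finset.range (p + 1), (1 : ℝ) := Finset.sum_le_sum fun r _ => rind_le _
    _ = _ := by simp

lemma fin_aux {p : ℕ} (hp : p.Prime) {A : ℝ} (k : ℕ) (hk : k ≤ 8) (h : (p : ℝ) ^ 8 * A ≤ 32 * p ^ (8 - k)) :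
    A ≤ 32 * ((p : ℝ) ^ k)⁻¹ := by
  have hp0 : (0:ℝ) < p := by exact_mod_cast hp.pos
  rw [← div_eq_mul_inv, le_div_iff₀ (by positivity)]
  have : (p : ℝ) ^ 8 = p ^ (8 - k) * p ^ k := by rw [← pow_add]; congr 1; omega
  rw [this] at h
  have h8 : (0:ℝ) < p ^ (8 - k) := by positivity
  nlinarith

lemma Phi_L0 {p : ℕ} (hp : p.Prime) (x : BCF) (hx : inDual x) : ‖PhiHat' p x‖ ≤ 32 * ((p : ℝ) ^ 2)⁻¹ := by
  apply fin_aux hp 2 (by norm_num)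
  have h := Phi_bd' hp x hx
  have hp2 : (2:ℝ) ≤ p := by exact_mod_cast hp.two_le
  have h1 := sum_rind_le' (p := p) (fun r => Ls p (act (Mr p r) x))
  have h2 := sum_rind_le' (p := p) (fun r => Ts p (act (Mr p r) x))
  have h3 := sum_rind_le' (p := p) (fun r => LTs p (act (Mr p r) x))
  have h4 := rind_le (dvdAll p x)
  calc _ ≤ _ := h
    _ ≤ (p : ℝ) ^ 4 * 1 + ((p : ℝ) ^ 5 * (p + 1) + p ^ 5 * (p + 1) + p ^ 4 * (p + 1) + p ^ 4 * ((p + 1) * 1)) := by gcongr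
    _ = (p : ℝ) ^ 4 * (2 * p ^ 2 + 4 * p + 3) := by ring
    _ ≤ (p : ℝ) ^ 4 * (32 * p ^ 2) := by gcongr; nlinarith
    _ = _ := by norm_num; ring

lemma Phi_L1 {p : ℕ} (hp : p.Prime) (x : BCF) (hx : inDual x) (h : dvdAll p x) (h' : ¬ dvdAll ((p : ℤ) ^ 2) x) :
    ‖PhiHat' p x‖ ≤ 32 * ((p : ℝ) ^ 3)⁻¹ := by
  apply fin_aux hp 3 (by norm_num)
  have hb := Phi_bd' hp x hx
  have hp2 : (2:ℝ) ≤ p := by exact_mod_cast hp.two_le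
  have hpz : (p : ℤ) ≠ 0 := by exact_mod_cast hp.pos.ne'
  obtain ⟨f, hf⟩ := (dvdAll_iff _ _).1 h
  have hnf : ¬ dvdAll p f := by
    intro hc
    obtain ⟨g, rfl⟩ := (dvdAll_iff _ _).1 hc
    apply h'
    rw [hf, smul_smul, ← sq]
    exact dvdAll_smul _ _
  have key : ∀ r, (p : ℤ) ^ 2 ∣ (act (Mr p r) x).1 → (p : ℤ) ∣ (act (Mr p r) f).1 := by
    intro r hr
    rw [hf, act_smul, Prod.smul_fst, smul_eq_mul, sq] at hr
    exact (mul_dvd_mul_iff_left hpz).1 hr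
  have h1 := sum_rind_le hp f hnf (fun r => Ls p (act (Mr p r) x)) (fun r h => key r h.1)
  have h2 := sum_rind_le hp f hnf (fun r => Ts p (act (Mr p r) x)) (fun r h => key r h.1)
  have h3 := sum_rind_le hp f hnf (fun r => LTs p (act (Mr p r) x)) (fun r h => key r h.1)
  have h4 := rind_le (dvdAll p x)
  calc _ ≤ _ := hb
    _ ≤ (p : ℝ) ^ 4 * 1 + ((p : ℝ) ^ 5 * 4 + p ^ 5 * 4 + p ^ 4 * 4 + p ^ 4 * ((p + 1) * 1)) := by gcongr
    _ = (p : ℝ) ^ 4 * (9 * p + 6) := by ring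
    _ ≤ (p : ℝ) ^ 4 * (32 * p) := by gcongr; nlinarith
    _ = _ := by norm_num; ring

lemma Phi_aux {p : ℕ} (hp : p.Prime) (x : BCF) (hx : inDual x) (h : ¬ dvdAll p x) :
    (p : ℝ) ^ 8 * ‖PhiHat' p x‖ ≤ p ^ 5 * ∑ r ∈ Finset.range (p + 1), rind (Ls p (act (Mr p r) x))
        + p ^ 4 * ∑ r ∈ Finset.range (p + 1), rind (LTs p (act (Mr p r) x)) := by
  have hb := Phi_bd' hp x hx
  have hT : ∀ r, ¬ Ts p (act (Mr p r) x) := fun r hc => h ((dvdAll_act_iff _ _ (Mr_det p r) _).1 hc.2)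
  have e1 : rind (dvdAll p x) = 0 := by simp [rind, h]
  have e2 : ∑ r ∈ Finset.range (p + 1), rind (Ts p (act (Mr p r) x)) = 0 :=
    Finset.sum_eq_zero fun r _ => by simp [rind, hT]
  rw [e1, e2] at hb
  linarith

lemma p_dvd_of_sq {p : ℕ} {z : ℤ} (h : (p : ℤ) ^ 2 ∣ z) : (p : ℤ) ∣ z := (dvd_pow_self _ two_ne_zero).trans h

lemma Phi_L2 {p : ℕ} (hp : p.Prime) (x : BCF) (hx : inDual x) (h : ¬ dvdAll p x) :
    ‖PhiHat' p x‖ ≤ 32 * ((p : ℝ) ^ 3)⁻¹ := by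
  apply fin_aux hp 3 (by norm_num)
  have hb := Phi_aux hp x hx h
  have hp2 : (2:ℝ) ≤ p := by exact_mod_cast hp.two_le
  have h1 := sum_rind_le hp x h (fun r => Ls p (act (Mr p r) x)) (fun r h => p_dvd_of_sq h.1)
  have h3 := sum_rind_le hp x h (fun r => LTs p (act (Mr p r) x)) (fun r h => p_dvd_of_sq h.1)
  calc _ ≤ _ := hb
    _ ≤ (p : ℝ) ^ 5 * 4 + p ^ 4 * 4 := by gcongr
    _ = (p : ℝ) ^ 4 * (4 * p + 4) := by ring
    _ ≤ (p : ℝ) ^ 4 * (32 * p) := by gcongr; nlinarith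
    _ = _ := by norm_num; ring

lemma Phi_L3 {p : ℕ} (hp : p.Prime) (x : BCF) (hx : inDual x) (h : ¬ dvdAll p x)
    (hL : ∀ r, ¬ Ls p (act (Mr p r) x)) : ‖PhiHat' p x‖ ≤ 32 * ((p : ℝ) ^ 4)⁻¹ := by
  apply fin_aux hp 4 (by norm_num)
  have hb := Phi_aux hp x hx h
  have hp2 : (2:ℝ) ≤ p := by exact_mod_cast hp.two_le
  have e2 : ∑ r ∈ Finset.range (p + 1), rind (Ls p (act (Mr p r) x)) = 0 :=
    Finset.sum_eq_zero fun r _ => by simp [rind, hL]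
  have h3 := sum_rind_le hp x h (fun r => LTs p (act (Mr p r) x)) (fun r h => p_dvd_of_sq h.1)
  rw [e2] at hb
  calc _ ≤ _ := hb
    _ ≤ (p : ℝ) ^ 5 * 0 + p ^ 4 * 4 := by gcongr
    _ = 4 * (p : ℝ) ^ 4 := by ring
    _ ≤ _ := by norm_num; nlinarith [pow_pos (by linarith : (0:ℝ) < p) 4]

lemma Phi_L4 {p : ℕ} (hp : p.Prime) (x : BCF) (hx : inDual x) (h : ¬ dvdAll p x)
    (hL : ∀ r, ¬ LTs p (act (Mr p r) x)) : ‖PhiHat' p x‖ = 0 := by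
  have hb := Phi_aux hp x hx h
  have hL' : ∀ r, ¬ Ls p (act (Mr p r) x) := fun r hc => hL r ⟨hc.1, p_dvd_of_sq hc.2.1, hc.2.2⟩
  have e2 : ∑ r ∈ Finset.range (p + 1), rind (Ls p (act (Mr p r) x)) = 0 :=
    Finset.sum_eq_zero fun r _ => by simp [rind, hL']
  have e3 : ∑ r ∈ Finset.range (p + 1), rind (LTs p (act (Mr p r) x)) = 0 :=
    Finset.sum_eq_zero fun r _ => by simp [rind, hL]
  rw [e2, e3] at hb
  have hp0 : (0:ℝ) < (p : ℝ) ^ 8 := by have := hp.pos; positivity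
  have := norm_nonneg (PhiHat' p x)
  nlinarith

/-- depth four position -/
def Fs (p : ℕ) (z : BCF) : Prop := (p : ℤ) ^ 3 ∣ z.1 ∧ (p : ℤ) ^ 2 ∣ z.2.1 ∧ (p : ℤ) ∣ z.2.2.1

/-- The local type of a form. -/
def ty (p : ℕ) (x : BCF) : ℕ :=
  if dvdAll ((p : ℤ) ^ 2) x then 0 else if dvdAll p x then 1 else
  if ∃ γ : Matrix (Fin 2) (Fin 2) ℤ, γ.det = 1 ∧ Fs p (act γ x) then 4 else
  if ∃ γ : Matrix (Fin 2) (Fin 2) ℤ, γ.det = 1 ∧ Ls p (act γ x) then 2 else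
  if ∃ γ : Matrix (Fin 2) (Fin 2) ℤ, γ.det = 1 ∧ LTs p (act γ x) then 3 else 5

/-- local weight -/
def wt (p : ℕ) (t : ℕ) : ℝ :=
  if t = 0 then ((p : ℝ) ^ 2)⁻¹ else if t = 3 then ((p : ℝ) ^ 4)⁻¹ else if t = 5 then 0 else ((p : ℝ) ^ 3)⁻¹

lemma Phi_local {p : ℕ} (hp : p.Prime) (x : BCF) (hx : inDual x) :
    ‖PhiHat' p x‖ ≤ 32 * wt p (ty p x) := by
  unfold ty
  split_ifs with h0 h1 h4 h2 h3
  · simpa [wt] using Phi_L0 hp x hx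
  · simpa [wt] using Phi_L1 hp x hx h1 h0
  · simpa [wt] using Phi_L2 hp x hx h1
  · simpa [wt] using Phi_L2 hp x hx h1
  · simpa [wt] using Phi_L3 hp x hx h1 (fun r hc => h2 ⟨_, Mr_det p r, hc⟩)
  · have := Phi_L4 hp x hx h1 (fun r hc => h3 ⟨_, Mr_det p r, hc⟩)
    simp [wt, this]

end BCF

namespace BCF

lemma glue (s : Finset ℕ) (hs : ∀ p ∈ s, p.Prime) (Γ : ℕ → Matrix (Fin 2) (Fin 2) ℤ)
    (hΓ : ∀ p ∈ s, (Γ p).det = 1) :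
    ∃ γ : Matrix (Fin 2) (Fin 2) ℤ, γ.det = 1 ∧ ∀ p ∈ s, (p : ℤ) ∣ (γ * (Γ p).adjugate) 0 1 := by
  induction s using Finset.induction_on with
  | empty => exact ⟨1, by simp, by simp⟩
  | insert p s hps ih =>
    obtain ⟨γ, hγ, h⟩ := ih (fun p hp => hs p (Finset.mem_insert_of_mem hp))
      (fun p hp => hΓ p (Finset.mem_insert_of_mem hp))
    have hpp : p.Prime := hs p (Finset.mem_insert_self _ _)
    have hpz : Prime (p : ℤ) := Nat.prime_iff_prime_int.1 hpp
    have hs' : ∀ p' ∈ s, p'.Prime := fun p hp => hs p (Finset.mem_insert_of_mem hp)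
    set M : ℕ := ∏ p' ∈ s, p' with hM
    have hpM : Nat.Coprime p M := by
      apply Nat.Coprime.prod_right
      intro p' hp'
      exact (Nat.coprime_primes hpp (hs' p' hp')).2 (fun e => hps (e ▸ hp'))
    have hpM' : ¬ (p : ℤ) ∣ (M : ℤ) := by
      rw [Int.natCast_dvd_natCast]; exact (Nat.Prime.coprime_iff_not_dvd hpp).1 hpM
    set δ := γ * (Γ p).adjugate with hδ
    have hδd : δ.det = 1 := by
      rw [hδ, Matrix.det_mul, hγ, det_adj _ (hΓ p (Finset.mem_insert_self _ _))]; rfl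
    suffices hσ : ∃ σ : Matrix (Fin 2) (Fin 2) ℤ, σ.det = 1 ∧ (M : ℤ) ∣ σ 0 1 ∧ (p : ℤ) ∣ (σ * δ) 0 1 by
      obtain ⟨σ, h1, h2, h3⟩ := hσ
      refine ⟨σ * γ, by rw [Matrix.det_mul, h1, hγ]; rfl, fun p' hp' => ?_⟩
      rw [Matrix.mul_assoc]
      rcases Finset.mem_insert.1 hp' with rfl | hp'
      · exact h3
      · rw [Matrix.mul_apply, Fin.sum_univ_two]
        have : (p' : ℤ) ∣ M := Int.natCast_dvd_natCast.2 (Finset.dvd_prod_of_mem _ hp')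
        exact dvd_add ((h p' hp').mul_left _) ((this.trans h2).mul_right _)
    by_cases hd : (p : ℤ) ∣ δ 1 1
    · have hc : IsCoprime (p : ℤ) (M : ℤ) := Nat.isCoprime_iff_coprime.2 hpM
      obtain ⟨u, v, huv⟩ := hc
      refine ⟨!![(p : ℤ), (M : ℤ); -v, u], ?_, by simp, ?_⟩
      · rw [Matrix.det_fin_two]; simp; linarith
      · rw [Matrix.mul_apply, Fin.sum_univ_two]
        simp only [Matrix.of_apply, Matrix.cons_val_zero, Matrix.cons_val_one]
        exact dvd_add (dvd_mul_right _ _) (hd.mul_left _)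
    · obtain ⟨r, _, hr⟩ := exists_inv_mod hpp (M * δ 1 1) (-(δ 0 1)) (by
        rw [hpz.dvd_mul]; tauto)
      refine ⟨!![1, (M : ℤ) * r; 0, 1], by simp [Matrix.det_fin_two], by simp, ?_⟩
      rw [Matrix.mul_apply, Fin.sum_univ_two]
      simp only [Matrix.of_apply, Matrix.cons_val_zero, Matrix.cons_val_one]
      have := dvd_neg.2 hr
      have e : 1 * δ 0 1 + (M : ℤ) * r * δ 1 1 = -(-(δ 0 1) - M * δ 1 1 * r) := by ring
      rw [e]; exact this

lemma sqf_pow_dvd (m : ℕ) (hm : Squarefree m) (k : ℕ) (z : ℤ)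
    (h : ∀ p : ℕ, p.Prime → p ∣ m → (p : ℤ) ^ k ∣ z) : (m : ℤ) ^ k ∣ z := by
  rw [← Nat.prod_primeFactors_of_squarefree hm]
  push_cast
  rw [← Finset.prod_pow]
  apply Finset.prod_dvd_of_coprime
  · intro p hp p' hp' hne
    simp only [Finset.mem_coe, Nat.mem_primeFactors] at hp hp'
    exact IsCoprime.pow (Nat.isCoprime_iff_coprime.2 ((Nat.coprime_primes hp.1 hp'.1).2 hne))
  · intro p hp
    exact h p (Nat.prime_of_mem_primeFactors hp) (Nat.dvd_of_mem_primeFactors hp)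

/-- congruent position transfers -/
lemma pos_transfer {p : ℕ} {P Q R : ℤ} (γ Γ : Matrix (Fin 2) (Fin 2) ℤ) (hΓ : Γ.det = 1)
    (hk : (p : ℤ) ∣ (γ * Γ.adjugate) 0 1)
    (h1 : Q ∣ P) (h1' : R ∣ Q) (hPQ : P ∣ Q * p) (hQR : Q ∣ R * p) (hR : R ∣ p)
    (f : BCF) (ha : P ∣ (act Γ f).1) (hb : Q ∣ (act Γ f).2.1) (hc : R ∣ (act Γ f).2.2.1) :
    P ∣ (act γ f).1 ∧ Q ∣ (act γ f).2.1 ∧ R ∣ (act γ f).2.2.1 := by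
  have e : act γ f = act (γ * Γ.adjugate) (act Γ f) := by
    rw [← act_mul, Matrix.mul_assoc, Matrix.adjugate_mul, hΓ, one_smul, mul_one]
  rw [e]
  exact pos_stable _ p hk h1 h1' hPQ hQR hR _ ha hb hc

/-- twisted normal form -/
def nf (q2 q3 q4 : ℤ) (a b c d : ℤ) : BCF :=
  ((q2 * q3 * q4) ^ 2 * q4 * a, q2 * q3 * q4 * q2 * q4 * b, q2 * q3 * q4 * c, d)

def gf (q2 q3 : ℤ) (a b c d : ℤ) : BCF := (a, q2 * b, q2 * q3 * c, q2 * q3 * d)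

lemma disc_nf (q2 q3 q4 a b c d : ℤ) :
    disc (nf q2 q3 q4 a b c d) = (q2 * q3 * q4) ^ 2 * q4 ^ 4 * disc (gf q2 q3 a b c d) := by
  simp only [disc, nf, gf]; ring

def nondeg (q2 q3 : ℕ) (a b : ℤ) : Prop := (∀ p : ℕ, p.Prime → p ∣ q2 → ¬ (p : ℤ) ∣ a) ∧
  (∀ p : ℕ, p.Prime → p ∣ q3 → ¬ (p : ℤ) ∣ b)

lemma trans_exists (q2 q3 q4 : ℕ) (hsq : Squarefree (q2 * q3 * q4)) (f : BCF)
    (h4 : ∀ p : ℕ, p.Prime → p ∣ q4 → ∃ γ : Matrix (Fin 2) (Fin 2) ℤ, γ.det = 1 ∧ Fs p (act γ f))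
    (h2 : ∀ p : ℕ, p.Prime → p ∣ q2 → (∃ γ : Matrix (Fin 2) (Fin 2) ℤ, γ.det = 1 ∧ Ls p (act γ f)) ∧
      ¬ ∃ γ : Matrix (Fin 2) (Fin 2) ℤ, γ.det = 1 ∧ Fs p (act γ f))
    (h3 : ∀ p : ℕ, p.Prime → p ∣ q3 → (∃ γ : Matrix (Fin 2) (Fin 2) ℤ, γ.det = 1 ∧ LTs p (act γ f)) ∧
      ¬ ∃ γ : Matrix (Fin 2) (Fin 2) ℤ, γ.det = 1 ∧ Ls p (act γ f)) :
    ∃ a b c d : ℤ, SLeq f (nf q2 q3 q4 a b c d) ∧ nondeg q2 q3 a b := by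
  have hm0 : q2 * q3 * q4 ≠ 0 := hsq.ne_zero
  set m := q2 * q3 * q4 with hm
  have hLTs : ∀ p : ℕ, p.Prime → p ∣ m → ∃ γ : Matrix (Fin 2) (Fin 2) ℤ, γ.det = 1 ∧ LTs p (act γ f) ∧
      (p ∣ q2 → Ls p (act γ f)) ∧ (p ∣ q4 → Fs p (act γ f)) := by
    intro p hp hpm
    by_cases hp4 : p ∣ q4
    · obtain ⟨γ, hγ, hF⟩ := h4 p hp hp4
      have hpp : (p : ℤ) ^ 2 ∣ (p : ℤ) ^ 3 := pow_dvd_pow _ (by norm_num)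
      exact ⟨γ, hγ, ⟨hpp.trans hF.1, p_dvd_of_sq hF.2.1, hF.2.2⟩,
        fun _ => ⟨hpp.trans hF.1, hF.2.1, hF.2.2⟩, fun _ => hF⟩
    · by_cases hp2 : p ∣ q2
      · obtain ⟨γ, hγ, hF⟩ := (h2 p hp hp2).1
        exact ⟨γ, hγ, ⟨hF.1, p_dvd_of_sq hF.2.1, hF.2.2⟩, fun _ => hF, fun h => absurd h hp4⟩
      · have hp3 : p ∣ q3 := by
          rw [hm] at hpm
          rcases hp.dvd_mul.1 hpm with h | h
          · rcases hp.dvd_mul.1 h with h | h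
            · exact absurd h hp2
            · exact h
          · exact absurd h hp4
        obtain ⟨γ, hγ, hF⟩ := (h3 p hp hp3).1
        exact ⟨γ, hγ, hF, fun h => absurd h hp2, fun h => absurd h hp4⟩
  choose! Γ hΓ using hLTs
  obtain ⟨γ, hγ, hg⟩ := glue m.primeFactors (fun p hp => Nat.prime_of_mem_primeFactors hp) Γ
    (fun p hp => (hΓ p (Nat.prime_of_mem_primeFactors hp) (Nat.dvd_of_mem_primeFactors hp)).1)
  have hg' : ∀ p : ℕ, p.Prime → p ∣ m → (p : ℤ) ∣ (γ * (Γ p).adjugate) 0 1 := fun p hp hd =>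
    hg p (Nat.mem_primeFactors.2 ⟨hp, hd, hm0⟩)
  have d2 : q2 ∣ m := ⟨q3 * q4, by rw [hm]; ring⟩
  have d3 : q3 ∣ m := ⟨q2 * q4, by rw [hm]; ring⟩
  have d4 : q4 ∣ m := ⟨q2 * q3, by rw [hm]; ring⟩
  have A : ∀ p : ℕ, p.Prime → p ∣ m → LTs p (act γ f) := by
    intro p hp hd
    obtain ⟨u1, u2, u3, u4⟩ := hΓ p hp hd
    exact pos_transfer γ (Γ p) u1 (hg' p hp hd) (dvd_pow_self _ two_ne_zero) dvd_rfl (by rw [sq])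
      (dvd_mul_right _ _) dvd_rfl f u2.1 u2.2.1 u2.2.2
  have B : ∀ p : ℕ, p.Prime → p ∣ q2 → Ls p (act γ f) := by
    intro p hp hd
    obtain ⟨u1, u2, u3, u4⟩ := hΓ p hp (hd.trans d2)
    have u2 := u3 hd
    exact pos_transfer γ (Γ p) u1 (hg' p hp (hd.trans d2)) dvd_rfl (dvd_pow_self _ two_ne_zero)
      (dvd_mul_right _ _) (by rw [sq]) dvd_rfl f u2.1 u2.2.1 u2.2.2
  have F : ∀ p : ℕ, p.Prime → p ∣ q4 → Fs p (act γ f) := by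
    intro p hp hd
    obtain ⟨u1, u2, u3, u4⟩ := hΓ p hp (hd.trans d4)
    have u2 := u4 hd
    exact pos_transfer γ (Γ p) u1 (hg' p hp (hd.trans d4)) (pow_dvd_pow _ (by norm_num)) (dvd_pow_self _ two_ne_zero)
      (by rw [← pow_succ]) (by rw [sq]) dvd_rfl f u2.1 u2.2.1 u2.2.2
  have cop : ∀ {u v : ℕ}, u * v ∣ m → Nat.Coprime u v := fun h => Nat.coprime_of_squarefree_mul (hsq.squarefree_of_dvd h)
  have c23 : Nat.Coprime q2 q3 := cop ⟨q4, by rw [hm]⟩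
  have c24 : Nat.Coprime q2 q4 := cop ⟨q3, by rw [hm]; ring⟩
  have c34 : Nat.Coprime q3 q4 := cop ⟨q2, by rw [hm]; ring⟩
  have sq2 := hsq.squarefree_of_dvd d2
  have sq3 := hsq.squarefree_of_dvd d3
  have sq4 := hsq.squarefree_of_dvd d4
  have ic : ∀ {u v : ℕ}, Nat.Coprime u v → IsCoprime (u : ℤ) (v : ℤ) := fun h => Nat.isCoprime_iff_coprime.2 h
  obtain ⟨a0, b0, c0, d0, hh⟩ : ∃ a0 b0 c0 d0, act γ f = (a0, b0, c0, d0) := ⟨_, _, _, _, rfl⟩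
  rw [hh] at A B F
  have ha : ((q2 * q3 * q4 : ℤ)) ^ 2 * q4 ∣ a0 := by
    have e1 : (q4 : ℤ) ^ 3 ∣ a0 := sqf_pow_dvd q4 sq4 3 a0 fun p hp hd => (F p hp hd).1
    have e2 : ((q2 * q3 : ℕ) : ℤ) ^ 2 ∣ a0 := sqf_pow_dvd (q2 * q3) (hsq.squarefree_of_dvd ⟨q4, hm⟩) 2 a0
      fun p hp hd => (A p hp (hd.trans ⟨q4, hm⟩)).1
    have : IsCoprime (((q2 * q3 : ℕ) : ℤ) ^ 2) ((q4 : ℤ) ^ 3) := (ic (Nat.Coprime.mul_left c24 c34)).pow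
    have := this.mul_dvd e2 e1
    have e : ((q2 * q3 * q4 : ℤ)) ^ 2 * q4 = ((q2 * q3 : ℕ) : ℤ) ^ 2 * (q4 : ℤ) ^ 3 := by push_cast; ring
    rw [e]; exact this
  have hb : (q2 * q3 * q4 * q2 * q4 : ℤ) ∣ b0 := by
    have e1 : (q4 : ℤ) ^ 2 ∣ b0 := sqf_pow_dvd q4 sq4 2 b0 fun p hp hd => (F p hp hd).2.1
    have e2 : (q2 : ℤ) ^ 2 ∣ b0 := sqf_pow_dvd q2 sq2 2 b0 fun p hp hd => (B p hp hd).2.1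
    have e3 : (q3 : ℤ) ^ 1 ∣ b0 := sqf_pow_dvd q3 sq3 1 b0 fun p hp hd => by
      rw [pow_one]; exact (A p hp (hd.trans d3)).2.1
    have i1 : IsCoprime ((q2 : ℤ) ^ 2) ((q3 : ℤ) ^ 1) := (ic c23).pow
    have i2 : IsCoprime ((q2 : ℤ) ^ 2 * (q3 : ℤ) ^ 1) ((q4 : ℤ) ^ 2) :=
      IsCoprime.mul_left (ic c24).pow (ic c34).pow
    have := i2.mul_dvd (i1.mul_dvd e2 e3) e1
    have e : (q2 * q3 * q4 * q2 * q4 : ℤ) = (q2 : ℤ) ^ 2 * (q3 : ℤ) ^ 1 * (q4 : ℤ) ^ 2 := by ring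
    rw [e]; exact this
  have hc : (q2 * q3 * q4 : ℤ) ∣ c0 := by
    have := sqf_pow_dvd m hsq 1 c0 fun p hp hd => by rw [pow_one]; exact (A p hp hd).2.2
    rw [pow_one, hm] at this
    exact_mod_cast this
  obtain ⟨a, rfl⟩ := ha
  obtain ⟨b, rfl⟩ := hb
  obtain ⟨c, rfl⟩ := hc
  refine ⟨a, b, c, d0, ⟨γ, hγ, by rw [hh]; rfl⟩, ?_, ?_⟩
  · intro p hp hd ha
    apply (h2 p hp hd).2
    refine ⟨γ, hγ, ?_⟩
    rw [hh]
    refine ⟨?_, (B p hp hd).2.1, (B p hp hd).2.2⟩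
    have h1 : (p : ℤ) ∣ (q2 : ℤ) := Int.natCast_dvd_natCast.2 hd
    have := mul_dvd_mul (pow_dvd_pow_of_dvd h1 2) ha
    simp only
    refine (by simpa [pow_succ] using this : (p : ℤ) ^ 3 ∣ (q2 : ℤ) ^ 2 * a).trans ⟨(q3 * q4) ^ 2 * q4, by ring⟩
  · intro p hp hd hb
    apply (h3 p hp hd).2
    refine ⟨γ, hγ, ?_⟩
    rw [hh]
    have hA := A p hp (hd.trans d3)
    refine ⟨hA.1, ?_, hA.2.2⟩
    have h1 : (p : ℤ) ∣ (q3 : ℤ) := Int.natCast_dvd_natCast.2 hd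
    have := mul_dvd_mul h1 hb
    simp only
    rw [sq]
    exact this.trans ⟨q2 * q4 * q2 * q4, by ring⟩

lemma trans_inj (q2 q3 q4 : ℕ) (hsq : Squarefree (q2 * q3 * q4)) (a b c d a' b' c' d' : ℤ)
    (hn : nondeg q2 q3 a b) (σ : Matrix (Fin 2) (Fin 2) ℤ) (hσ : σ.det = 1)
    (hact : act σ (gf q2 q3 a b c d) = gf q2 q3 a' b' c' d') (h4 : (q4 : ℤ) ∣ σ 1 0) :
    SLeq (nf q2 q3 q4 a b c d) (nf q2 q3 q4 a' b' c' d') := by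
  have hdet := det_two σ hσ
  have hm : q2 * q3 * q4 ≠ 0 := hsq.ne_zero
  have hE := hact
  rw [gf, gf, act_eq σ hσ] at hE
  simp only [Prod.mk.injEq] at hE
  obtain ⟨E1, E2, E3, E4⟩ := hE
  have cop : ∀ {u v : ℕ}, u * v ∣ q2 * q3 * q4 → Nat.Coprime u v := fun h => Nat.coprime_of_squarefree_mul (hsq.squarefree_of_dvd h)
  have c23 : Nat.Coprime q2 q3 := cop ⟨q4, by ring⟩
  have key : ((q2 * q3 * q4 : ℕ) : ℤ) ∣ σ 1 0 := by
    have := sqf_pow_dvd (q2 * q3 * q4) hsq 1 (σ 1 0) ?_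
    · rwa [pow_one] at this
    · intro p hp hd
      rw [pow_one]
      by_cases hp4 : p ∣ q4
      · exact (Int.natCast_dvd_natCast.2 hp4).trans h4
      have hp23 : p ∣ q2 * q3 := (hp.dvd_mul.1 hd).resolve_right hp4
      by_contra hβ
      have := Fact.mk hp
      have z23 : ((q2 * q3 : ℕ) : ZMod p) = 0 := by rwa [ZMod.natCast_eq_zero_iff]
      push_cast at z23
      have hβ' : ((σ 1 0 : ℤ) : ZMod p) ≠ 0 := by rwa [Ne, ZMod.intCast_zmod_eq_zero_iff_dvd]
      have F3 := congrArg (fun z : ℤ => (z : ZMod p)) E3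
      have F4 := congrArg (fun z : ℤ => (z : ZMod p)) E4
      have Fd := congrArg (fun z : ℤ => (z : ZMod p)) hdet
      push_cast at F3 F4 Fd
      rw [z23] at F3 F4
      generalize ((σ 1 0 : ℤ) : ZMod p) = β at *
      generalize ((σ 0 0 : ℤ) : ZMod p) = α at *
      generalize ((σ 0 1 : ℤ) : ZMod p) = g at *
      generalize ((σ 1 1 : ℤ) : ZMod p) = δ at *
      have k1 : (a : ZMod p) * β + (q2 * b) * δ = 0 := by
        have : β ^ 2 * ((a : ZMod p) * β + (q2 * b) * δ) = 0 := by linear_combination F4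
        exact (mul_eq_zero.1 this).resolve_left (pow_ne_zero _ hβ')
      have k2 : (a : ZMod p) * α + (q2 * b) * g = 0 := by
        have : β ^ 2 * ((a : ZMod p) * α + (q2 * b) * g) = 0 := by linear_combination F3 - 2 * α * β * k1
        exact (mul_eq_zero.1 this).resolve_left (pow_ne_zero _ hβ')
      have ka : (a : ZMod p) = 0 := by linear_combination (-(a : ZMod p)) * Fd + δ * k2 - g * k1
      have kb : (q2 : ZMod p) * b = 0 := by linear_combination (-(q2 * b : ZMod p)) * Fd + α * k1 - β * k2
      rcases hp.dvd_mul.1 hp23 with h | h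
      · exact hn.1 p hp h ((ZMod.intCast_zmod_eq_zero_iff_dvd _ _).1 ka)
      · apply hn.2 p hp h
        rcases mul_eq_zero.1 kb with k | k
        · rw [ZMod.natCast_eq_zero_iff] at k
          have := Nat.dvd_gcd k h
          rw [c23] at this
          exact absurd (Nat.dvd_one.1 this) hp.one_lt.ne'
        · exact (ZMod.intCast_zmod_eq_zero_iff_dvd _ _).1 k
  push_cast at key
  obtain ⟨t, ht⟩ := key
  have n2 : (q2 : ℤ) ≠ 0 := by rintro h; apply hm; simp [Int.natCast_eq_zero.1 h]
  have n3 : (q3 : ℤ) ≠ 0 := by rintro h; apply hm; simp [Int.natCast_eq_zero.1 h]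
  have n4 : (q4 : ℤ) ≠ 0 := by rintro h; apply hm; simp [Int.natCast_eq_zero.1 h]
  have hd' : (!![σ 0 0, q2 * q3 * q4 * σ 0 1; t, σ 1 1] : Matrix (Fin 2) (Fin 2) ℤ).det = 1 := by
    rw [Matrix.det_fin_two]; simp; rw [ht] at hdet; linear_combination hdet
  refine ⟨!![σ 0 0, q2 * q3 * q4 * σ 0 1; t, σ 1 1], hd', ?_⟩
  rw [nf, nf, act_eq _ hd']
  simp only [Matrix.of_apply, Matrix.cons_val_zero, Matrix.cons_val_one, Matrix.cons_val', Matrix.cons_val_fin_one]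
  rw [ht] at E2 E3 E4
  generalize σ 0 0 = α at *
  generalize σ 0 1 = g at *
  generalize σ 1 1 = δ at *
  have n23 : (q2 * q3 : ℤ) ≠ 0 := mul_ne_zero n2 n3
  ext <;> simp only
  · linear_combination ((q2 : ℤ) * q3 * q4) ^ 2 * q4 * E1
  · linear_combination ((q2 : ℤ) * q3 * q4) * q4 * E2
  · linear_combination (q4 : ℤ) * E3
  · apply mul_left_cancel₀ n23
    linear_combination E4

end BCF

namespace BCF

lemma quad_red (α β γ : ℝ) (hα : 0 < α) (hΔ : 0 < 4 * α * γ - β ^ 2) :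
    ∃ M : Matrix (Fin 2) (Fin 2) ℤ, M.det = 1 ∧
      3 * (α * (M 0 0 : ℝ) ^ 2 + β * (M 0 0 : ℝ) * (M 0 1 : ℝ) + γ * (M 0 1 : ℝ) ^ 2) ^ 2 ≤
        4 * α * γ - β ^ 2 ∧
      0 < α * (M 0 0 : ℝ) ^ 2 + β * (M 0 0 : ℝ) * (M 0 1 : ℝ) + γ * (M 0 1 : ℝ) ^ 2 := by
  set Δ := 4 * α * γ - β ^ 2 with hΔd
  have hs : 0 < √Δ := Real.sqrt_pos.2 hΔ
  have hs2 : √Δ ^ 2 = Δ := Real.sq_sqrt hΔ.le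
  set y := √Δ / (2 * α) with hy
  have hy0 : 0 < y := by positivity
  let τ : UpperHalfPlane := ⟨⟨β / (2 * α), y⟩, hy0⟩
  obtain ⟨g, hg⟩ := ModularGroup.exists_smul_mem_fd τ
  have h3 := ModularGroup.three_le_four_mul_im_sq_of_mem_fd hg
  rw [ModularGroup.im_smul_eq_div_normSq, ModularGroup.denom_apply] at h3
  have hdet := g.2
  rw [Matrix.det_fin_two] at hdet
  refine ⟨!![g 1 1, g 1 0; g 0 1, g 0 0], ?_, ?_⟩
  · rw [Matrix.det_fin_two]; simp; linarith
  simp only [Matrix.of_apply, Matrix.cons_val', Matrix.cons_val_zero, Matrix.cons_val_one]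
  set c : ℝ := ((g 1 0 : ℤ) : ℝ) with hc
  set d : ℝ := ((g 1 1 : ℤ) : ℝ) with hd
  have hn : Complex.normSq (((g 1 0 : ℤ) : ℂ) * (τ : ℂ) + ((g 1 1 : ℤ) : ℂ)) =
      (c * (β / (2 * α)) + d) ^ 2 + (c * y) ^ 2 := by
    rw [Complex.normSq_apply]
    simp [τ, UpperHalfPlane.coe, hc, hd]
    ring
  have hv : α * d ^ 2 + β * d * c + γ * c ^ 2 = α * ((c * (β / (2 * α)) + d) ^ 2 + (c * y) ^ 2) := by
    have : y ^ 2 = Δ / (2 * α) ^ 2 := by rw [hy, div_pow, hs2]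
    rw [mul_pow c y, this, hΔd]
    field_simp
    ring
  have him : τ.im = y := rfl
  rw [hn, him] at h3
  rw [hv]
  set N := (c * (β / (2 * α)) + d) ^ 2 + (c * y) ^ 2 with hN
  have hN0 : 0 < N := by
    rcases (by positivity : 0 ≤ N).eq_or_lt with h | h
    · rw [← h] at h3; norm_num at h3
    · exact h
  refine ⟨?_, by positivity⟩
  rw [div_pow, ← mul_div_assoc, le_div_iff₀ (by positivity)] at h3
  have : 4 * y ^ 2 * α ^ 2 = Δ := by rw [hy, div_pow, hs2]; field_simp; norm_num
  nlinarith [mul_le_mul_of_nonneg_right h3 (sq_nonneg α)]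

lemma cubic_root (a b c d : ℝ) (ha : a ≠ 0) : ∃ t : ℝ, a * t ^ 3 + b * t ^ 2 + c * t + d = 0 := by
  have key : ∀ b c d : ℝ, ∃ t : ℝ, t ^ 3 + b * t ^ 2 + c * t + d = 0 := by
    intro b c d
    set M := 1 + |b| + |c| + |d| with hM
    have hM1 : 1 ≤ M := by have := abs_nonneg b; have := abs_nonneg c; have := abs_nonneg d; linarith
    have hM0 : 0 ≤ M := by linarith
    have hMM : M ≤ M ^ 2 := by nlinarith
    have e1 : |b| * M ^ 2 + |c| * M + |d| ≤ (|b| + |c| + |d|) * M ^ 2 := by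
      nlinarith [mul_le_mul_of_nonneg_left hMM (abs_nonneg c),
        mul_le_mul_of_nonneg_left (hM1.trans hMM) (abs_nonneg d)]
    have e2 : (|b| + |c| + |d|) * M ^ 2 = M ^ 3 - M ^ 2 := by rw [hM]; ring
    have hc : ContinuousOn (fun t : ℝ => t ^ 3 + b * t ^ 2 + c * t + d) (Set.Icc (-M) M) := by fun_prop
    have := intermediate_value_Icc (by linarith : -M ≤ M) hc
    have h0 : (0 : ℝ) ∈ Set.Icc ((-M) ^ 3 + b * (-M) ^ 2 + c * (-M) + d) (M ^ 3 + b * M ^ 2 + c * M + d) := by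
      constructor
      · nlinarith [mul_le_mul_of_nonneg_right (le_abs_self b) (sq_nonneg M),
          mul_le_mul_of_nonneg_right (neg_abs_le c) hM0, le_abs_self d, sq_nonneg M]
      · nlinarith [mul_le_mul_of_nonneg_right (neg_abs_le b) (sq_nonneg M),
          mul_le_mul_of_nonneg_right (neg_abs_le c) hM0, neg_abs_le d, sq_nonneg M]
    obtain ⟨t, _, ht⟩ := this h0
    exact ⟨t, ht⟩
  obtain ⟨t, ht⟩ := key (b / a) (c / a) (d / a)
  refine ⟨t, ?_⟩
  have : a * t ^ 3 + b * t ^ 2 + c * t + d = a * (t ^ 3 + b / a * t ^ 2 + c / a * t + d / a) := by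
    field_simp
  rw [this, ht, mul_zero]

/-- first reduction step -/
def pre (L : ℝ) (z : BCF) : Prop := |(z.1 : ℝ)| ≤ L ∧ |(hA z : ℝ)| ≤ 2 * L ^ 2

lemma red_pos (g : BCF) (hd : 0 < disc g) (L : ℝ) (hL : 0 < L) (hW : (disc g : ℝ) < L ^ 4) :
    ∃ M : Matrix (Fin 2) (Fin 2) ℤ, M.det = 1 ∧ pre L (act M g) := by
  have hh := hess_disc g
  have hpos : 0 < hA g := by
    have h1 : 0 < 4 * hA g * hC g := by nlinarith [sq_nonneg (hB g)]
    have h0 : hA g ≠ 0 := by rintro h; rw [h] at h1; simp at h1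
    by_contra hn
    have hneg : hA g < 0 := by omega
    obtain ⟨a, b, c, d⟩ := g
    have := syz a b c d
    simp only [hA] at hneg
    have h3 : (b ^ 2 - 3 * a * c) ^ 3 < 0 := Odd.pow_neg (by decide) hneg
    nlinarith [sq_nonneg (2 * b ^ 3 - 9 * a * b * c + 27 * a ^ 2 * d), mul_nonneg (sq_nonneg a) hd.le]
  have hhR : 4 * (hA g : ℝ) * (hC g : ℝ) - (hB g : ℝ) ^ 2 = 3 * (disc g : ℝ) := by exact_mod_cast hh
  have hdR : (0 : ℝ) < disc g := by exact_mod_cast hd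
  obtain ⟨M, hM, h1, h2⟩ := quad_red (hA g) (hB g) (hC g) (by exact_mod_cast hpos) (by rw [hhR]; linarith)
  refine ⟨M, hM, ?_⟩
  have hP : (hA (act M g) : ℝ) = hA g * (M 0 0 : ℝ) ^ 2 + hB g * (M 0 0 : ℝ) * (M 0 1 : ℝ) + hC g * (M 0 1 : ℝ) ^ 2 := by
    rw [hA_act M hM]; push_cast; ring
  rw [← hP, hhR] at h1
  rw [← hP] at h2
  have hD := disc_act M hM g
  rcases hz : act M g with ⟨a, b, c, d⟩
  rw [hz] at h1 h2 hD
  have hs := syz a b c d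
  rw [hD] at hs
  have hsR : 4 * (hA (a, b, c, d) : ℝ) ^ 3 - (2 * b ^ 3 - 9 * a * b * c + 27 * a ^ 2 * d) ^ 2
    = 27 * a ^ 2 * disc g := by simp only [hA]; exact_mod_cast hs
  set P : ℝ := (hA (a, b, c, d) : ℝ)
  have hP2 : P ^ 2 ≤ disc g := by linarith
  have hPL : P ≤ L ^ 2 := by
    refine le_trans (le_abs_self _) (abs_le_of_sq_le_sq ?_ (by positivity))
    nlinarith
  refine ⟨?_, ?_⟩
  · have h27 : 27 * (a : ℝ) ^ 2 ≤ 4 * P := by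
      by_contra hn
      push Not at hn
      have : 4 * P * disc g < 27 * (a : ℝ) ^ 2 * disc g := mul_lt_mul_of_pos_right hn hdR
      nlinarith [sq_nonneg (2 * (b : ℝ) ^ 3 - 9 * a * b * c + 27 * a ^ 2 * d), mul_le_mul_of_nonneg_left hP2 h2.le]
    apply abs_le_of_sq_le_sq _ hL.le
    show (a : ℝ) ^ 2 ≤ _
    nlinarith [sq_nonneg (a : ℝ)]
  · rw [abs_of_pos h2]; nlinarith

lemma red_neg (g : BCF) (hd : disc g < 0) (L : ℝ) (hL : 0 < L) (hW : -(disc g : ℝ) < L ^ 4) :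
    ∃ M : Matrix (Fin 2) (Fin 2) ℤ, M.det = 1 ∧ pre L (act M g) := by
  obtain ⟨a, b, c, d⟩ := g
  have hf : ∃ l m α β γ : ℝ, (a : ℝ) = l * α ∧ (b : ℝ) = l * β + m * α ∧ (c : ℝ) = l * γ + m * β ∧
      (d : ℝ) = m * γ := by
    by_cases ha : a = 0
    · exact ⟨0, 1, b, c, d, by simp [ha], by ring, by ring, by ring⟩
    · obtain ⟨t, ht⟩ := cubic_root a b c d (by exact_mod_cast ha)
      exact ⟨1, -t, a, b + a * t, c + b * t + a * t ^ 2, by ring, by ring, by ring, by linarith⟩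
  obtain ⟨l, m, α, β, γ, h1, h2, h3, h4⟩ := hf
  have hDR : (disc (a, b, c, d) : ℝ) = -(4 * α * γ - β ^ 2) * (γ * l ^ 2 - β * l * m + α * m ^ 2) ^ 2 := by
    simp only [disc]; push_cast; rw [h1, h2, h3, h4]; ring
  have hdR : (disc (a, b, c, d) : ℝ) < 0 := by exact_mod_cast hd
  have hΔ : 0 < 4 * α * γ - β ^ 2 := by
    by_contra hn
    push Not at hn
    nlinarith [mul_nonneg (neg_nonneg.2 hn) (sq_nonneg (γ * l ^ 2 - β * l * m + α * m ^ 2))]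
  -- make α positive
  have hf : ∃ l m α β γ : ℝ, (a : ℝ) = l * α ∧ (b : ℝ) = l * β + m * α ∧ (c : ℝ) = l * γ + m * β ∧
      (d : ℝ) = m * γ ∧ 0 < 4 * α * γ - β ^ 2 ∧ 0 < α := by
    rcases lt_trichotomy α 0 with h | h | h
    · exact ⟨-l, -m, -α, -β, -γ, by linarith, by linarith, by linarith, by linarith, by linarith, by linarith⟩
    · rw [h] at hΔ; nlinarith [sq_nonneg β]
    · exact ⟨l, m, α, β, γ, h1, h2, h3, h4, hΔ, h⟩
  clear! l m α β γ
  obtain ⟨l, m, α, β, γ, h1, h2, h3, h4, hΔ, hα⟩ := hf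
  have hDR : -(disc (a, b, c, d) : ℝ) = (4 * α * γ - β ^ 2) * (γ * l ^ 2 - β * l * m + α * m ^ 2) ^ 2 := by
    simp only [disc]; push_cast; rw [h1, h2, h3, h4]; ring
  obtain ⟨M, hM, k1, k2⟩ := quad_red α β γ hα hΔ
  refine ⟨M, hM, ?_⟩
  set r : ℝ := (M 0 0 : ℝ) with hr
  set s : ℝ := (M 0 1 : ℝ)
  set A := α * r ^ 2 + β * r * s + γ * s ^ 2 with hA'
  set R := γ * l ^ 2 - β * l * m + α * m ^ 2 with hR
  set Δ := 4 * α * γ - β ^ 2 with hΔd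
  set l' := l * r + m * s with hl
  have hP : (hA (act M (a, b, c, d)) : ℝ) = A * R - l' ^ 2 * Δ := by
    rw [hA_act M hM]; simp only [hA, hB, hC]; push_cast; rw [h1, h2, h3, h4, hA', hR, hl, hΔd]; ring
  have ha : ((act M (a, b, c, d)).1 : ℝ) = l' * A := by
    rw [act_eq M hM]; push_cast; rw [h1, h2, h3, h4, hA', hl]; ring
  have hkey : 4 * A * R - Δ * l' ^ 2 = ((2 * α * m - β * l) * r + (β * m - 2 * γ * l) * s) ^ 2 := by
    rw [hA', hR, hl, hΔd]; ring
  have hkey' : Δ * l' ^ 2 ≤ 4 * (A * R) := by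
    have := sq_nonneg ((2 * α * m - β * l) * r + (β * m - 2 * γ * l) * s)
    rw [← hkey] at this; linarith
  have hAR0 : 0 ≤ A * R := by
    have := mul_nonneg hΔ.le (sq_nonneg l')
    linarith
  have hAR : 3 * (A * R) ^ 2 ≤ L ^ 4 := by
    have := mul_le_mul_of_nonneg_right k1 (sq_nonneg R)
    rw [← hDR] at this; rw [mul_pow]; linarith
  have hARL : 3 * (A * R) ≤ 2 * L ^ 2 := by
    refine le_trans (le_abs_self _) (abs_le_of_sq_le_sq ?_ (by positivity))
    have e1 : (3 * (A * R)) ^ 2 = 3 * (3 * (A * R) ^ 2) := by ring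
    have e2 : (2 * L ^ 2) ^ 2 = 4 * L ^ 4 := by ring
    have : 0 ≤ L ^ 4 := by positivity
    rw [e1, e2]; linarith
  have hΔl : 0 ≤ Δ * l' ^ 2 := by positivity
  refine ⟨?_, ?_⟩
  · rw [ha]
    apply abs_le_of_sq_le_sq _ hL.le
    have := mul_le_mul_of_nonneg_right k1 (sq_nonneg l')
    rw [mul_pow]
    have := sq_nonneg L
    linarith
  · rw [hP, abs_le]
    have e : l' ^ 2 * Δ = Δ * l' ^ 2 := mul_comm _ _
    rw [e]
    constructor <;> linarith

/-- reduced forms -/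
def redd (L : ℝ) (z : BCF) : Prop :=
  (z.1 = 0 ∧ z.2.1 ≠ 0 ∧ |z.2.2.1| ≤ |z.2.1|) ∨
  (z.1 ≠ 0 ∧ |(z.1 : ℝ)| ≤ L ∧ |(hA z : ℝ)| ≤ 2 * L ^ 2 ∧ 2 * |z.2.1| ≤ 3 * |z.1|)

lemma shear (b n : ℤ) (hn : n ≠ 0) : ∃ k : ℤ, 2 * |b + n * k| ≤ |n| := by
  refine ⟨-(round ((b : ℚ) / n)), ?_⟩
  have h := abs_sub_round ((b : ℚ) / n)
  have hnq : (n : ℚ) ≠ 0 := by exact_mod_cast hn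
  have : (b : ℚ) + n * (-(round ((b : ℚ) / n)) : ℤ) = n * ((b : ℚ) / n - round ((b : ℚ) / n)) := by
    push_cast; field_simp; ring
  have h2 : 2 * |(b : ℚ) + n * (-(round ((b : ℚ) / n)) : ℤ)| ≤ |(n : ℚ)| := by
    rw [this, abs_mul]; nlinarith [abs_nonneg (n : ℚ)]
  exact_mod_cast h2

lemma reduce (g : BCF) (hd : disc g ≠ 0) (L : ℝ) (hL : 0 < L) (hW : |(disc g : ℝ)| < L ^ 4) :
    ∃ M : Matrix (Fin 2) (Fin 2) ℤ, M.det = 1 ∧ redd L (act M g) := by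
  have h : ∃ M : Matrix (Fin 2) (Fin 2) ℤ, M.det = 1 ∧ pre L (act M g) := by
    rcases lt_or_gt_of_ne hd with h | h
    · exact red_neg g h L hL (lt_of_le_of_lt (neg_le_abs _) hW)
    · exact red_pos g h L hL (lt_of_le_of_lt (le_abs_self _) hW)
  obtain ⟨M, hM, h1, h2⟩ := h
  have hd' : disc (act M g) ≠ 0 := by rwa [disc_act M hM]
  rcases hz : act M g with ⟨a, b, c, d⟩
  rw [hz] at h1 h2 hd'
  have hdet : ∀ k : ℤ, (!![1, 0; k, 1] : Matrix (Fin 2) (Fin 2) ℤ).det = 1 := by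
    intro k; rw [Matrix.det_fin_two]; simp
  have hact : ∀ k : ℤ, act (!![1, 0; k, 1] * M) g = (a, b + 3 * a * k, c + 2 * b * k + 3 * a * k ^ 2,
      d + c * k + b * k ^ 2 + a * k ^ 3) := by
    intro k
    rw [act_mul, hz, act_eq _ (hdet k)]
    simp
    refine ⟨?_, ?_, ?_⟩ <;> ring
  by_cases ha : a = 0
  · subst ha
    have hb : b ≠ 0 := by rintro rfl; simp [disc] at hd'
    obtain ⟨k, hk⟩ := shear c (2 * b) (by omega)
    refine ⟨!![1, 0; k, 1] * M, by rw [Matrix.det_mul, hdet, hM]; rfl, Or.inl ?_⟩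
    rw [hact]
    refine ⟨rfl, by simpa using hb, ?_⟩
    simp only
    rw [abs_mul, show |(2:ℤ)| = 2 from rfl] at hk
    have : c + 2 * b * k + 3 * 0 * k ^ 2 = c + 2 * b * k := by ring
    rw [this, show b + 3 * 0 * k = b by ring]
    omega
  · obtain ⟨k, hk⟩ := shear b (3 * a) (by omega)
    refine ⟨!![1, 0; k, 1] * M, by rw [Matrix.det_mul, hdet, hM]; rfl, Or.inr ?_⟩
    rw [hact]
    refine ⟨ha, h1, ?_, ?_⟩
    · have : hA (a, b + 3 * a * k, c + 2 * b * k + 3 * a * k ^ 2, d + c * k + b * k ^ 2 + a * k ^ 3)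
        = hA (a, b, c, d) := by simp only [hA]; ring
      rw [this]; exact h2
    · rw [abs_mul 3 a, show |(3:ℤ)| = 3 from rfl] at hk
      exact hk

end BCF

namespace BCF

lemma card_fib {α β : Type*} [DecidableEq β] (s : Finset α) (t : Finset β) (f : α → β) (N : β → ℝ)
    (hf : ∀ x ∈ s, f x ∈ t) (h : ∀ y ∈ t, ((s.filter (fun x => f x = y)).card : ℝ) ≤ N y) :
    (s.card : ℝ) ≤ ∑ y ∈ t, N y := by
  rw [Finset.card_eq_sum_card_fiberwise (t := t) (f := f) hf]
  push_cast
  exact Finset.sum_le_sum h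

lemma cnt (s : Finset ℤ) (k : ℕ) (hk : 0 < k) (ℓ : ℝ) (hℓ : 0 ≤ ℓ)
    (h1 : ∀ x ∈ s, ∀ y ∈ s, (x : ℝ) - y ≤ ℓ) (h2 : ∀ x ∈ s, ∀ y ∈ s, (k : ℤ) ∣ x - y) :
    (s.card : ℝ) ≤ ℓ / k + 1 := by
  rcases s.eq_empty_or_nonempty with rfl | hne
  · simp; positivity
  have hkR : (0 : ℝ) < k := by exact_mod_cast hk
  set x0 := s.min' hne with hx0
  have hx0s : x0 ∈ s := s.min'_mem hne
  have : s.card ≤ (Finset.range (⌊ℓ / k⌋₊ + 1)).card := by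
    apply Finset.card_le_card_of_injOn (fun x => ((x - x0) / k).toNat)
    · intro x hx
      have hle : x0 ≤ x := s.min'_le x hx
      obtain ⟨t, ht⟩ := h2 x hx x0 hx0s
      have e : (x - x0) / k = t := by rw [ht]; exact Int.mul_ediv_cancel_left _ (by omega)
      have ht0 : 0 ≤ t := by
        by_contra hn; push Not at hn
        have : (k : ℤ) * t < 0 := mul_neg_of_pos_of_neg (by omega) hn
        omega
      simp only [Finset.coe_range, Set.mem_Iio]
      rw [e]
      have h3 := h1 x hx x0 hx0s
      have h4 : ((t.toNat : ℕ) : ℝ) ≤ ℓ / k := by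
        rw [le_div_iff₀ hkR]
        have : ((t.toNat : ℤ) : ℝ) = (t : ℝ) := by rw [Int.toNat_of_nonneg ht0]
        have h5 : (x : ℝ) - x0 = k * t := by exact_mod_cast ht
        rw [Int.cast_natCast] at this
        rw [this]; linarith
      exact Nat.lt_succ_of_le (Nat.le_floor h4)
    · intro x hx y hy hxy
      have hle : x0 ≤ x := s.min'_le x hx
      have hle' : x0 ≤ y := s.min'_le y hy
      obtain ⟨t, ht⟩ := h2 x hx x0 hx0s
      obtain ⟨t', ht'⟩ := h2 y hy x0 hx0s
      have e : (x - x0) / k = t := by rw [ht]; exact Int.mul_ediv_cancel_left _ (by omega)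
      have e' : (y - x0) / k = t' := by rw [ht']; exact Int.mul_ediv_cancel_left _ (by omega)
      have ht0 : 0 ≤ t := by
        by_contra hn; push Not at hn
        have : (k : ℤ) * t < 0 := mul_neg_of_pos_of_neg (by omega) hn
        omega
      have ht0' : 0 ≤ t' := by
        by_contra hn; push Not at hn
        have : (k : ℤ) * t' < 0 := mul_neg_of_pos_of_neg (by omega) hn
        omega
      simp only [e, e'] at hxy
      have : t = t' := by omega
      subst this; omega
  rw [Finset.card_range] at this
  have h2 : ((⌊ℓ / k⌋₊ : ℕ) : ℝ) ≤ ℓ / k := Nat.floor_le (by positivity)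
  have h3 : (s.card : ℝ) ≤ (⌊ℓ / k⌋₊ : ℝ) + 1 := by exact_mod_cast this
  linarith

def Uu (a b c d : ℤ) : ℤ := 2 * b ^ 3 - 9 * a * b * c + 27 * a ^ 2 * d

/-- one sign class -/
lemma dcount1 (a b c : ℤ) (ha : a ≠ 0) (m : ℕ) (hm : Squarefree m) (hm3 : ¬ 3 ∣ m)
    (ℓ : ℝ) (hℓ : 0 ≤ ℓ) (s : Finset ℤ) (hs : ∀ d ∈ s, (m : ℤ) ∣ disc (a, b, c, d))
    (hl : ∀ d ∈ s, ∀ d' ∈ s, (Uu a b c d : ℝ) - Uu a b c d' ≤ ℓ) :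
    (s.card : ℝ) ≤ m.divisors.card * (ℓ * (Int.gcd a m) / (27 * a ^ 2 * m) + 1) := by
  have hm0 : 0 < m := Nat.pos_of_ne_zero hm.ne_zero
  have haR : (0 : ℝ) < (a : ℝ) ^ 2 := by positivity
  have hmR : (0 : ℝ) < m := by exact_mod_cast hm0
  rcases s.eq_empty_or_nonempty with rfl | ⟨d0, hd0⟩
  · simp; positivity
  obtain ⟨k, hk⟩ : Int.gcd a m ∣ m := by
    have := Int.gcd_dvd_right (a := a) (b := m); exact_mod_cast this
  set g := Int.gcd a m with hg
  have hg0 : 0 < g := Nat.pos_of_ne_zero (by rintro h; rw [h] at hk; omega)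
  have hk0 : 0 < k := Nat.pos_of_ne_zero (by rintro h; rw [h] at hk; omega)
  have hkm : k ∣ m := ⟨g, by rw [hk]; ring⟩
  have hksq : Squarefree k := hm.squarefree_of_dvd hkm
  -- primes dividing k do not divide a
  have hpa : ∀ p : ℕ, p.Prime → p ∣ k → ¬ (p : ℤ) ∣ a := by
    intro p hp hpk hpa
    have h1 : p ∣ g := by
      have : (p : ℤ) ∣ (g : ℤ) := Int.dvd_coe_gcd hpa (by exact_mod_cast hpk.trans hkm)
      exact_mod_cast this
    have h2 : p * p ∣ m := by rw [hk]; exact mul_dvd_mul h1 hpk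
    exact hp.one_lt.ne' (Nat.isUnit_iff.1 (hm p h2))
  have hU : ∀ d ∈ s, ∀ d' ∈ s, (m : ℤ) ∣ (Uu a b c d - Uu a b c d') * (Uu a b c d + Uu a b c d') := by
    intro d hd d' hd'
    have e : (Uu a b c d - Uu a b c d') * (Uu a b c d + Uu a b c d') =
      27 * a ^ 2 * (disc (a, b, c, d') - disc (a, b, c, d)) := by
      have e1 := syz a b c d
      have e2 := syz a b c d'
      simp only [Uu]; linarith
    rw [e]
    exact (dvd_sub (hs d' hd') (hs d hd)).mul_left _
  have key := card_fib s m.divisors (fun d => Int.gcd (Uu a b c d - Uu a b c d0) k)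
    (fun _ => ℓ * g / (27 * a ^ 2 * m) + 1) ?_ ?_
  · rw [Finset.sum_const, nsmul_eq_mul] at key
    exact key
  · intro d _
    rw [Nat.mem_divisors]
    refine ⟨?_, hm0.ne'⟩
    have : Int.gcd (Uu a b c d - Uu a b c d0) k ∣ k := by
      have := Int.gcd_dvd_right (a := Uu a b c d - Uu a b c d0) (b := (k : ℤ)); exact_mod_cast this
    exact this.trans hkm
  · intro e _
    have := cnt (s.filter (fun d => Int.gcd (Uu a b c d - Uu a b c d0) k = e)) k hk0
      (ℓ / (27 * a ^ 2)) (by positivity) ?_ ?_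
    · refine this.trans (le_of_eq ?_)
      congr 1
      rw [hk]; push_cast
      have : (g : ℝ) ≠ 0 := by positivity
      have : (k : ℝ) ≠ 0 := by positivity
      field_simp
    · intro d hd d' hd'
      rw [Finset.mem_filter] at hd hd'
      have := hl d hd.1 d' hd'.1
      rw [le_div_iff₀ (by positivity)]
      simp only [Uu] at this
      push_cast at this
      linarith
    · intro d hd d' hd'
      rw [Finset.mem_filter] at hd hd'
      have := sqf_pow_dvd k hksq 1 (d - d') ?_
      · simpa using this
      intro p hp hpk
      rw [pow_one]
      have hpz : Prime (p : ℤ) := Nat.prime_iff_prime_int.1 hp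
      have hpU : (p : ℤ) ∣ Uu a b c d - Uu a b c d' := by
        have hpkz : (p : ℤ) ∣ (k : ℤ) := by exact_mod_cast hpk
        have hpm : (p : ℤ) ∣ (m : ℤ) := by exact_mod_cast hpk.trans hkm
        by_cases hpe : p ∣ e
        · have h1 : (p : ℤ) ∣ Uu a b c d - Uu a b c d0 := by
            refine Dvd.dvd.trans ?_ (Int.gcd_dvd_left (a := Uu a b c d - Uu a b c d0) (b := (k : ℤ)))
            rw [hd.2]; exact_mod_cast hpe
          have h2 : (p : ℤ) ∣ Uu a b c d' - Uu a b c d0 := by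
            refine Dvd.dvd.trans ?_ (Int.gcd_dvd_left (a := Uu a b c d' - Uu a b c d0) (b := (k : ℤ)))
            rw [hd'.2]; exact_mod_cast hpe
          have := dvd_sub h1 h2
          rwa [sub_sub_sub_cancel_right] at this
        · have h1 : ∀ y ∈ s, Int.gcd (Uu a b c y - Uu a b c d0) k = e → (p : ℤ) ∣ Uu a b c y + Uu a b c d0 := by
            intro y hy hye
            rcases hpz.dvd_or_dvd (hpm.trans (hU y hy d0 hd0)) with h | h
            · exfalso; apply hpe
              have : (p : ℤ) ∣ (e : ℤ) := by rw [← hye]; exact Int.dvd_coe_gcd h hpkz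
              exact_mod_cast this
            · exact h
          have := dvd_sub (h1 d hd.1 hd.2) (h1 d' hd'.1 hd'.2)
          rwa [add_sub_add_right_eq_sub] at this
      have e1 : Uu a b c d - Uu a b c d' = 27 * a ^ 2 * (d - d') := by simp only [Uu]; ring
      rw [e1] at hpU
      rcases hpz.dvd_or_dvd hpU with h | h
      · exfalso
        rcases hpz.dvd_or_dvd h with h | h
        · have h27 : p ∣ 27 := by exact_mod_cast h
          have : p ∣ 3 := hp.dvd_of_dvd_pow (n := 3) (by norm_num; exact h27)
          have : p = 3 := (Nat.prime_dvd_prime_iff_eq hp Nat.prime_three).1 this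
          exact hm3 (this ▸ hpk.trans hkm)
        · exact hpa p hp hpk (hpz.dvd_of_dvd_pow h)
      · exact h

lemma dcount (a b c : ℤ) (ha : a ≠ 0) (m : ℕ) (hm : Squarefree m) (hm3 : ¬ 3 ∣ m)
    (ℓ : ℝ) (hℓ : 0 ≤ ℓ) (s : Finset ℤ) (hs : ∀ d ∈ s, (m : ℤ) ∣ disc (a, b, c, d))
    (hl : ∀ d ∈ s, ∀ d' ∈ s, 0 ≤ (Uu a b c d : ℝ) * Uu a b c d' → (Uu a b c d : ℝ) - Uu a b c d' ≤ ℓ) :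
    (s.card : ℝ) ≤ 2 * m.divisors.card * (ℓ * (Int.gcd a m) / (27 * a ^ 2 * m) + 1) := by
  have h1 := dcount1 a b c ha m hm hm3 ℓ hℓ (s.filter (fun d => 0 ≤ Uu a b c d))
    (fun d hd => hs d (Finset.mem_filter.1 hd).1) (fun d hd d' hd' => hl d (Finset.mem_filter.1 hd).1 d'
      (Finset.mem_filter.1 hd').1 (by
        have := (Finset.mem_filter.1 hd).2
        have := (Finset.mem_filter.1 hd').2
        exact mul_nonneg (by exact_mod_cast (Finset.mem_filter.1 hd).2) (by exact_mod_cast this)))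
  have h2 := dcount1 a b c ha m hm hm3 ℓ hℓ (s.filter (fun d => ¬ 0 ≤ Uu a b c d))
    (fun d hd => hs d (Finset.mem_filter.1 hd).1) (fun d hd d' hd' => hl d (Finset.mem_filter.1 hd).1 d'
      (Finset.mem_filter.1 hd').1 (by
        have h1 := not_le.1 (Finset.mem_filter.1 hd).2
        have h2 := not_le.1 (Finset.mem_filter.1 hd').2
        have h1' : (Uu a b c d : ℝ) < 0 := by exact_mod_cast h1
        have h2' : (Uu a b c d' : ℝ) < 0 := by exact_mod_cast h2
        exact (mul_pos_of_neg_of_neg h1' h2').le))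
  have h3 := Finset.card_filter_add_card_filter_not (s := s) (fun d => 0 ≤ Uu a b c d)
  have h4 : (s.card : ℝ) = ((s.filter (fun d => 0 ≤ Uu a b c d)).card : ℝ) +
    ((s.filter (fun d => ¬ 0 ≤ Uu a b c d)).card : ℝ) := by rw [← h3]; push_cast; rfl
  rw [h4]; linarith

end BCF

namespace BCF

lemma tele (P0 h : ℝ) (hP : 0 < P0) (hh : 0 < h) (N : ℕ) :
    ∑ n ∈ Finset.range (N + 1), (√(P0 + n * h) ^ 3)⁻¹ ≤
      (√P0 ^ 3)⁻¹ + 2 / h * ((√P0)⁻¹ - (√(P0 + N * h))⁻¹) := by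
  induction N with
  | zero => simp
  | succ N ih =>
    rw [Finset.sum_range_succ]
    have key : (√(P0 + (N + 1 : ℕ) * h) ^ 3)⁻¹ ≤
        2 / h * ((√(P0 + N * h))⁻¹ - (√(P0 + (N + 1 : ℕ) * h))⁻¹) := by
      set s := √(P0 + N * h) with hs
      set t := √(P0 + (N + 1 : ℕ) * h) with ht
      have hs0 : 0 < s := Real.sqrt_pos.2 (by positivity)
      have ht0 : 0 < t := Real.sqrt_pos.2 (by positivity)
      have hs2 : s ^ 2 = P0 + N * h := Real.sq_sqrt (by positivity)
      have ht2 : t ^ 2 = P0 + (N + 1 : ℕ) * h := Real.sq_sqrt (by positivity)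
      have hst : h = t ^ 2 - s ^ 2 := by rw [hs2, ht2]; push_cast; ring
      have hle : s ≤ t := by
        refine le_trans (le_abs_self _) (abs_le_of_sq_le_sq ?_ ht0.le); linarith
      have hlt : 0 < t - s := by
        by_contra hn
        have : s = t := le_antisymm hle (by linarith)
        rw [this] at hst; simp at hst; linarith
      have e : 2 / h * (s⁻¹ - t⁻¹) = 2 / ((t + s) * (s * t)) := by
        rw [hst]
        have : t ^ 2 - s ^ 2 = (t - s) * (t + s) := by ring
        rw [this]
        field_simp
      rw [e, inv_eq_one_div, div_le_div_iff₀ (by positivity) (by positivity)]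
      have e1 : s * s ≤ t * t := by nlinarith
      have e2 : t * (t * s) ≤ t * (t * t) := by gcongr
      have e3 : t * (s * s) ≤ t * (t * t) := by gcongr
      nlinarith
    have e : 2 / h * ((√P0)⁻¹ - (√(P0 + (N + 1 : ℕ) * h))⁻¹) = 2 / h * ((√P0)⁻¹ - (√(P0 + N * h))⁻¹) +
      2 / h * ((√(P0 + N * h))⁻¹ - (√(P0 + (N + 1 : ℕ) * h))⁻¹) := by ring
    rw [e]; linarith

lemma decay {ι : Type*} (s : Finset ι) (f : ι → ℝ) (P0 h : ℝ) (hP : 0 < P0) (hh : 0 < h)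
    (h1 : ∀ x ∈ s, P0 ≤ f x) (h2 : ∀ x ∈ s, ∀ y ∈ s, x ≠ y → h ≤ |f x - f y|) :
    ∑ x ∈ s, (√(f x) ^ 3)⁻¹ ≤ (√P0 ^ 3)⁻¹ + 2 / h * (√P0)⁻¹ := by
  set φ : ι → ℕ := fun x => ⌊(f x - P0) / h⌋₊ with hφ
  have hb : ∀ x ∈ s, P0 + φ x * h ≤ f x ∧ f x < P0 + φ x * h + h := by
    intro x hx
    have h0 : 0 ≤ (f x - P0) / h := div_nonneg (by linarith [h1 x hx]) hh.le
    have e1 := Nat.floor_le h0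
    have e2 := Nat.lt_floor_add_one ((f x - P0) / h)
    rw [le_div_iff₀ hh] at e1
    rw [div_lt_iff₀ hh] at e2
    simp only [hφ]
    constructor <;> linarith
  have hinj : Set.InjOn φ s := by
    intro x hx y hy hxy
    by_contra hne
    have := h2 x hx y hy hne
    have a1 := hb x hx
    have a2 := hb y hy
    rw [hxy] at a1
    rw [le_abs] at this
    rcases this with h | h <;> linarith [a1.1, a1.2, a2.1, a2.2]
  set N := s.sup φ
  calc ∑ x ∈ s, (√(f x) ^ 3)⁻¹ ≤ ∑ x ∈ s, (√(P0 + φ x * h) ^ 3)⁻¹ := by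
        apply Finset.sum_le_sum
        intro x hx
        have : 0 < √(P0 + φ x * h) := Real.sqrt_pos.2 (by positivity)
        have := Real.sqrt_le_sqrt (hb x hx).1
        gcongr
    _ = ∑ n ∈ s.image φ, (√(P0 + n * h) ^ 3)⁻¹ := by rw [Finset.sum_image hinj]
    _ ≤ ∑ n ∈ Finset.range (N + 1), (√(P0 + n * h) ^ 3)⁻¹ := by
        apply Finset.sum_le_sum_of_subset_of_nonneg
        · intro n hn
          rw [Finset.mem_image] at hn
          obtain ⟨x, hx, rfl⟩ := hn
          rw [Finset.mem_range]
          exact Nat.lt_succ_of_le (Finset.le_sup hx)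
        · intros; positivity
    _ ≤ _ := tele P0 h hP hh N
    _ ≤ _ := by
        have : 0 ≤ (√(P0 + N * h))⁻¹ := by positivity
        gcongr
        linarith

/-- length of the U-interval -/
lemma Ulen (P T u v : ℝ) (hT : 0 ≤ T) (hu : |4 * P ^ 3 - u ^ 2| ≤ 27 * T ^ 2)
    (hv : |4 * P ^ 3 - v ^ 2| ≤ 27 * T ^ 2) (huv : 0 ≤ u * v) : u - v ≤ 8 * T := by
  refine le_trans (le_abs_self _) (abs_le_of_sq_le_sq ?_ (by positivity))
  rw [abs_le] at hu hv
  by_cases h : u ^ 2 ≤ v ^ 2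
  · have : u * v ≥ u ^ 2 := by
      have h1 : |u| ≤ |v| := sq_le_sq.1 h
      rw [← abs_of_nonneg huv, abs_mul, ← sq_abs u]
      nlinarith [abs_nonneg u]
    nlinarith
  · have : u * v ≥ v ^ 2 := by
      have h1 : |v| ≤ |u| := sq_le_sq.1 (le_of_not_ge h)
      rw [← abs_of_nonneg huv, abs_mul, ← sq_abs v]
      nlinarith [abs_nonneg v]
    nlinarith

lemma Ulen2 (P T u v : ℝ) (hP : 0 < P) (hPT : 27 * T ^ 2 ≤ P ^ 3)
    (hu : |4 * P ^ 3 - u ^ 2| ≤ 27 * T ^ 2)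
    (hv : |4 * P ^ 3 - v ^ 2| ≤ 27 * T ^ 2) (huv : 0 ≤ u * v) : u - v ≤ 27 * T ^ 2 * (√P ^ 3)⁻¹ := by
  set s := √P
  have hs0 : 0 < s := Real.sqrt_pos.2 hP
  have hs2 : s ^ 2 = P := Real.sq_sqrt hP.le
  rw [← hs2] at hu hv hPT
  rw [abs_le] at hu hv
  have hu3 : s ^ 3 ≤ |u| := by
    have : (s ^ 3) ^ 2 ≤ u ^ 2 := by nlinarith
    rw [sq_le_sq, abs_of_pos (by positivity)] at this; exact this
  have hv3 : s ^ 3 ≤ |v| := by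
    have : (s ^ 3) ^ 2 ≤ v ^ 2 := by nlinarith
    rw [sq_le_sq, abs_of_pos (by positivity)] at this; exact this
  rw [← div_eq_mul_inv, le_div_iff₀ (by positivity)]
  have hadd : |u + v| = |u| + |v| := by
    rw [abs_add_eq_add_abs_iff]
    rcases le_total 0 u with h | h
    · rcases le_total 0 v with h' | h'
      · exact Or.inl ⟨h, h'⟩
      · have : |u| > 0 := lt_of_lt_of_le (by positivity) hu3
        have hu' : 0 < u := by rwa [abs_of_nonneg h] at this
        have : v = 0 := by nlinarith
        exact Or.inl ⟨h, this.ge⟩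
    · rcases le_total 0 v with h' | h'
      · have : |v| > 0 := lt_of_lt_of_le (by positivity) hv3
        have hv' : 0 < v := by rwa [abs_of_nonneg h'] at this
        have : u = 0 := by nlinarith
        exact Or.inl ⟨this.ge, h'⟩
      · exact Or.inr ⟨h, h'⟩
  have h1 : |u - v| * |u + v| ≤ 54 * T ^ 2 := by
    rw [← abs_mul, show (u - v) * (u + v) = u ^ 2 - v ^ 2 by ring, abs_le]
    constructor <;> linarith
  have h2 : |u - v| * (2 * s ^ 3) ≤ |u - v| * |u + v| := by
    apply mul_le_mul_of_nonneg_left _ (abs_nonneg _); linarith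
  have h3 : (u - v) * s ^ 3 ≤ |u - v| * s ^ 3 := mul_le_mul_of_nonneg_right (le_abs_self _) (by positivity)
  linarith

end BCF

namespace BCF

lemma c_class (a b c d c' d' : ℤ) (q2 : ℕ) (hsq : Squarefree q2) (h3 : ¬ 3 ∣ q2)
    (h1 : (q2 : ℤ) ∣ hA (a, b, c, d)) (h2 : (q2 : ℤ) ∣ hC (a, b, c, d))
    (h1' : (q2 : ℤ) ∣ hA (a, b, c', d')) (h2' : (q2 : ℤ) ∣ hC (a, b, c', d')) : (q2 : ℤ) ∣ c - c' := by
  have := sqf_pow_dvd q2 hsq 1 (c - c') ?_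
  · simpa using this
  intro p hp hpq
  rw [pow_one]
  have hpz : Prime (p : ℤ) := Nat.prime_iff_prime_int.1 hp
  have hpq' : (p : ℤ) ∣ (q2 : ℤ) := by exact_mod_cast hpq
  replace h1 := hpq'.trans h1
  replace h2 := hpq'.trans h2
  replace h1' := hpq'.trans h1'
  replace h2' := hpq'.trans h2'
  simp only [hA, hC] at h1 h2 h1' h2'
  by_cases hpa : (p : ℤ) ∣ a
  · have hb : (p : ℤ) ∣ b := by
      apply hpz.dvd_of_dvd_pow (n := 2)
      have e : b ^ 2 = (b ^ 2 - 3 * a * c) + a * (3 * c) := by ring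
      rw [e]; exact dvd_add h1 (hpa.mul_right _)
    have hc : ∀ c d : ℤ, (p : ℤ) ∣ c ^ 2 - 3 * b * d → (p : ℤ) ∣ c := by
      intro c d h
      apply hpz.dvd_of_dvd_pow (n := 2)
      have e : c ^ 2 = (c ^ 2 - 3 * b * d) + b * (3 * d) := by ring
      rw [e]; exact dvd_add h (hb.mul_right _)
    exact dvd_sub (hc _ _ h2) (hc _ _ h2')
  · have h := dvd_sub h1' h1
    have e : b ^ 2 - 3 * a * c' - (b ^ 2 - 3 * a * c) = 3 * (a * (c - c')) := by ring
    rw [e] at h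
    rcases hpz.dvd_or_dvd h with h | h
    · exfalso
      have : p ∣ 3 := by exact_mod_cast h
      exact h3 (((Nat.prime_dvd_prime_iff_eq hp Nat.prime_three).1 this) ▸ hpq)
    · exact (hpz.dvd_or_dvd h).resolve_left hpa

set_option maxHeartbeats 1600000 in
lemma cd_count (a b : ℤ) (ha : a ≠ 0) (q2 m : ℕ) (hm : Squarefree m) (hm3 : ¬ 3 ∣ m) (h2m : q2 ∣ m)
    (L : ℝ) (hL : 0 < L) (haL : |(a : ℝ)| ≤ L) (s : Finset (ℤ × ℤ))
    (hs : ∀ x ∈ s, (m : ℤ) ∣ disc (a, b, x.1, x.2) ∧ |(disc (a, b, x.1, x.2) : ℝ)| ≤ L ^ 4 ∧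
      |(hA (a, b, x.1, x.2) : ℝ)| ≤ 2 * L ^ 2 ∧ (q2 : ℤ) ∣ hA (a, b, x.1, x.2) ∧ (q2 : ℤ) ∣ hC (a, b, x.1, x.2)) :
    (s.card : ℝ) ≤ 2 * m.divisors.card * ((Int.gcd a m : ℝ) / m * (L ^ 2 / |(a : ℝ)|) *
      (1 + 2 * √(L ^ 3 * |(a : ℝ)|) / (|(a : ℝ)| * q2)) + 2 * L ^ 2 / (|(a : ℝ)| * q2) + 1) := by
  have hm0 : 0 < m := Nat.pos_of_ne_zero hm.ne_zero
  have hmR : (0 : ℝ) < m := by exact_mod_cast hm0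
  have hq2 : 0 < q2 := Nat.pos_of_dvd_of_pos h2m hm0
  have hq2R : (0 : ℝ) < q2 := by exact_mod_cast hq2
  have haa : 0 < |(a : ℝ)| := by positivity
  set α := |(a : ℝ)| with hα
  have hα2 : (a : ℝ) ^ 2 = α ^ 2 := (sq_abs _).symm
  set r := √(L ^ 3 * α) with hr
  have hr0 : 0 < r := Real.sqrt_pos.2 (by positivity)
  have hr2 : r ^ 2 = L ^ 3 * α := Real.sq_sqrt (by positivity)
  set T := α * L ^ 2 with hT
  have hT0 : 0 < T := by positivity
  have hrT : T ^ 2 ≤ r ^ 3 := by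
    have : (T ^ 2) ^ 2 ≤ (r ^ 3) ^ 2 := by
      have e : (r ^ 3) ^ 2 = (α ^ 3 * L ^ 8) * L := by
        rw [show (r ^ 3) ^ 2 = (r ^ 2) ^ 3 by ring, hr2]; ring
      have e' : (T ^ 2) ^ 2 = (α ^ 3 * L ^ 8) * α := by rw [hT]; ring
      rw [e, e']; gcongr
    rw [sq_le_sq, abs_of_nonneg (by positivity), abs_of_nonneg (by positivity)] at this
    exact this
  set P0 := 3 * r with hP0
  have hP00 : 0 < P0 := by positivity
  have hP03 : 27 * T ^ 2 ≤ P0 ^ 3 := by rw [hP0]; nlinarith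
  set h := 3 * α * q2 with hh
  have hh0 : 0 < h := by positivity
  let Pf : ℤ → ℝ := fun c => (b : ℝ) ^ 2 - 3 * a * c
  have hPf : ∀ c d : ℤ, (hA (a, b, c, d) : ℝ) = Pf c := by
    intro c d; simp only [hA, Pf]; push_cast; ring
  have hUU : ∀ x ∈ s, |4 * Pf x.1 ^ 3 - (Uu a b x.1 x.2 : ℝ) ^ 2| ≤ 27 * T ^ 2 := by
    intro x hx
    have e : 4 * Pf x.1 ^ 3 - (Uu a b x.1 x.2 : ℝ) ^ 2 = 27 * a ^ 2 * (disc (a, b, x.1, x.2) : ℝ) := by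
      have := syz a b x.1 x.2
      simp only [Pf, Uu]; exact_mod_cast this
    rw [e, abs_mul, abs_of_nonneg (by positivity), hα2, hT]
    have := (hs x hx).2.1
    calc 27 * α ^ 2 * |(disc (a, b, x.1, x.2) : ℝ)| ≤ 27 * α ^ 2 * L ^ 4 := by gcongr
      _ = _ := by ring
  have hPlow : ∀ x ∈ s, -P0 ≤ Pf x.1 := by
    intro x hx
    by_contra hn
    push Not at hn
    have h1 := (abs_le.1 (hUU x hx)).1
    have h2 : P0 ^ 3 < (-Pf x.1) ^ 3 := by gcongr; linarith
    nlinarith [sq_nonneg (Uu a b x.1 x.2 : ℝ)]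
  set C := s.image Prod.fst with hC'
  have hCmem : ∀ c ∈ C, ∃ d, (c, d) ∈ s := by
    intro c hc
    simpa [hC'] using hc
  have hcong : ∀ c ∈ C, ∀ c' ∈ C, (q2 : ℤ) ∣ c - c' := by
    intro c hc c' hc'
    obtain ⟨d, hd⟩ := hCmem c hc
    obtain ⟨d', hd'⟩ := hCmem c' hc'
    exact c_class a b c d c' d' q2 (hm.squarefree_of_dvd h2m) (fun h => hm3 (h.trans h2m))
      (hs _ hd).2.2.2.1 (hs _ hd).2.2.2.2 (hs _ hd').2.2.2.1 (hs _ hd').2.2.2.2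
  have hPdiff : ∀ c c' : ℤ, |Pf c - Pf c'| = 3 * α * |(c : ℝ) - c'| := by
    intro c c'
    rw [show Pf c - Pf c' = -(3 * a * ((c : ℝ) - c')) by simp only [Pf]; ring, abs_neg, abs_mul, abs_mul]
    simp [hα]
  have hcnt : ∀ (B : Finset ℤ) (R : ℝ), B ⊆ C → 0 ≤ R → (∀ c ∈ B, |Pf c| ≤ R) → (B.card : ℝ) ≤ 2 * R / h + 1 := by
    intro B R hB hR hBR
    have := cnt B q2 hq2 (2 * R / (3 * α)) (by positivity) ?_ (fun c hc c' hc' => hcong c (hB hc) c' (hB hc'))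
    · refine this.trans (le_of_eq ?_)
      rw [hh]; field_simp
    · intro c hc c' hc'
      rw [le_div_iff₀ (by positivity)]
      have h1 := hPdiff c c'
      have h2 : |Pf c - Pf c'| ≤ R + R := (abs_sub _ _).trans (add_le_add (hBR c hc) (hBR c' hc'))
      have h3 := le_abs_self ((c : ℝ) - c')
      nlinarith
  let ℓ : ℤ → ℝ := fun c => if Pf c ≤ P0 then 8 * T else 27 * T ^ 2 * (√(Pf c) ^ 3)⁻¹
  have hℓ0 : ∀ c, 0 ≤ ℓ c := by
    intro c; simp only [ℓ]; split_ifs <;> positivity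
  set G : ℝ := (Int.gcd a m : ℝ) with hG
  have hG0 : 0 ≤ G := by positivity
  set τ : ℝ := (m.divisors.card : ℝ) with hτ
  have hτ0 : 0 ≤ τ := by positivity
  have step1 := card_fib s C Prod.fst (fun c => 2 * τ * (ℓ c * G / (27 * a ^ 2 * m) + 1))
    (fun x hx => Finset.mem_image_of_mem _ hx) (by
      intro c hc
      have hinj : Set.InjOn (Prod.snd : ℤ × ℤ → ℤ) (s.filter (fun x => x.1 = c)) := by
        intro x hx y hy hxy
        simp only [Finset.coe_filter, Set.mem_setOf_eq] at hx hy
        exact Prod.ext (hx.2.trans hy.2.symm) hxy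
      rw [← Finset.card_image_of_injOn hinj]
      have hmem : ∀ d ∈ (s.filter (fun x => x.1 = c)).image Prod.snd, (c, d) ∈ s := by
        intro d hd
        simp only [Finset.mem_image, Finset.mem_filter] at hd
        obtain ⟨x, ⟨hx, rfl⟩, rfl⟩ := hd
        exact hx
      apply dcount a b c ha m hm hm3 (ℓ c) (hℓ0 c)
      · intro d hd; exact (hs _ (hmem d hd)).1
      · intro d hd d' hd' h0
        have k1 := hUU _ (hmem d hd)
        have k2 := hUU _ (hmem d' hd')
        simp only [ℓ]
        split_ifs with hP
        · exact Ulen _ T _ _ hT0.le k1 k2 h0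
        · push Not at hP
          refine Ulen2 _ T _ _ (hP00.trans hP) (hP03.trans ?_) k1 k2 h0
          gcongr)
  have hsum : ∑ c ∈ C, ℓ c ≤ 27 * T * (1 + 2 * P0 / h) := by
    rw [← Finset.sum_filter_add_sum_filter_not C (fun c => Pf c ≤ P0)]
    have e1 : ∑ c ∈ C.filter (fun c => Pf c ≤ P0), ℓ c ≤ (2 * P0 / h + 1) * (8 * T) := by
      have : ∑ c ∈ C.filter (fun c => Pf c ≤ P0), ℓ c = ∑ c ∈ C.filter (fun c => Pf c ≤ P0), 8 * T := by
        apply Finset.sum_congr rfl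
        intro c hc
        simp only [ℓ, if_pos (Finset.mem_filter.1 hc).2]
      rw [this, Finset.sum_const, nsmul_eq_mul]
      gcongr
      apply hcnt _ _ (Finset.filter_subset _ _) hP00.le
      intro c hc
      rw [Finset.mem_filter] at hc
      obtain ⟨d, hd⟩ := hCmem c hc.1
      exact abs_le.2 ⟨hPlow _ hd, hc.2⟩
    have e2 : ∑ c ∈ C.filter (fun c => ¬ Pf c ≤ P0), ℓ c ≤
        27 * T ^ 2 * ((√P0 ^ 3)⁻¹ + 2 / h * (√P0)⁻¹) := by
      have : ∑ c ∈ C.filter (fun c => ¬ Pf c ≤ P0), ℓ c =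
          27 * T ^ 2 * ∑ c ∈ C.filter (fun c => ¬ Pf c ≤ P0), (√(Pf c) ^ 3)⁻¹ := by
        rw [Finset.mul_sum]
        apply Finset.sum_congr rfl
        intro c hc
        simp only [ℓ, if_neg (Finset.mem_filter.1 hc).2]
      rw [this]
      gcongr
      apply decay _ _ _ _ hP00 hh0
      · intro c hc
        rw [Finset.mem_filter] at hc
        exact (not_le.1 hc.2).le
      · intro c hc c' hc' hne
        rw [Finset.mem_filter] at hc hc'
        rw [hPdiff, hh]
        gcongr
        obtain ⟨t, ht⟩ := hcong c hc.1 c' hc'.1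
        have ht0 : t ≠ 0 := by rintro rfl; apply hne; rw [mul_zero] at ht; linarith
        have : (c : ℝ) - c' = q2 * t := by exact_mod_cast ht
        rw [this, abs_mul, abs_of_pos hq2R]
        have : (1 : ℝ) ≤ |(t : ℝ)| := by exact_mod_cast Int.one_le_abs ht0
        nlinarith
    set y := √P0 with hy
    have hy0 : 0 < y := Real.sqrt_pos.2 hP00
    have hy2 : y ^ 2 = P0 := Real.sq_sqrt hP00.le
    have hy3 : 5 * T ≤ y ^ 3 := by
      refine le_trans (le_abs_self _) (abs_le_of_sq_le_sq ?_ (by positivity))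
      have : (y ^ 3) ^ 2 = P0 ^ 3 := by rw [← hy2]; ring
      rw [this]; nlinarith
    have e3 : 27 * T ^ 2 * ((y ^ 3)⁻¹ + 2 / h * y⁻¹) = 27 * T ^ 2 * (y ^ 3)⁻¹ * (1 + 2 * P0 / h) := by
      rw [← hy2]; field_simp
    have e4 : 27 * T ^ 2 * (y ^ 3)⁻¹ ≤ 6 * T := by
      rw [← div_eq_mul_inv, div_le_iff₀ (by positivity)]
      linarith [mul_le_mul_of_nonneg_left hy3 hT0.le, mul_pos hT0 hT0]
    have e5 : 0 ≤ 1 + 2 * P0 / h := by positivity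
    have e6 := mul_le_mul_of_nonneg_right e4 e5
    rw [e3] at e2
    have e7 : 0 ≤ T * (1 + 2 * P0 / h) := by positivity
    have e8 : (2 * P0 / h + 1) * (8 * T) = 8 * (T * (1 + 2 * P0 / h)) := by ring
    have e9 : 6 * T * (1 + 2 * P0 / h) = 6 * (T * (1 + 2 * P0 / h)) := by ring
    have e10 : 27 * T * (1 + 2 * P0 / h) = 27 * (T * (1 + 2 * P0 / h)) := by ring
    rw [e10]; linarith
  have hCc : (C.card : ℝ) ≤ 2 * (2 * L ^ 2) / h + 1 := by
    apply hcnt C _ (Finset.Subset.refl _) (by positivity)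
    intro c hc
    obtain ⟨d, hd⟩ := hCmem c hc
    have := (hs _ hd).2.2.1
    rwa [hPf] at this
  calc (s.card : ℝ) ≤ _ := step1
    _ = 2 * τ * (∑ c ∈ C, ℓ c * (G / (27 * a ^ 2 * m)) + C.card) := by
        rw [← Finset.mul_sum, Finset.sum_add_distrib, Finset.sum_const, nsmul_eq_mul, mul_one]
        simp only [mul_div_assoc]
    _ = 2 * τ * ((∑ c ∈ C, ℓ c) * (G / (27 * a ^ 2 * m)) + C.card) := by rw [Finset.sum_mul]
    _ ≤ 2 * τ * (27 * T * (1 + 2 * P0 / h) * (G / (27 * a ^ 2 * m)) + (2 * (2 * L ^ 2) / h + 1)) := by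
        have : (a : ℝ) ≠ 0 := by exact_mod_cast ha
        gcongr
    _ ≤ _ := by
        have e1 : 27 * T * (1 + 2 * P0 / h) * (G / (27 * a ^ 2 * m)) =
          G / m * (L ^ 2 / α) * (1 + 2 * r / (α * q2)) := by
          rw [hα2, hT, hP0, hh]; field_simp
        have e2 : 2 * (2 * L ^ 2) / h ≤ 2 * L ^ 2 / (α * q2) := by
          rw [hh, div_le_div_iff₀ (by positivity) (by positivity)]
          have : 0 ≤ L ^ 2 * (α * q2) := by positivity
          nlinarith
        rw [e1]
        have : G / m * (L ^ 2 / α) * (1 + 2 * r / (α * q2)) + (2 * (2 * L ^ 2) / h + 1) ≤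
          G / m * (L ^ 2 / α) * (1 + 2 * r / (α * q2)) + 2 * L ^ 2 / (α * q2) + 1 := by linarith
        exact mul_le_mul_of_nonneg_left this (by positivity)

end BCF

namespace BCF

lemma sum_inv_sqrt (N : ℕ) : ∑ k ∈ Finset.Icc 1 N, (√(k : ℝ))⁻¹ ≤ 2 * √(N : ℝ) := by
  induction N with
  | zero => simp
  | succ N ih =>
    rw [Finset.sum_Icc_succ_top (by omega)]
    set s := √(N : ℝ) with hs
    set t := √((N + 1 : ℕ) : ℝ) with ht
    have ht0 : 0 < t := Real.sqrt_pos.2 (by positivity)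
    have hs0 : 0 ≤ s := Real.sqrt_nonneg _
    have hs2 : s ^ 2 = N := Real.sq_sqrt (by positivity)
    have ht2 : t ^ 2 = (N : ℝ) + 1 := by rw [ht, Real.sq_sqrt (by positivity)]; push_cast; ring
    have : t⁻¹ ≤ 2 * (t - s) := by
      rw [inv_le_iff_one_le_mul₀ ht0]
      nlinarith [sq_nonneg (t - s)]
    linarith

lemma sum_inv_sq' (N : ℕ) : ∑ k ∈ Finset.Icc 1 (N + 1), ((k : ℝ) ^ 2)⁻¹ ≤ 2 - 1 / ((N : ℝ) + 1) := by
  induction N with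
  | zero => norm_num
  | succ N ih =>
    rw [Finset.sum_Icc_succ_top (by omega)]
    have : (((N + 1 + 1 : ℕ) : ℝ) ^ 2)⁻¹ ≤ 1 / ((N : ℝ) + 1) - 1 / (((N + 1 : ℕ) : ℝ) + 1) := by
      push_cast
      rw [div_sub_div _ _ (by positivity) (by positivity), inv_eq_one_div,
        div_le_div_iff₀ (by positivity) (by positivity)]
      have : (0 : ℝ) ≤ N := by positivity
      nlinarith
    linarith

lemma sum_inv_sq (N : ℕ) : ∑ k ∈ Finset.Icc 1 N, ((k : ℝ) ^ 2)⁻¹ ≤ 2 := by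
  rcases N with _ | N
  · simp
  · have := sum_inv_sq' N
    have : 0 ≤ 1 / ((N : ℝ) + 1) := by positivity
    linarith

lemma gcdsum (m : ℕ) (hm : 0 < m) (N : ℕ) :
    ∑ n ∈ Finset.Icc 1 N, (Nat.gcd n m : ℝ) * (√(n : ℝ))⁻¹ ≤ 2 * m.divisors.card * √(N : ℝ) := by
  calc ∑ n ∈ Finset.Icc 1 N, (Nat.gcd n m : ℝ) * (√(n : ℝ))⁻¹
      ≤ ∑ n ∈ Finset.Icc 1 N, ∑ e ∈ m.divisors, (if e ∣ n then (e : ℝ) * (√(n : ℝ))⁻¹ else 0) := by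
        apply Finset.sum_le_sum
        intro n hn
        have := Finset.single_le_sum (f := fun e : ℕ => if e ∣ n then (e : ℝ) * (√(n : ℝ))⁻¹ else 0)
          (s := m.divisors) (fun e _ => by positivity) (Nat.mem_divisors.2 ⟨Nat.gcd_dvd_right n m, hm.ne'⟩)
        simpa [Nat.gcd_dvd_left] using this
    _ = ∑ e ∈ m.divisors, ∑ n ∈ Finset.Icc 1 N, (if e ∣ n then (e : ℝ) * (√(n : ℝ))⁻¹ else 0) :=
        Finset.sum_comm
    _ ≤ ∑ e ∈ m.divisors, 2 * √(N : ℝ) := by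
        apply Finset.sum_le_sum
        intro e he
        have he0 : 0 < e := Nat.pos_of_mem_divisors he
        rw [← Finset.sum_filter]
        have himg : (Finset.Icc 1 N).filter (fun n => e ∣ n) = (Finset.Icc 1 (N / e)).image (fun k => e * k) := by
          ext n
          simp only [Finset.mem_filter, Finset.mem_Icc, Finset.mem_image]
          constructor
          · rintro ⟨⟨h1, h2⟩, k, rfl⟩
            refine ⟨k, ⟨Nat.pos_of_ne_zero (by rintro rfl; omega), ?_⟩, rfl⟩
            rw [Nat.le_div_iff_mul_le he0]; linarith [mul_comm e k]
          · rintro ⟨k, ⟨h1, h2⟩, rfl⟩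
            rw [Nat.le_div_iff_mul_le he0] at h2
            exact ⟨⟨Nat.mul_pos he0 h1, by linarith [mul_comm e k]⟩, dvd_mul_right _ _⟩
        rw [himg, Finset.sum_image (fun x _ y _ h => Nat.eq_of_mul_eq_mul_left he0 h)]
        have hse : 0 < √(e : ℝ) := Real.sqrt_pos.2 (by exact_mod_cast he0)
        have hse2 : √(e : ℝ) ^ 2 = e := Real.sq_sqrt (by positivity)
        have : ∀ k : ℕ, (e : ℝ) * (√((e * k : ℕ) : ℝ))⁻¹ = √(e : ℝ) * (√(k : ℝ))⁻¹ := by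
          intro k
          rw [Nat.cast_mul, Real.sqrt_mul (by positivity), mul_inv, ← mul_assoc]
          congr 1
          nth_rw 1 [← hse2]; field_simp
        simp only [this]
        rw [← Finset.mul_sum]
        calc √(e : ℝ) * ∑ k ∈ Finset.Icc 1 (N / e), (√(k : ℝ))⁻¹ ≤ √(e : ℝ) * (2 * √((N / e : ℕ) : ℝ)) := by
              gcongr; exact sum_inv_sqrt _
          _ = 2 * √((e : ℝ) * ((N / e : ℕ) : ℝ)) := by rw [Real.sqrt_mul (by positivity)]; ring
          _ ≤ 2 * √(N : ℝ) := by
              gcongr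
              exact_mod_cast Nat.mul_div_le N e
    _ = _ := by rw [Finset.sum_const, nsmul_eq_mul]; ring

set_option maxHeartbeats 1600000 in
lemma count_main (q2 m : ℕ) (hm : Squarefree m) (hm3 : ¬ 3 ∣ m) (h2m : q2 ∣ m)
    (L : ℝ) (hL : 0 < L) (s : Finset BCF)
    (hs : ∀ z ∈ s, (m : ℤ) ∣ disc z ∧ |(disc z : ℝ)| ≤ L ^ 4 ∧ (q2 : ℤ) ∣ hA z ∧ (q2 : ℤ) ∣ hC z ∧
      z.1 ≠ 0 ∧ |(z.1 : ℝ)| ≤ L ∧ |(hA z : ℝ)| ≤ 2 * L ^ 2 ∧ 2 * |z.2.1| ≤ 3 * |z.1|) :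
    (s.card : ℝ) ≤ 64 * (m.divisors.card : ℝ) ^ 2 * (L ^ 4 / (q2 * m) + L ^ 3 / q2 + L ^ 2) := by
  have hm0 : 0 < m := Nat.pos_of_ne_zero hm.ne_zero
  have hmR : (0 : ℝ) < m := by exact_mod_cast hm0
  have hq2 : 0 < q2 := Nat.pos_of_dvd_of_pos h2m hm0
  have hq2R : (0 : ℝ) < q2 := by exact_mod_cast hq2
  set τ : ℝ := (m.divisors.card : ℝ) with hτ
  have hτ1 : 1 ≤ τ := by
    have : 0 < m.divisors.card := Finset.card_pos.2 ⟨1, Nat.one_mem_divisors.2 hm0.ne'⟩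
    rw [hτ]; exact_mod_cast this
  set N := ⌊L⌋₊ with hN
  have hNL : (N : ℝ) ≤ L := Nat.floor_le hL.le
  let B : ℕ → ℝ := fun n => 2 * τ * ((Nat.gcd n m : ℝ) / m * (L ^ 2 / n) *
      (1 + 2 * √(L ^ 3 * n) / (n * q2)) + 2 * L ^ 2 / (n * q2) + 1)
  have hB0 : ∀ n, 0 ≤ B n := by intro n; simp only [B]; positivity
  have step := card_fib s (Finset.Icc 1 N) (fun z => z.1.natAbs) (fun n => 8 * n * B n) ?_ ?_
  · refine step.trans ?_
    have hterm : ∀ n ∈ Finset.Icc 1 N, 8 * n * B n ≤ 16 * τ * ((L ^ 2 * √L / m + 2 * L ^ 2 * √(L ^ 3) / (q2 * m)) *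
        ((Nat.gcd n m : ℝ) * (√(n : ℝ))⁻¹) + (2 * L ^ 2 / q2 + L)) := by
      intro n hn
      rw [Finset.mem_Icc] at hn
      have hn0 : (0 : ℝ) < n := by exact_mod_cast hn.1
      have hnL : (n : ℝ) ≤ L := le_trans (by exact_mod_cast hn.2) hNL
      set w := √(n : ℝ) with hw
      have hw0 : 0 < w := Real.sqrt_pos.2 hn0
      have hw2 : w ^ 2 = n := Real.sq_sqrt hn0.le
      have hwL : w ≤ √L := Real.sqrt_le_sqrt hnL
      have hr : √(L ^ 3 * n) = √(L ^ 3) * w := Real.sqrt_mul (by positivity) _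
      simp only [B]
      rw [hr]
      set G : ℝ := (Nat.gcd n m : ℝ)
      have hG : 0 ≤ G := by positivity
      set R := √(L ^ 3)
      have e : 8 * n * (2 * τ * (G / m * (L ^ 2 / n) * (1 + 2 * (R * w) / (n * q2)) + 2 * L ^ 2 / (n * q2) + 1))
        = 16 * τ * ((L ^ 2 * w / m + 2 * L ^ 2 * R / (q2 * m)) * (G * w⁻¹) + (2 * L ^ 2 / q2 + n)) := by
        rw [← hw2]
        field_simp
        ring
      rw [e]
      gcongr
    refine (Finset.sum_le_sum hterm).trans ?_
    rw [← Finset.mul_sum, Finset.sum_add_distrib, ← Finset.mul_sum, Finset.sum_const, nsmul_eq_mul,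
      Nat.card_Icc, Nat.add_sub_cancel]
    have hg := gcdsum m hm0 N
    have hsN : √(N : ℝ) ≤ √L := Real.sqrt_le_sqrt hNL
    have hR : √(L ^ 3) * √L = L ^ 2 := by
      rw [← Real.sqrt_mul (by positivity), show L ^ 3 * L = (L ^ 2) ^ 2 by ring, Real.sqrt_sq (by positivity)]
    have hLL : √L * √L = L := Real.mul_self_sqrt hL.le
    have hmq : (q2 : ℝ) ≤ m := by exact_mod_cast Nat.le_of_dvd hm0 h2m
    calc 16 * τ * ((L ^ 2 * √L / m + 2 * L ^ 2 * √(L ^ 3) / (q2 * m)) *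
        ∑ n ∈ Finset.Icc 1 N, ((Nat.gcd n m : ℝ) * (√(n : ℝ))⁻¹) + N * (2 * L ^ 2 / q2 + L))
        ≤ 16 * τ * ((L ^ 2 * √L / m + 2 * L ^ 2 * √(L ^ 3) / (q2 * m)) * (2 * τ * √L) + L * (2 * L ^ 2 / q2 + L)) := by
          have : ∑ n ∈ Finset.Icc 1 N, ((Nat.gcd n m : ℝ) * (√(n : ℝ))⁻¹) ≤ 2 * τ * √L :=
            hg.trans (by gcongr)
          gcongr
      _ = 16 * τ * (2 * τ * (L ^ 2 * (√L * √L) / m) + 4 * τ * (L ^ 2 * (√(L ^ 3) * √L) / (q2 * m)) + 2 * (L ^ 3 / q2) + L ^ 2) := by ring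
      _ = 16 * τ * (2 * τ * (L ^ 3 / m) + 4 * τ * (L ^ 4 / (q2 * m)) + 2 * (L ^ 3 / q2) + L ^ 2) := by
          rw [hR, hLL]; ring
      _ ≤ 16 * τ * (2 * τ * (L ^ 3 / q2) + 4 * τ * (L ^ 4 / (q2 * m)) + 2 * τ * (L ^ 3 / q2) + 4 * τ * L ^ 2) := by
          have h1 : L ^ 3 / m ≤ L ^ 3 / q2 := by gcongr
          have h2 : 2 * (L ^ 3 / q2) ≤ 2 * τ * (L ^ 3 / q2) := by
            have : 0 ≤ L ^ 3 / q2 := by positivity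
            nlinarith
          have h3 : L ^ 2 ≤ 4 * τ * L ^ 2 := by
            have : 0 ≤ L ^ 2 := by positivity
            nlinarith
          gcongr
      _ = _ := by ring
  · intro z hz
    obtain ⟨-, -, -, -, h1, h2, -, -⟩ := hs z hz
    rw [Finset.mem_Icc]
    refine ⟨Int.natAbs_pos.2 h1, Nat.le_floor ?_⟩
    rwa [Nat.cast_natAbs, Int.cast_abs]
  · intro n hn
    rw [Finset.mem_Icc] at hn
    set k : ℤ := (3 * n : ℤ) / 2 with hk
    have st := card_fib (s.filter (fun z => z.1.natAbs = n)) (({(n : ℤ), -(n : ℤ)} : Finset ℤ) ×ˢ Finset.Icc (-k) k)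
      (fun z => (z.1, z.2.1)) (fun _ => B n) ?_ ?_
    · refine st.trans ?_
      rw [Finset.sum_const, nsmul_eq_mul]
      have hB : 0 ≤ B n := by simp only [B]; positivity
      apply mul_le_mul_of_nonneg_right _ hB
      rw [Finset.card_product, Int.card_Icc]
      have h1 : ({(n : ℤ), -(n : ℤ)} : Finset ℤ).card ≤ 2 := Finset.card_le_two
      have h2 : (k + 1 - -k).toNat ≤ 4 * n := by omega
      have h3 := Nat.mul_le_mul h1 h2
      have : ((({(n : ℤ), -(n : ℤ)} : Finset ℤ).card * (k + 1 - -k).toNat : ℕ) : ℝ) ≤ ((2 * (4 * n) : ℕ) : ℝ) := by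
        exact_mod_cast h3
      refine this.trans (le_of_eq ?_)
      push_cast; ring
    · intro z hz
      rw [Finset.mem_filter] at hz
      obtain ⟨-, -, -, -, h1, h2, -, h4⟩ := hs z hz.1
      simp only [Finset.mem_product, Finset.mem_insert, Finset.mem_singleton, Finset.mem_Icc]
      rw [← abs_le]
      have h5 : |z.1| = n := by rw [Int.abs_eq_natAbs, hz.2]
      refine ⟨by omega, by omega⟩
    · rintro ⟨a, b⟩ hab
      simp only [Finset.mem_product, Finset.mem_insert, Finset.mem_singleton] at hab
      have han : a.natAbs = n := by omega
      have ha0 : a ≠ 0 := by omega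
      set F := (s.filter (fun z => z.1.natAbs = n)).filter (fun z => (z.1, z.2.1) = (a, b)) with hF
      have hinj : Set.InjOn (fun z : BCF => z.2.2) F := by
        rintro ⟨x1, x2, x3⟩ hx ⟨y1, y2, y3⟩ hy hxy
        simp only [hF, Finset.coe_filter, Finset.mem_filter, Set.mem_setOf_eq, Prod.mk.injEq] at hx hy hxy ⊢
        exact ⟨hx.2.1.trans hy.2.1.symm, hx.2.2.trans hy.2.2.symm, hxy⟩
      rw [← Finset.card_image_of_injOn hinj]
      have hmem : ∀ x ∈ F.image (fun z : BCF => z.2.2), ((a, b, x.1, x.2) : BCF) ∈ s := by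
        intro x hx
        rw [Finset.mem_image] at hx
        obtain ⟨⟨z1, z2, z3⟩, hz, rfl⟩ := hx
        simp only [hF, Finset.mem_filter, Prod.mk.injEq] at hz
        obtain ⟨⟨hz1, _⟩, rfl, rfl⟩ := hz
        exact hz1
      have haabs : |(a : ℝ)| = n := by rw [← han, Nat.cast_natAbs, Int.cast_abs]
      have hgcd : Int.gcd a m = Nat.gcd n m := by rw [Int.gcd, han, Int.natAbs_natCast]
      by_cases haL : |(a : ℝ)| ≤ L
      · have := cd_count a b ha0 q2 m hm hm3 h2m L hL haL (F.image (fun z : BCF => z.2.2)) (by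
          intro x hx
          obtain ⟨h1, h2, h3, h4, -, -, h5, -⟩ := hs _ (hmem x hx)
          exact ⟨h1, h2, h5, h3, h4⟩)
        rw [haabs, hgcd] at this
        exact this
      · have : F.image (fun z : BCF => z.2.2) = ∅ := by
          rw [Finset.eq_empty_iff_forall_notMem]
          intro x hx
          exact haL (hs _ (hmem x hx)).2.2.2.2.2.1
        rw [this]
        rw [Finset.card_empty, Nat.cast_zero]; exact hB0 n

end BCF

namespace BCF

lemma sqf_dvd_of_sq (n : ℕ) (hn : Squarefree n) (x : ℤ) (h : (n : ℤ) ∣ x ^ 2) : (n : ℤ) ∣ x := by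
  have := sqf_pow_dvd n hn 1 x ?_
  · simpa using this
  intro p hp hpn
  rw [pow_one]
  apply (Nat.prime_iff_prime_int.1 hp).dvd_of_dvd_pow (n := 2)
  exact Dvd.dvd.trans (by exact_mod_cast hpn) h

/-- the number of d for given b, c in the degenerate case -/
lemma d_deg (b c : ℤ) (hb : b ≠ 0) (q3 e e' : ℕ) (he : Int.gcd b q3 = e) (hq3 : q3 = e * e') (hsq : Squarefree q3)
    (h2 : ¬ 2 ∣ q3) (W : ℝ) (hW : 0 < W) (s : Finset ℤ)
    (hs : ∀ d ∈ s, (q3 : ℤ) ∣ disc (0, b, c, d) ∧ |(disc (0, b, c, d) : ℝ)| ≤ W ∧ disc (0, b, c, d) ≠ 0) :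
    (s.card : ℝ) ≤ W / (2 * |(b : ℝ)| ^ 3 * e') + 1 := by
  have he' : 0 < e' := Nat.pos_of_ne_zero (by rintro rfl; rw [hq3] at hsq; simp at hsq)
  have hdisc : ∀ d, disc (0, b, c, d) = b ^ 2 * (c ^ 2 - 4 * b * d) := by intro d; simp only [disc]; ring
  have hbR : 0 < |(b : ℝ)| := by positivity
  have := cnt s e' he' (W / (2 * |(b : ℝ)| ^ 3)) (by positivity) ?_ ?_
  · refine this.trans (le_of_eq ?_)
    rw [div_div]
  · intro d hd d' hd'
    have h1 := (hs d hd).2.1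
    have h1' := (hs d' hd').2.1
    rw [hdisc] at h1 h1'
    push_cast at h1 h1'
    have h3 : |(b : ℝ) ^ 2 * (c ^ 2 - 4 * b * d') - (b : ℝ) ^ 2 * (c ^ 2 - 4 * b * d)| ≤ W + W :=
      (abs_sub _ _).trans (add_le_add h1' h1)
    rw [show (b : ℝ) ^ 2 * (c ^ 2 - 4 * b * d') - (b : ℝ) ^ 2 * (c ^ 2 - 4 * b * d) = 4 * b ^ 3 * (d - d') by ring,
      abs_mul, abs_mul, abs_pow, abs_of_pos (by norm_num : (0:ℝ) < 4)] at h3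
    rw [le_div_iff₀ (by positivity)]
    have h4 := mul_le_mul_of_nonneg_right (le_abs_self ((d : ℝ) - d')) (by positivity : 0 ≤ |(b : ℝ)| ^ 3)
    linarith
  · intro d hd d' hd'
    have := sqf_pow_dvd e' (hsq.squarefree_of_dvd ⟨e, by rw [hq3]; ring⟩) 1 (d - d') ?_
    · simpa using this
    intro p hp hpe
    rw [pow_one]
    have hpz := Nat.prime_iff_prime_int.1 hp
    have hpq : p ∣ q3 := by rw [hq3]; exact hpe.mul_left _
    have hpqz : (p : ℤ) ∣ (q3 : ℤ) := by exact_mod_cast hpq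
    have hpb : ¬ (p : ℤ) ∣ b := by
      intro h
      have h1 : p ∣ e := by
        have : (p : ℤ) ∣ (e : ℤ) := by rw [← he]; exact Int.dvd_coe_gcd h hpqz
        exact_mod_cast this
      have h2 : p * p ∣ q3 := by rw [hq3]; exact mul_dvd_mul h1 hpe
      exact hp.one_lt.ne' (Nat.isUnit_iff.1 (hsq p h2))
    have h3 := dvd_sub (hpqz.trans (hs d' hd').1) (hpqz.trans (hs d hd).1)
    rw [hdisc, hdisc, show b ^ 2 * (c ^ 2 - 4 * b * d') - b ^ 2 * (c ^ 2 - 4 * b * d) = 4 * (b ^ 3 * (d - d')) by ring] at h3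
    rcases hpz.dvd_or_dvd h3 with h | h
    · exfalso
      have h4 : p ∣ 4 := by exact_mod_cast h
      have : p ∣ 2 := hp.dvd_of_dvd_pow (n := 2) (by norm_num; exact h4)
      exact h2 (((Nat.prime_dvd_prime_iff_eq hp Nat.prime_two).1 this) ▸ hpq)
    · exact (hpz.dvd_or_dvd h).resolve_left (fun h => hpb (hpz.dvd_of_dvd_pow h))

/-- lower bound for the discriminant -/
lemma deg_lower (b c d : ℤ) (q3 e e' : ℕ) (he : Int.gcd b q3 = e) (hq3 : q3 = e * e') (hsq : Squarefree q3)
    (W : ℝ) (h1 : (q3 : ℤ) ∣ disc (0, b, c, d)) (h2 : |(disc (0, b, c, d) : ℝ)| ≤ W) (h3 : disc (0, b, c, d) ≠ 0) :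
    (b : ℝ) ^ 2 * e' ≤ W := by
  have hdisc : disc (0, b, c, d) = b ^ 2 * (c ^ 2 - 4 * b * d) := by simp only [disc]; ring
  rw [hdisc] at h1 h2 h3
  have hD0 : c ^ 2 - 4 * b * d ≠ 0 := by rintro h; rw [h] at h3; simp at h3
  have hdv : (e' : ℤ) ∣ c ^ 2 - 4 * b * d := by
    have := sqf_pow_dvd e' (hsq.squarefree_of_dvd ⟨e, by rw [hq3]; ring⟩) 1 (c ^ 2 - 4 * b * d) ?_
    · simpa using this
    intro p hp hpe
    rw [pow_one]
    have hpz := Nat.prime_iff_prime_int.1 hp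
    have hpq : p ∣ q3 := by rw [hq3]; exact hpe.mul_left _
    have hpqz : (p : ℤ) ∣ (q3 : ℤ) := by exact_mod_cast hpq
    have hpb : ¬ (p : ℤ) ∣ b := by
      intro h
      have h1 : p ∣ e := by
        have : (p : ℤ) ∣ (e : ℤ) := by rw [← he]; exact Int.dvd_coe_gcd h hpqz
        exact_mod_cast this
      have h2 : p * p ∣ q3 := by rw [hq3]; exact mul_dvd_mul h1 hpe
      exact hp.one_lt.ne' (Nat.isUnit_iff.1 (hsq p h2))
    exact (hpz.dvd_or_dvd (hpqz.trans h1)).resolve_left (fun h => hpb (hpz.dvd_of_dvd_pow h))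
  have h4 : (e' : ℤ) ≤ |c ^ 2 - 4 * b * d| := by
    apply Int.le_of_dvd (abs_pos.2 hD0) ((dvd_abs _ _).2 hdv)
  have h4R : (e' : ℝ) ≤ |((c ^ 2 - 4 * b * d : ℤ) : ℝ)| := by
    rw [← Int.cast_abs]; exact_mod_cast h4
  refine le_trans ?_ h2
  rw [Int.cast_mul, abs_mul]
  have e1 : |((b ^ 2 : ℤ) : ℝ)| = (b : ℝ) ^ 2 := by push_cast; exact abs_of_nonneg (sq_nonneg _)
  rw [e1]
  gcongr

set_option maxHeartbeats 1600000 in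
lemma count_deg (q2 q3 : ℕ) (hsq : Squarefree (q2 * q3)) (h2 : ¬ 2 ∣ q3) (W : ℝ) (hW : 0 < W) (s : Finset BCF)
    (hs : ∀ z ∈ s, (q3 : ℤ) ∣ disc z ∧ |(disc z : ℝ)| ≤ W ∧ disc z ≠ 0 ∧ (q2 : ℤ) ∣ hA z ∧ (q2 : ℤ) ∣ hC z ∧
      z.1 = 0 ∧ z.2.1 ≠ 0 ∧ |z.2.2.1| ≤ |z.2.1|) :
    (s.card : ℝ) ≤ 12 * (q3.divisors.card : ℝ) * (W / (q2 ^ 2 * q3)) := by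
  have hq2sq : Squarefree q2 := hsq.squarefree_of_dvd ⟨q3, rfl⟩
  have hq3sq : Squarefree q3 := hsq.squarefree_of_dvd ⟨q2, by ring⟩
  have hcop : Nat.Coprime q2 q3 := Nat.coprime_of_squarefree_mul hsq
  have hq2 : 0 < q2 := Nat.pos_of_ne_zero hq2sq.ne_zero
  have hq3 : 0 < q3 := Nat.pos_of_ne_zero hq3sq.ne_zero
  have hq2R : (0 : ℝ) < q2 := by exact_mod_cast hq2
  have hq3R : (0 : ℝ) < q3 := by exact_mod_cast hq3
  have hbc : ∀ z ∈ s, (q2 : ℤ) ∣ z.2.1 ∧ (q2 : ℤ) ∣ z.2.2.1 := by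
    intro z hz
    obtain ⟨-, -, -, h4, h5, h6, -, -⟩ := hs z hz
    obtain ⟨a, b, c, d⟩ := z
    simp only [hA, hC] at h4 h5 h6 ⊢
    subst h6
    have hb : (q2 : ℤ) ∣ b := sqf_dvd_of_sq q2 hq2sq b (by simpa using h4)
    refine ⟨hb, sqf_dvd_of_sq q2 hq2sq c ?_⟩
    have e : c ^ 2 = (c ^ 2 - 3 * b * d) + b * (3 * d) := by ring
    rw [e]; exact dvd_add h5 (hb.mul_right _)
  have step := card_fib s q3.divisors (fun z => Int.gcd z.2.1 q3) (fun _ => 12 * (W / (q2 ^ 2 * q3))) ?_ ?_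
  · rw [Finset.sum_const, nsmul_eq_mul] at step
    linarith
  · intro z _
    rw [Nat.mem_divisors]
    refine ⟨?_, hq3.ne'⟩
    have := Int.gcd_dvd_right (a := z.2.1) (b := (q3 : ℤ)); exact_mod_cast this
  intro e he
  obtain ⟨e', hee⟩ := Nat.dvd_of_mem_divisors he
  have he0 : 0 < e := Nat.pos_of_mem_divisors he
  have he'0 : 0 < e' := Nat.pos_of_ne_zero (by rintro rfl; omega)
  have heR : (0 : ℝ) < e := by exact_mod_cast he0
  have he'R : (0 : ℝ) < e' := by exact_mod_cast he'0
  have hq3e : (q3 : ℝ) = e * e' := by rw [hee]; push_cast; ring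
  set Y := √(W / e') / (q2 * e) with hY
  have hY0 : 0 ≤ Y := by positivity
  set F := s.filter (fun z => Int.gcd z.2.1 q3 = e) with hF
  -- structure of b
  have hbk : ∀ z ∈ F, ∃ k : ℕ, z.2.1.natAbs = q2 * e * k ∧ 1 ≤ k ∧ (k : ℝ) ≤ Y := by
    intro z hz
    rw [hF, Finset.mem_filter] at hz
    obtain ⟨hz, hge⟩ := hz
    obtain ⟨g1, g2, g3, -, -, g6, g7, -⟩ := hs z hz
    have hb2 := (hbc z hz).1
    have hbe : (e : ℤ) ∣ z.2.1 := by rw [← hge]; exact Int.gcd_dvd_left ..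
    have hcop' : Nat.Coprime q2 e := Nat.Coprime.coprime_dvd_right ⟨e', hee⟩ hcop
    have hd : q2 * e ∣ z.2.1.natAbs := by
      apply Nat.Coprime.mul_dvd_of_dvd_of_dvd hcop'
      · exact Int.natCast_dvd.1 hb2
      · exact Int.natCast_dvd.1 hbe
    obtain ⟨k, hk⟩ := hd
    refine ⟨k, hk, ?_, ?_⟩
    · rcases Nat.eq_zero_or_pos k with h | h
      · rw [h] at hk; simp at hk; exact absurd hk g7
      · exact h
    · obtain ⟨a, b, c, d⟩ := z
      simp only at g6 hk hge
      subst g6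
      have hlow := deg_lower b c d q3 e e' hge hee hq3sq W g1 g2 g3
      have hbR : |(b : ℝ)| = q2 * e * k := by
        have : ((b.natAbs : ℕ) : ℝ) = |(b : ℝ)| := by rw [Nat.cast_natAbs, Int.cast_abs]
        rw [← this, hk]; push_cast; ring
      rw [hY, le_div_iff₀ (by positivity)]
      apply Real.le_sqrt_of_sq_le
      rw [le_div_iff₀ he'R]
      have : ((k : ℝ) * (q2 * e)) ^ 2 = (b : ℝ) ^ 2 := by rw [← sq_abs (b : ℝ), hbR]; ring
      rw [this]; exact hlow
  have step2 := card_fib F (Finset.Icc 1 ⌊Y⌋₊) (fun z => z.2.1.natAbs / (q2 * e))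
    (fun k => 3 * (W / (q2 ^ 2 * q3)) * ((k : ℝ) ^ 2)⁻¹ + 6 * e * Y) ?_ ?_
  · refine step2.trans ?_
    rw [Finset.sum_add_distrib, ← Finset.mul_sum, Finset.sum_const, nsmul_eq_mul, Nat.card_Icc, Nat.add_sub_cancel]
    have h1 := sum_inv_sq ⌊Y⌋₊
    have h2 : ((⌊Y⌋₊ : ℕ) : ℝ) ≤ Y := Nat.floor_le hY0
    have h3 : Y * (6 * e * Y) = 6 * (W / (q2 ^ 2 * q3)) := by
      have : Y ^ 2 = W / e' / (q2 * e) ^ 2 := by rw [hY, div_pow, Real.sq_sqrt (by positivity)]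
      rw [show Y * (6 * e * Y) = 6 * e * Y ^ 2 by ring, this, hq3e]
      field_simp
    have h4 : (⌊Y⌋₊ : ℝ) * (6 * e * Y) ≤ Y * (6 * e * Y) := by gcongr
    have h5 : 3 * (W / (q2 ^ 2 * q3)) * ∑ k ∈ Finset.Icc 1 ⌊Y⌋₊, ((k : ℝ) ^ 2)⁻¹ ≤ 3 * (W / (q2 ^ 2 * q3)) * 2 := by
      gcongr
    rw [h3] at h4
    linarith
  · intro z hz
    obtain ⟨k, hk, hk1, hkY⟩ := hbk z hz
    have : z.2.1.natAbs / (q2 * e) = k := by rw [hk]; exact Nat.mul_div_cancel_left _ (by positivity)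
    simp only [this]
    exact Finset.mem_Icc.2 ⟨hk1, Nat.le_floor hkY⟩
  intro k hk
  rw [Finset.mem_Icc] at hk
  have hkR : (1 : ℝ) ≤ k := by exact_mod_cast hk.1
  have hkY : (k : ℝ) ≤ Y := le_trans (by exact_mod_cast hk.2) (Nat.floor_le hY0)
  set β : ℕ := q2 * e * k with hβ
  have hβR : (β : ℝ) = q2 * e * k := by rw [hβ]; push_cast; ring
  set E := F.filter (fun z => z.2.1.natAbs / (q2 * e) = k) with hE
  have hEb : ∀ z ∈ E, z.2.1.natAbs = β := by
    intro z hz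
    rw [hE, Finset.mem_filter] at hz
    obtain ⟨k', hk', -, -⟩ := hbk z hz.1
    have : z.2.1.natAbs / (q2 * e) = k' := by rw [hk']; exact Nat.mul_div_cancel_left _ (by positivity)
    rw [hk', hβ]
    rw [← hz.2, this]
  have hβ0 : 0 < β := by rw [hβ]; have := hk.1; positivity
  have step3 := card_fib E (({(β : ℤ), -(β : ℤ)} : Finset ℤ) ×ˢ Finset.Icc (-((e * k : ℕ) : ℤ)) ((e * k : ℕ) : ℤ))
      (fun z => (z.2.1, z.2.2.1 / q2)) (fun _ => W / (2 * (β : ℝ) ^ 3 * e') + 1) ?_ ?_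
  · refine step3.trans ?_
    rw [Finset.sum_const, nsmul_eq_mul, Finset.card_product, Int.card_Icc]
    have h1 : ({(β : ℤ), -(β : ℤ)} : Finset ℤ).card ≤ 2 := Finset.card_le_two
    have hek : 1 ≤ e * k := Nat.mul_pos he0 hk.1
    have h2 : (((e * k : ℕ) : ℤ) + 1 - -((e * k : ℕ) : ℤ)).toNat ≤ 3 * (e * k) := by omega
    have h3 := Nat.mul_le_mul h1 h2
    have h4 : ((({(β : ℤ), -(β : ℤ)} : Finset ℤ).card * (((e * k : ℕ) : ℤ) + 1 - -((e * k : ℕ) : ℤ)).toNat : ℕ) : ℝ)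
        ≤ ((2 * (3 * (e * k)) : ℕ) : ℝ) := by exact_mod_cast h3
    have h5 : 0 ≤ W / (2 * (β : ℝ) ^ 3 * e') + 1 := by positivity
    refine (mul_le_mul_of_nonneg_right h4 h5).trans ?_
    have hk0 : (0 : ℝ) < k := by linarith
    have h6 : ((2 * (3 * (e * k)) : ℕ) : ℝ) * (W / (2 * (β : ℝ) ^ 3 * e') + 1) =
        3 * (W / (q2 ^ 2 * q3)) * ((k : ℝ) ^ 2)⁻¹ * (1 / (q2 * e)) + 6 * e * k := by
      rw [hβR, hq3e]; push_cast; field_simp; ring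
    rw [h6]
    have h7 : 1 / ((q2 : ℝ) * e) ≤ 1 := by
      rw [div_le_one (by positivity)]
      have : 1 ≤ q2 * e := Nat.mul_pos hq2 he0
      exact_mod_cast this
    have h8 : 3 * (W / (q2 ^ 2 * q3)) * ((k : ℝ) ^ 2)⁻¹ * (1 / (q2 * e)) ≤ 3 * (W / (q2 ^ 2 * q3)) * ((k : ℝ) ^ 2)⁻¹ * 1 := by
      gcongr
    have h9 : 6 * (e : ℝ) * k ≤ 6 * e * Y := by gcongr
    linarith
  · intro z hz
    have hzb := hEb z hz
    have hzs : z ∈ s := (Finset.mem_filter.1 (Finset.mem_filter.1 hz).1).1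
    obtain ⟨-, -, -, -, -, -, -, g8⟩ := hs z hzs
    obtain ⟨c', hc'⟩ := (hbc z hzs).2
    have hcd : z.2.2.1 / q2 = c' := by rw [hc']; exact Int.mul_ediv_cancel_left _ (by omega)
    simp only [Finset.mem_product, Finset.mem_insert, Finset.mem_singleton, Finset.mem_Icc, hcd]
    rw [← abs_le]
    refine ⟨by omega, ?_⟩
    have h5 : |z.2.1| = β := by rw [Int.abs_eq_natAbs, hzb]
    rw [h5, hc', abs_mul, abs_of_nonneg (by omega : (0:ℤ) ≤ q2), hβ] at g8
    have hq2z : (0 : ℤ) < q2 := by omega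
    push_cast at g8 ⊢
    rw [mul_assoc] at g8
    exact le_of_mul_le_mul_left g8 hq2z
  · rintro ⟨b, c'⟩ hbc'
    simp only [Finset.mem_product, Finset.mem_insert, Finset.mem_singleton] at hbc'
    have hb : b.natAbs = β := by omega
    have hb0 : b ≠ 0 := by omega
    have hbR : |(b : ℝ)| = β := by
      have : ((b.natAbs : ℕ) : ℝ) = |(b : ℝ)| := by rw [Nat.cast_natAbs, Int.cast_abs]
      rw [← this, hb]
    set H := E.filter (fun z => (z.2.1, z.2.2.1 / (q2 : ℤ)) = (b, c')) with hH
    have hHm : ∀ z ∈ H, z ∈ s ∧ z.1 = 0 ∧ z.2.1 = b ∧ z.2.2.1 = q2 * c' ∧ Int.gcd b q3 = e := by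
      intro z hz
      rw [hH, Finset.mem_filter, Prod.mk.injEq] at hz
      have hzF := Finset.mem_filter.1 (Finset.mem_filter.1 hz.1).1
      have hzs : z ∈ s := hzF.1
      obtain ⟨-, -, -, -, -, g6, -, -⟩ := hs z hzs
      refine ⟨hzs, g6, hz.2.1, ?_, ?_⟩
      · rw [← hz.2.2]; exact (Int.mul_ediv_cancel' (hbc z hzs).2).symm
      · rw [← hz.2.1]; exact hzF.2
    have hinj : Set.InjOn (fun z : BCF => z.2.2.2) H := by
      intro x hx y hy hxy
      have h1 := hHm x hx
      have h2 := hHm y hy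
      obtain ⟨x1, x2, x3, x4⟩ := x
      obtain ⟨y1, y2, y3, y4⟩ := y
      simp only at h1 h2 hxy
      simp only [Prod.mk.injEq]
      exact ⟨h1.2.1.trans h2.2.1.symm, h1.2.2.1.trans h2.2.2.1.symm, h1.2.2.2.1.trans h2.2.2.2.1.symm, hxy⟩
    by_cases hge : Int.gcd b q3 = e
    · rw [← Finset.card_image_of_injOn hinj, ← hbR]
      apply d_deg b (q2 * c') hb0 q3 e e' hge hee hq3sq h2 W hW
      intro d hd
      rw [Finset.mem_image] at hd
      obtain ⟨z, hz, rfl⟩ := hd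
      obtain ⟨g1, g2, g3, g4, -⟩ := hHm z hz
      obtain ⟨k1, k2, k3, -⟩ := hs z g1
      have : z = (0, b, q2 * c', z.2.2.2) := by
        obtain ⟨x1, x2, x3, x4⟩ := z
        simp only at g2 g3 g4 ⊢
        rw [g2, g3, g4]
      rw [this] at k1 k2 k3
      exact ⟨k1, k2, k3⟩
    · have : H = ∅ := by
        rw [Finset.eq_empty_iff_forall_notMem]
        intro z hz
        exact hge (hHm z hz).2.2.2.2
      rw [this, Finset.card_empty, Nat.cast_zero]; positivity

end BCF

namespace BCF

lemma count_comb (q2 q3 : ℕ) (hsq : Squarefree (q2 * q3)) (h2 : ¬ 2 ∣ q2 * q3) (h3 : ¬ 3 ∣ q2 * q3) (L : ℝ)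
    (hL : 0 < L) (T : Finset BCF) (hT : ∀ z ∈ T, redd L z ∧ ((q2 * q3 : ℕ) : ℤ) ∣ disc z ∧ disc z ≠ 0 ∧
      |(disc z : ℝ)| ≤ L ^ 4 ∧ (q2 : ℤ) ∣ hA z ∧ (q2 : ℤ) ∣ hC z) :
    (T.card : ℝ) ≤ 76 * ((q2 * q3).divisors.card : ℝ) ^ 2 * (L ^ 4 / (q2 ^ 2 * q3) + L ^ 3 / q2 + L ^ 2) := by
  have hm0 : q2 * q3 ≠ 0 := hsq.ne_zero
  have e := Finset.card_filter_add_card_filter_not (s := T) (fun z : BCF => z.1 = 0)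
  have c1 := count_main q2 (q2 * q3) hsq h3 ⟨q3, rfl⟩ L hL (T.filter fun z => ¬ z.1 = 0) (by
    intro z hz
    rw [Finset.mem_filter] at hz
    obtain ⟨hz, h0⟩ := hz
    obtain ⟨hr, hd, hd0, hdl, hA', hC'⟩ := hT z hz
    rcases hr with hr | hr
    · exact absurd hr.1 h0
    · exact ⟨hd, hdl, hA', hC', hr⟩)
  have c2 := count_deg q2 q3 hsq (fun h => h2 (h.mul_left _)) (L ^ 4) (by positivity) (T.filter fun z => z.1 = 0) (by
    intro z hz
    rw [Finset.mem_filter] at hz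
    obtain ⟨hz, h0⟩ := hz
    obtain ⟨hr, hd, hd0, hdl, hA', hC'⟩ := hT z hz
    rcases hr with hr | hr
    · refine ⟨dvd_trans ?_ hd, hdl, hd0, hA', hC', hr⟩
      exact_mod_cast Dvd.intro_left q2 rfl
    · exact absurd h0 hr.1)
  have hτ : (q3.divisors.card : ℝ) ≤ ((q2 * q3).divisors.card : ℝ) ^ 2 := by
    have h1 : (q3.divisors.card : ℝ) ≤ ((q2 * q3).divisors.card : ℝ) := by
      exact_mod_cast Finset.card_le_card (Nat.divisors_subset_of_dvd hm0 (Dvd.intro_left q2 rfl))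
    have h2 : (1:ℝ) ≤ ((q2 * q3).divisors.card : ℝ) := by
      exact_mod_cast Finset.card_pos.2 ⟨1, Nat.one_mem_divisors.2 hm0⟩
    nlinarith
  have e' : (T.card : ℝ) = ((T.filter fun z => z.1 = 0).card : ℝ) + ((T.filter fun z => ¬ z.1 = 0).card : ℝ) := by
    exact_mod_cast e.symm
  have hq : L ^ 4 / ((q2 : ℝ) * ((q2 * q3 : ℕ) : ℝ)) = L ^ 4 / (q2 ^ 2 * q3) := by push_cast; congr 1; ring
  rw [hq] at c1
  have p1 : 0 ≤ L ^ 4 / ((q2 : ℝ) ^ 2 * q3) := by positivity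
  have p2 : 0 ≤ L ^ 3 / (q2 : ℝ) := by positivity
  have p3 : 0 ≤ L ^ 2 := by positivity
  have c3 : 12 * (q3.divisors.card : ℝ) * (L ^ 4 / ((q2 : ℝ) ^ 2 * q3)) ≤
      12 * ((q2 * q3).divisors.card : ℝ) ^ 2 * (L ^ 4 / (q2 ^ 2 * q3) + L ^ 3 / q2 + L ^ 2) := by
    apply mul_le_mul <;> first | positivity | linarith
  rw [e']; linarith

lemma gf_div (q2 q3 : ℤ) (a b c d : ℤ) : q2 ^ 2 * q3 ∣ disc (gf q2 q3 a b c d) ∧ q2 ∣ hA (gf q2 q3 a b c d) ∧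
    q2 ∣ hB (gf q2 q3 a b c d) ∧ q2 ∣ hC (gf q2 q3 a b c d) := by
  refine ⟨⟨q2 ^ 2 * q3 * b ^ 2 * c ^ 2 - 4 * a * q2 * q3 ^ 2 * c ^ 3 - 4 * q2 ^ 2 * b ^ 3 * d - 27 * a ^ 2 * q3 * d ^ 2
      + 18 * a * b * c * d * q2 * q3, ?_⟩, ⟨q2 * b ^ 2 - 3 * a * q3 * c, ?_⟩, ⟨b * q2 * q3 * c - 9 * a * q3 * d, ?_⟩,
      ⟨q2 * q3 ^ 2 * c ^ 2 - 3 * b * q2 * q3 * d, ?_⟩⟩ <;> simp only [disc, gf, hA, hB, hC] <;> ring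

lemma count_tuple (q2 q3 q4 : ℕ) (hsq : Squarefree (q2 * q3 * q4)) (hc2 : ¬ 2 ∣ q2 * q3) (hc3 : ¬ 3 ∣ q2 * q3)
    (L : ℝ) (hL : 0 < L) (S : Finset BCF)
    (hS : ∀ f ∈ S, disc f ≠ 0 ∧ |(disc f : ℝ)| < ((q2 : ℝ) * q3 * q4) ^ 2 * (q4 : ℝ) ^ 4 * L ^ 4 ∧
    (∀ p : ℕ, p.Prime → p ∣ q4 → ∃ γ : Matrix (Fin 2) (Fin 2) ℤ, γ.det = 1 ∧ Fs p (act γ f)) ∧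
    (∀ p : ℕ, p.Prime → p ∣ q2 → (∃ γ : Matrix (Fin 2) (Fin 2) ℤ, γ.det = 1 ∧ Ls p (act γ f)) ∧
      ¬ ∃ γ : Matrix (Fin 2) (Fin 2) ℤ, γ.det = 1 ∧ Fs p (act γ f)) ∧
    (∀ p : ℕ, p.Prime → p ∣ q3 → (∃ γ : Matrix (Fin 2) (Fin 2) ℤ, γ.det = 1 ∧ LTs p (act γ f)) ∧
      ¬ ∃ γ : Matrix (Fin 2) (Fin 2) ℤ, γ.det = 1 ∧ Ls p (act γ f)))
    (hne : ∀ x ∈ S, ∀ y ∈ S, x ≠ y → ¬ SLeq x y) :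
    (S.card : ℝ) ≤ 76 * ((q2 * q3).divisors.card : ℝ) ^ 2 * (L ^ 4 / (q2 ^ 2 * q3) + L ^ 3 / q2 + L ^ 2) * q4 ^ 2 ∧
    (S.Nonempty → (q2 : ℝ) ^ 2 ≤ L ^ 4) := by
  have hm0 : q2 * q3 * q4 ≠ 0 := hsq.ne_zero
  have h4 : q4 ≠ 0 := by rintro rfl; simp at hm0
  have h2 : q2 ≠ 0 := by rintro rfl; simp at hm0
  have h3 : q3 ≠ 0 := by rintro rfl; simp at hm0
  have : NeZero q4 := ⟨h4⟩
  have ex : ∀ f : BCF, ∃ (v : BCF) (M : Matrix (Fin 2) (Fin 2) ℤ), f ∈ S →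
      SLeq f (nf q2 q3 q4 v.1 v.2.1 v.2.2.1 v.2.2.2) ∧ nondeg q2 q3 v.1 v.2.1 ∧ M.det = 1 ∧
      redd L (act M (gf q2 q3 v.1 v.2.1 v.2.2.1 v.2.2.2)) ∧ disc (gf q2 q3 v.1 v.2.1 v.2.2.1 v.2.2.2) ≠ 0 ∧
      |(disc (gf q2 q3 v.1 v.2.1 v.2.2.1 v.2.2.2) : ℝ)| < L ^ 4 := by
    intro f
    by_cases hf : f ∈ S
    · obtain ⟨hd, hdl, H4, H2, H3⟩ := hS f hf
      obtain ⟨a, b, c, d, hs, hn⟩ := trans_exists q2 q3 q4 hsq f H4 H2 H3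
      have hdd : disc f = ((q2 : ℤ) * q3 * q4) ^ 2 * (q4 : ℤ) ^ 4 * disc (gf q2 q3 a b c d) := by
        rw [← disc_nf]
        obtain ⟨γ, hγ, hg⟩ := hs
        rw [← hg, disc_act γ hγ]
      have hg0 : disc (gf q2 q3 a b c d) ≠ 0 := by
        intro h; rw [h, mul_zero] at hdd; exact hd hdd
      have hgl : |(disc (gf q2 q3 a b c d) : ℝ)| < L ^ 4 := by
        have hpos : (0:ℝ) < ((q2 : ℝ) * q3 * q4) ^ 2 * (q4 : ℝ) ^ 4 := by positivity
        rw [hdd] at hdl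
        push_cast at hdl
        rw [abs_mul, abs_of_pos hpos] at hdl
        exact lt_of_mul_lt_mul_left hdl hpos.le
      obtain ⟨M, hM, hr⟩ := reduce _ hg0 L hL hgl
      exact ⟨(a, b, c, d), M, fun _ => ⟨hs, hn, hM, hr, hg0, hgl⟩⟩
    · exact ⟨f, 1, fun h => absurd h hf⟩
  choose v M hv using ex
  set g : BCF → BCF := fun f => gf q2 q3 (v f).1 (v f).2.1 (v f).2.2.1 (v f).2.2.2 with hg
  set T := S.image (fun f => act (M f) (g f)) with hT
  have hTc := count_comb q2 q3 (hsq.squarefree_of_dvd ⟨q4, rfl⟩) hc2 hc3 L hL T (by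
    intro z hz
    obtain ⟨f, hf, rfl⟩ := Finset.mem_image.1 hz
    obtain ⟨hs, hn, hM, hr, hg0, hgl⟩ := hv f hf
    obtain ⟨d1, dA, dB, dC⟩ := gf_div q2 q3 (v f).1 (v f).2.1 (v f).2.2.1 (v f).2.2.2
    rw [disc_act _ hM, hA_act _ hM, hC_act _ hM]
    refine ⟨hr, dvd_trans ⟨q2, by push_cast; ring⟩ d1, hg0, hgl.le, ?_, ?_⟩
    · exact dvd_add (dvd_add (dA.mul_right _) ((dB.mul_right _).mul_right _)) (dC.mul_right _)
    · exact dvd_add (dvd_add (dA.mul_right _) ((dB.mul_right _).mul_right _)) (dC.mul_right _))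
  constructor
  · have hinj : S.card ≤ (T ×ˢ ((Finset.univ : Finset (ZMod q4)) ×ˢ (Finset.univ : Finset (ZMod q4)))).card := by
      apply Finset.card_le_card_of_injOn
        (fun f => (act (M f) (g f), (((M f) 0 0 : ℤ) : ZMod q4), (((M f) 1 0 : ℤ) : ZMod q4)))
      · intro f hf
        simp only [Finset.coe_product, Set.mem_prod, Finset.mem_coe, Finset.mem_univ, and_true]
        exact Finset.mem_image_of_mem _ hf
      · intro x hx y hy hxy
        simp only [Prod.mk.injEq] at hxy
        obtain ⟨e1, e2, e3⟩ := hxy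
        obtain ⟨sx, nx, Mx, -⟩ := hv x hx
        obtain ⟨sy, ny, My, -⟩ := hv y hy
        by_contra hne'
        apply hne x hx y hy hne'
        refine SLeq_trans sx (SLeq_trans ?_ (SLeq_symm sy))
        apply trans_inj q2 q3 q4 hsq _ _ _ _ _ _ _ _ nx ((M y).adjugate * M x)
        · rw [Matrix.det_mul, det_adj _ My, Mx, one_mul]
        · rw [act_mul]
          change act _ (act (M x) (g x)) = g y
          rw [e1, act_adj _ My]
        · rw [← ZMod.intCast_zmod_eq_zero_iff_dvd _ q4]
          rw [Matrix.adjugate_fin_two, Matrix.mul_apply, Fin.sum_univ_two]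
          simp only [Matrix.of_apply, Matrix.cons_val_zero, Matrix.cons_val_one, Matrix.cons_val', Matrix.cons_val_fin_one]
          push_cast
          rw [e2, e3]; ring
    rw [Finset.card_product, Finset.card_product, Finset.card_univ, ZMod.card] at hinj
    have hinj' : (S.card : ℝ) ≤ T.card * (q4 * q4) := by exact_mod_cast hinj
    calc (S.card : ℝ) ≤ T.card * (q4 * q4) := hinj'
      _ ≤ _ * (q4 * q4) := mul_le_mul_of_nonneg_right hTc (by positivity)
      _ = _ := by ring
  · rintro ⟨f, hf⟩
    obtain ⟨hs, hn, hM, hr, hg0, hgl⟩ := hv f hf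
    obtain ⟨d1, -⟩ := gf_div q2 q3 (v f).1 (v f).2.1 (v f).2.2.1 (v f).2.2.2
    have d2 : (q2 : ℤ) ^ 2 ∣ disc (g f) := dvd_trans ⟨q3, rfl⟩ d1
    have d3 := Int.le_of_dvd (abs_pos.2 hg0) ((dvd_abs _ _).2 d2)
    have d4 : ((q2 : ℝ)) ^ 2 ≤ |(disc (g f) : ℝ)| := by exact_mod_cast d3
    exact d4.trans hgl.le

end BCF

namespace BCF

lemma alg_bd (q0 q1 q2 q3 q4 X L : ℝ) (h0 : 1 ≤ q0) (h1 : 1 ≤ q1) (h2 : 1 ≤ q2) (h3 : 1 ≤ q3) (h4 : 1 ≤ q4)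
    (hX : 0 < X) (hL : 0 < L) (hW : L ^ 4 = q1 ^ 4 * q2 ^ 6 * q3 ^ 6 * q4 ^ 2 * X) :
    (L ^ 4 / (q2 ^ 2 * q3) + L ^ 3 / q2 + L ^ 2) * q4 ^ 2 * (q0 ^ 2 * q1 ^ 3 * q2 ^ 3 * q3 ^ 4 * q4 ^ 3)⁻¹ ≤
      3 * ((q0 * q1 * q2 * q3 * q4) * X + (q0 * q1 * q2 * q3 * q4)⁻¹) ∧
    (q2 ^ 2 ≤ L ^ 4 → (L ^ 4 / (q2 ^ 2 * q3) + L ^ 3 / q2 + L ^ 2) * q4 ^ 2 *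
      (q0 ^ 2 * q1 ^ 3 * q2 ^ 3 * q3 ^ 4 * q4 ^ 3)⁻¹ ≤ 3 * (q0 * q1 * q2 * q3 * q4) ^ 2 * X) := by
  have p0 : 0 < q0 := by linarith
  have p1 : 0 < q1 := by linarith
  have p2 : 0 < q2 := by linarith
  have p3 : 0 < q3 := by linarith
  have p4 : 0 < q4 := by linarith
  set s := Real.sqrt X with hs
  have hs2 : s ^ 2 = X := Real.sq_sqrt hX.le
  have hs0 : 0 < s := Real.sqrt_pos.2 hX
  have hL2 : L ^ 2 = q1 ^ 2 * q2 ^ 3 * q3 ^ 3 * q4 * s := by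
    apply (sq_eq_sq₀ (by positivity) (by positivity)).1
    calc (L ^ 2) ^ 2 = L ^ 4 := by ring
      _ = _ := by rw [hW, ← hs2]; ring
  set w := (q0 ^ 2 * q1 ^ 3 * q2 ^ 3 * q3 ^ 4 * q4 ^ 3)⁻¹ with hw
  have hw0 : 0 < w := by positivity
  set Q := q0 * q1 * q2 * q3 * q4 with hQ
  have hQ0 : 0 < Q := by positivity
  have i0 : q0⁻¹ ≤ 1 := inv_le_one_of_one_le₀ h0
  have i1 : q1⁻¹ ≤ 1 := inv_le_one_of_one_le₀ h1
  constructor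
  · have a1 : L ^ 3 / q2 ≤ L ^ 4 / (q2 ^ 2 * q3) + q3 * L ^ 2 := by
      have e : L ^ 4 / (q2 ^ 2 * q3) + q3 * L ^ 2 - L ^ 3 / q2 = (L ^ 2 / q3) * ((L / q2 - q3 / 2) ^ 2 + 3 / 4 * q3 ^ 2) := by
        field_simp; ring
      have : 0 ≤ (L ^ 2 / q3) * ((L / q2 - q3 / 2) ^ 2 + 3 / 4 * q3 ^ 2) := by positivity
      linarith
    have a2 : L ^ 2 ≤ q3 * L ^ 2 := le_mul_of_one_le_left (by positivity) h3
    have b1 : L ^ 4 / (q2 ^ 2 * q3) * q4 ^ 2 * w = Q * X * (q0⁻¹) ^ 3 := by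
      rw [hW, hw, hQ]; field_simp
    have b2 : q3 * L ^ 2 * q4 ^ 2 * w = s * ((q0⁻¹) ^ 2 * q1⁻¹) := by
      rw [hL2, hw]; field_simp
    have c1 : (q0⁻¹) ^ 3 ≤ 1 := pow_le_one₀ (by positivity) i0
    have c2 : (q0⁻¹) ^ 2 * q1⁻¹ ≤ 1 := mul_le_one₀ (pow_le_one₀ (by positivity) i0) (by positivity) i1
    have c3 : Q * X * (q0⁻¹) ^ 3 ≤ Q * X := mul_le_of_le_one_right (by positivity) c1
    have c4 : s * ((q0⁻¹) ^ 2 * q1⁻¹) ≤ s := mul_le_of_le_one_right hs0.le c2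
    have c5 : 2 * s ≤ Q * X + Q⁻¹ := by
      have e : Q * X + Q⁻¹ - 2 * s = Q⁻¹ * (Q * s - 1) ^ 2 := by rw [← hs2]; field_simp; ring
      have : 0 ≤ Q⁻¹ * (Q * s - 1) ^ 2 := by positivity
      linarith
    have hq4w : 0 ≤ q4 ^ 2 * w := by positivity
    have d : (L ^ 4 / (q2 ^ 2 * q3) + L ^ 3 / q2 + L ^ 2) * (q4 ^ 2 * w) ≤
        (2 * (L ^ 4 / (q2 ^ 2 * q3)) + 2 * (q3 * L ^ 2)) * (q4 ^ 2 * w) :=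
      mul_le_mul_of_nonneg_right (by linarith) hq4w
    have hQi : 0 < Q⁻¹ := by positivity
    have : (2 * (L ^ 4 / (q2 ^ 2 * q3)) + 2 * (q3 * L ^ 2)) * (q4 ^ 2 * w) =
      2 * (L ^ 4 / (q2 ^ 2 * q3) * q4 ^ 2 * w) + 2 * (q3 * L ^ 2 * q4 ^ 2 * w) := by ring
    rw [this, b1, b2] at d
    rw [mul_assoc]
    linarith
  · intro hq
    have hLq : q2 ≤ L ^ 2 := by
      apply le_of_sq_le_sq _ (by positivity)
      calc q2 ^ 2 ≤ L ^ 4 := hq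
        _ = (L ^ 2) ^ 2 := by ring
    have hL1 : 1 ≤ L := by
      by_contra hc
      have : L ^ 2 < 1 := pow_lt_one₀ hL.le (not_le.1 hc) two_ne_zero
      linarith
    have a1 : L ^ 4 / (q2 ^ 2 * q3) ≤ L ^ 4 / q2 := by
      apply div_le_div_of_nonneg_left (by positivity) p2
      nlinarith [mul_le_mul h2 h3 zero_le_one p2.le]
    have a2 : L ^ 3 / q2 ≤ L ^ 4 / q2 := by
      gcongr
      norm_num
    have a3 : L ^ 2 ≤ L ^ 4 / q2 := by
      rw [le_div_iff₀ p2]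
      nlinarith [mul_le_mul_of_nonneg_left hLq (sq_nonneg L)]
    have b : L ^ 4 / q2 * (q4 ^ 2 * w) = Q ^ 2 * X * ((q0⁻¹) ^ 4 * q1⁻¹ * q4⁻¹) := by
      rw [hW, hw, hQ]; field_simp
    have i4 : q4⁻¹ ≤ 1 := inv_le_one_of_one_le₀ h4
    have c2 : (q0⁻¹) ^ 4 * q1⁻¹ * q4⁻¹ ≤ 1 :=
      mul_le_one₀ (mul_le_one₀ (pow_le_one₀ (by positivity) i0) (by positivity) i1) (by positivity) i4
    have c3 : Q ^ 2 * X * ((q0⁻¹) ^ 4 * q1⁻¹ * q4⁻¹) ≤ Q ^ 2 * X := mul_le_of_le_one_right (by positivity) c2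
    have hq4w : 0 ≤ q4 ^ 2 * w := by positivity
    have d : (L ^ 4 / (q2 ^ 2 * q3) + L ^ 3 / q2 + L ^ 2) * (q4 ^ 2 * w) ≤ (3 * (L ^ 4 / q2)) * (q4 ^ 2 * w) :=
      mul_le_mul_of_nonneg_right (by linarith) hq4w
    rw [mul_assoc (3:ℝ), b] at d
    rw [mul_assoc]
    linarith

/-- coefficientwise quotient -/
def dv (n : ℤ) (x : BCF) : BCF := (x.1 / n, x.2.1 / n, x.2.2.1 / n, x.2.2.2 / n)

lemma dv_eq (n : ℤ) (x : BCF) (h : dvdAll n x) : n • dv n x = x := by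
  rcases x with ⟨a, b, c, d⟩
  obtain ⟨h1, h2, h3, h4⟩ := h
  simp only [dv, Prod.smul_mk, smul_eq_mul]
  rw [Int.mul_ediv_cancel' h1, Int.mul_ediv_cancel' h2, Int.mul_ediv_cancel' h3, Int.mul_ediv_cancel' h4]

lemma pk_cancel {p : ℕ} {n : ℤ} (hp : p.Prime) (hn : ¬ (p : ℤ) ∣ n) (k : ℕ) (z : ℤ) :
    (p : ℤ) ^ k ∣ n * z ↔ (p : ℤ) ^ k ∣ z := by
  have : IsCoprime ((p : ℤ) ^ k) n := IsCoprime.pow_left ((Prime.coprime_iff_not_dvd (Nat.prime_iff_prime_int.1 hp)).2 hn)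
  exact ⟨fun h => this.dvd_of_dvd_mul_left h, fun h => h.mul_left _⟩

lemma Fs_smul {p : ℕ} {n : ℤ} (hp : p.Prime) (hn : ¬ (p : ℤ) ∣ n) (z : BCF) : Fs p (n • z) ↔ Fs p z := by
  have := pk_cancel hp hn 1
  simp only [pow_one] at this
  simp only [Fs, Prod.smul_fst, Prod.smul_snd, smul_eq_mul, pk_cancel hp hn, this]

lemma Ls_smul {p : ℕ} {n : ℤ} (hp : p.Prime) (hn : ¬ (p : ℤ) ∣ n) (z : BCF) : Ls p (n • z) ↔ Ls p z := by
  have := pk_cancel hp hn 1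
  simp only [pow_one] at this
  simp only [Ls, Prod.smul_fst, Prod.smul_snd, smul_eq_mul, pk_cancel hp hn, this]

lemma LTs_smul {p : ℕ} {n : ℤ} (hp : p.Prime) (hn : ¬ (p : ℤ) ∣ n) (z : BCF) : LTs p (n • z) ↔ LTs p z := by
  have := pk_cancel hp hn 1
  simp only [pow_one] at this
  simp only [LTs, Prod.smul_fst, Prod.smul_snd, smul_eq_mul, pk_cancel hp hn, this]

lemma ty_le (p : ℕ) (x : BCF) : ty p x < 6 := by unfold ty; split_ifs <;> norm_num

lemma ty0 {p : ℕ} {x : BCF} (h : ty p x = 0) : dvdAll ((p : ℤ) ^ 2) x := by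
  unfold ty at h; split_ifs at h <;> first | assumption | omega
lemma ty1 {p : ℕ} {x : BCF} (h : ty p x = 1) : dvdAll p x := by
  unfold ty at h; split_ifs at h <;> first | assumption | omega
lemma ty4 {p : ℕ} {x : BCF} (h : ty p x = 4) : ∃ γ : Matrix (Fin 2) (Fin 2) ℤ, γ.det = 1 ∧ Fs p (act γ x) := by
  unfold ty at h; split_ifs at h <;> first | assumption | omega
lemma ty2 {p : ℕ} {x : BCF} (h : ty p x = 2) : (∃ γ : Matrix (Fin 2) (Fin 2) ℤ, γ.det = 1 ∧ Ls p (act γ x)) ∧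
    ¬ ∃ γ : Matrix (Fin 2) (Fin 2) ℤ, γ.det = 1 ∧ Fs p (act γ x) := by
  unfold ty at h; split_ifs at h <;> first | (constructor <;> assumption) | omega
lemma ty3 {p : ℕ} {x : BCF} (h : ty p x = 3) : (∃ γ : Matrix (Fin 2) (Fin 2) ℤ, γ.det = 1 ∧ LTs p (act γ x)) ∧
    ¬ ∃ γ : Matrix (Fin 2) (Fin 2) ℤ, γ.det = 1 ∧ Ls p (act γ x) := by
  unfold ty at h; split_ifs at h <;> first | (constructor <;> assumption) | omega

end BCF

namespace BCF

/-- product of the primes of a given class -/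
def qq (P : Finset ℕ) (κ : ℕ → ℕ) (i : ℕ) : ℕ := ∏ p ∈ P with κ p = i, p

lemma dvd_qq {P : Finset ℕ} (hP : ∀ p ∈ P, p.Prime) (κ : ℕ → ℕ) (i : ℕ) {p : ℕ} (hp : p.Prime) :
    p ∣ qq P κ i ↔ p ∈ P ∧ κ p = i := by
  unfold qq
  rw [Prime.dvd_finset_prod_iff hp.prime]
  constructor
  · rintro ⟨a, ha, hpa⟩
    rw [Finset.mem_filter] at ha
    rw [(Nat.prime_dvd_prime_iff_eq hp (hP a ha.1)).1 hpa]
    exact ha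
  · intro h
    exact ⟨p, Finset.mem_filter.2 h, dvd_rfl⟩

lemma sqf_P {P : Finset ℕ} (hP : ∀ p ∈ P, p.Prime) : Squarefree (∏ p ∈ P, p) := by
  refine Finset.squarefree_prod_of_pairwise_isCoprime (fun p hp q hq hpq ↦ ?_) (fun p hp => (hP p hp).squarefree)
  exact Nat.coprime_iff_isRelPrime.1 ((Nat.coprime_primes (hP p hp) (hP q hq)).2 hpq)

lemma prod5 {M : Type*} [CommMonoid M] (P : Finset ℕ) (κ : ℕ → ℕ) (hκ : ∀ p ∈ P, κ p < 5) (F : ℕ → M) :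
    ∏ p ∈ P, F p = (∏ p ∈ P with κ p = 0, F p) * (∏ p ∈ P with κ p = 1, F p) * (∏ p ∈ P with κ p = 2, F p) *
      (∏ p ∈ P with κ p = 3, F p) * (∏ p ∈ P with κ p = 4, F p) := by
  rw [← Finset.prod_fiberwise_of_maps_to (g := κ) (t := Finset.range 5) (fun p hp => Finset.mem_range.2 (hκ p hp))]
  simp only [Finset.prod_range_succ, Finset.prod_range_zero, one_mul]

lemma wt_prod (P : Finset ℕ) (κ : ℕ → ℕ) (hκ : ∀ p ∈ P, κ p < 5) :
    ∏ p ∈ P, wt p (κ p) = ((qq P κ 0 : ℝ) ^ 2 * (qq P κ 1 : ℝ) ^ 3 * (qq P κ 2 : ℝ) ^ 3 * (qq P κ 3 : ℝ) ^ 4 *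
      (qq P κ 4 : ℝ) ^ 3)⁻¹ := by
  have h : ∀ i e : ℕ, (∀ p : ℕ, wt p i = ((p : ℝ) ^ e)⁻¹) →
      ∏ p ∈ P with κ p = i, wt p (κ p) = ((qq P κ i : ℝ) ^ e)⁻¹ := by
    intro i e hi
    unfold qq
    rw [Nat.cast_prod, ← Finset.prod_pow, ← Finset.prod_inv_distrib]
    refine Finset.prod_congr rfl fun p hp => ?_
    rw [(Finset.mem_filter.1 hp).2, hi]
  rw [prod5 P κ hκ, h 0 2 (by simp [wt]), h 1 3 (by simp [wt]), h 2 3 (by simp [wt]), h 3 4 (by simp [wt]),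
    h 4 3 (by simp [wt])]
  simp only [mul_inv]

lemma class_core (q0 q1 q2 q3 q4 : ℕ) (hsq : Squarefree (q0 * q1 * q2 * q3 * q4))
    (hc2 : ¬ 2 ∣ q0 * q1 * q2 * q3 * q4) (hc3 : ¬ 3 ∣ q0 * q1 * q2 * q3 * q4) (X : ℝ) (hX : 0 < X) (S : Finset BCF)
    (hS : ∀ x ∈ S, disc x ≠ 0 ∧ |(disc x : ℝ)| < ((q0 : ℝ) * q1 * q2 * q3 * q4) ^ 8 * X ∧
      (∀ p : ℕ, p.Prime → p ∣ q0 → dvdAll ((p : ℤ) ^ 2) x) ∧ (∀ p : ℕ, p.Prime → p ∣ q1 → dvdAll p x) ∧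
      (∀ p : ℕ, p.Prime → p ∣ q4 → ∃ γ : Matrix (Fin 2) (Fin 2) ℤ, γ.det = 1 ∧ Fs p (act γ x)) ∧
      (∀ p : ℕ, p.Prime → p ∣ q2 → (∃ γ : Matrix (Fin 2) (Fin 2) ℤ, γ.det = 1 ∧ Ls p (act γ x)) ∧
        ¬ ∃ γ : Matrix (Fin 2) (Fin 2) ℤ, γ.det = 1 ∧ Fs p (act γ x)) ∧
      (∀ p : ℕ, p.Prime → p ∣ q3 → (∃ γ : Matrix (Fin 2) (Fin 2) ℤ, γ.det = 1 ∧ LTs p (act γ x)) ∧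
        ¬ ∃ γ : Matrix (Fin 2) (Fin 2) ℤ, γ.det = 1 ∧ Ls p (act γ x)))
    (hne : ∀ x ∈ S, ∀ y ∈ S, x ≠ y → ¬ SLeq x y) :
    (S.card : ℝ) * ((q0 : ℝ) ^ 2 * (q1 : ℝ) ^ 3 * (q2 : ℝ) ^ 3 * (q3 : ℝ) ^ 4 * (q4 : ℝ) ^ 3)⁻¹ ≤
      228 * ((q0 * q1 * q2 * q3 * q4).divisors.card : ℝ) ^ 2 *
      (((q0 : ℝ) * q1 * q2 * q3 * q4) * X + ((q0 : ℝ) * q1 * q2 * q3 * q4)⁻¹) ∧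
    (S.card : ℝ) * ((q0 : ℝ) ^ 2 * (q1 : ℝ) ^ 3 * (q2 : ℝ) ^ 3 * (q3 : ℝ) ^ 4 * (q4 : ℝ) ^ 3)⁻¹ ≤
      228 * ((q0 * q1 * q2 * q3 * q4).divisors.card : ℝ) ^ 2 * (((q0 : ℝ) * q1 * q2 * q3 * q4) ^ 2 * X) := by
  have hm0 : q0 * q1 * q2 * q3 * q4 ≠ 0 := hsq.ne_zero
  have z0 : 0 < q0 := Nat.pos_of_ne_zero (by rintro rfl; simp at hm0)
  have z1 : 0 < q1 := Nat.pos_of_ne_zero (by rintro rfl; simp at hm0)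
  have z2 : 0 < q2 := Nat.pos_of_ne_zero (by rintro rfl; simp at hm0)
  have z3 : 0 < q3 := Nat.pos_of_ne_zero (by rintro rfl; simp at hm0)
  have z4 : 0 < q4 := Nat.pos_of_ne_zero (by rintro rfl; simp at hm0)
  have o0 : (1:ℝ) ≤ q0 := by exact_mod_cast z0
  have o1 : (1:ℝ) ≤ q1 := by exact_mod_cast z1
  have o2 : (1:ℝ) ≤ q2 := by exact_mod_cast z2
  have o3 : (1:ℝ) ≤ q3 := by exact_mod_cast z3
  have o4 : (1:ℝ) ≤ q4 := by exact_mod_cast z4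
  have cop : ∀ {u v : ℕ}, u * v ∣ q0 * q1 * q2 * q3 * q4 → Nat.Coprime u v :=
    fun h => Nat.coprime_of_squarefree_mul (hsq.squarefree_of_dvd h)
  set n : ℤ := (q0 : ℤ) ^ 2 * q1 with hn
  have hn0 : n ≠ 0 := by positivity
  have hnd : ∀ x ∈ S, dvdAll n x := by
    intro x hx
    obtain ⟨-, -, a0, a1, -⟩ := hS x hx
    have s0 : Squarefree q0 := hsq.squarefree_of_dvd ⟨q1 * q2 * q3 * q4, by ring⟩
    have s1 : Squarefree q1 := hsq.squarefree_of_dvd ⟨q0 * q2 * q3 * q4, by ring⟩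
    have c01 : IsCoprime ((q0 : ℤ) ^ 2) q1 :=
      IsCoprime.pow_left (Nat.isCoprime_iff_coprime.2 (cop ⟨q2 * q3 * q4, by ring⟩))
    have k1 : ∀ z : ℤ, (∀ p : ℕ, p.Prime → p ∣ q1 → (p : ℤ) ∣ z) → (q1 : ℤ) ∣ z := by
      intro z hz
      have := sqf_pow_dvd q1 s1 1 z (by simpa using hz)
      simpa using this
    refine ⟨c01.mul_dvd (sqf_pow_dvd q0 s0 2 _ fun p hp h => (a0 p hp h).1) (k1 _ fun p hp h => (a1 p hp h).1),
      c01.mul_dvd (sqf_pow_dvd q0 s0 2 _ fun p hp h => (a0 p hp h).2.1) (k1 _ fun p hp h => (a1 p hp h).2.1),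
      c01.mul_dvd (sqf_pow_dvd q0 s0 2 _ fun p hp h => (a0 p hp h).2.2.1) (k1 _ fun p hp h => (a1 p hp h).2.2.1),
      c01.mul_dvd (sqf_pow_dvd q0 s0 2 _ fun p hp h => (a0 p hp h).2.2.2) (k1 _ fun p hp h => (a1 p hp h).2.2.2)⟩
  have hpn : ∀ p : ℕ, p.Prime → p ∣ q2 * q3 * q4 → ¬ (p : ℤ) ∣ n := by
    intro p hp hd hc
    have hc' : p ∣ q0 ^ 2 * q1 := by
      rw [hn] at hc; exact_mod_cast hc
    have hc'' : p ∣ q0 * q1 := by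
      rcases hp.dvd_mul.1 hc' with h | h
      · exact (hp.dvd_of_dvd_pow h).mul_right _
      · exact h.mul_left _
    have := Nat.dvd_gcd hc'' hd
    rw [cop (u := q0 * q1) (v := q2 * q3 * q4) ⟨1, by ring⟩] at this
    exact hp.one_lt.ne' (Nat.dvd_one.1 this)
  have hact : ∀ x ∈ S, ∀ γ, act γ x = n • act γ (dv n x) := by
    intro x hx γ
    rw [← act_smul, dv_eq n x (hnd x hx)]
  set W : ℝ := (q1 : ℝ) ^ 4 * q2 ^ 6 * q3 ^ 6 * q4 ^ 2 * X with hW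
  have hW0 : 0 < W := by positivity
  set L := Real.sqrt (Real.sqrt W) with hL
  have hL0 : 0 < L := Real.sqrt_pos.2 (Real.sqrt_pos.2 hW0)
  have hL4 : L ^ 4 = W := by
    rw [show L ^ 4 = (L ^ 2) ^ 2 by ring, hL, Real.sq_sqrt (Real.sqrt_nonneg _), Real.sq_sqrt hW0.le]
  have hinj : Set.InjOn (dv n) S := by
    intro x hx y hy hxy
    rw [← dv_eq n x (hnd x hx), hxy, dv_eq n y (hnd y hy)]
  have hsq' : Squarefree (q2 * q3 * q4) := hsq.squarefree_of_dvd ⟨q0 * q1, by ring⟩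
  have hd23 : q2 * q3 ∣ q0 * q1 * q2 * q3 * q4 := ⟨q0 * q1 * q4, by ring⟩
  have main := count_tuple q2 q3 q4 hsq' (fun h => hc2 (h.trans hd23)) (fun h => hc3 (h.trans hd23)) L hL0
    (S.image (dv n)) (by
      intro f hf
      obtain ⟨x, hx, rfl⟩ := Finset.mem_image.1 hf
      obtain ⟨hd0, hdl, a0, a1, a4, a2, a3⟩ := hS x hx
      have hdx : disc x = n ^ 4 * disc (dv n x) := by rw [← disc_smul, dv_eq n x (hnd x hx)]
      refine ⟨?_, ?_, ?_, ?_, ?_⟩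
      · intro h; rw [h, mul_zero] at hdx; exact hd0 hdx
      · have hpos : (0:ℝ) < (q0 ^ 2 * q1 : ℝ) ^ 4 := by positivity
        rw [hdx, hn] at hdl
        push_cast at hdl
        rw [abs_mul, abs_of_pos hpos] at hdl
        rw [hL4]
        refine lt_of_mul_lt_mul_left (hdl.trans_le (le_of_eq ?_)) hpos.le
        rw [hW]; ring
      · intro p hp hpd
        have := a4 p hp hpd
        simpa only [hact x hx, Fs_smul hp (hpn p hp (hpd.mul_left _))] using this
      · intro p hp hpd
        have := a2 p hp hpd
        have hh := hpn p hp ((hpd.mul_right _).mul_right _)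
        simpa only [hact x hx, Fs_smul hp hh, Ls_smul hp hh] using this
      · intro p hp hpd
        have := a3 p hp hpd
        have hh := hpn p hp ((hpd.mul_left _).mul_right _)
        simpa only [hact x hx, LTs_smul hp hh, Ls_smul hp hh] using this) (by
      intro f hf g hg hfg hs
      obtain ⟨x, hx, rfl⟩ := Finset.mem_image.1 hf
      obtain ⟨y, hy, rfl⟩ := Finset.mem_image.1 hg
      refine hne x hx y hy (fun h => hfg (by rw [h])) ?_
      obtain ⟨γ, hγ, h⟩ := hs
      exact ⟨γ, hγ, by rw [hact x hx, h, dv_eq n y (hnd y hy)]⟩)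
  rw [Finset.card_image_of_injOn hinj] at main
  obtain ⟨m1, m2⟩ := main
  obtain ⟨b1, b2⟩ := alg_bd q0 q1 q2 q3 q4 X L o0 o1 o2 o3 o4 hX hL0 hL4
  set w := ((q0 : ℝ) ^ 2 * (q1 : ℝ) ^ 3 * (q2 : ℝ) ^ 3 * (q3 : ℝ) ^ 4 * (q4 : ℝ) ^ 3)⁻¹ with hw
  have hw0 : 0 ≤ w := by positivity
  have hD : ((q2 * q3).divisors.card : ℝ) ^ 2 ≤ ((q0 * q1 * q2 * q3 * q4).divisors.card : ℝ) ^ 2 := by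
    gcongr
  set E := (L ^ 4 / ((q2 : ℝ) ^ 2 * q3) + L ^ 3 / q2 + L ^ 2) * (q4 : ℝ) ^ 2 * w with hE
  have key : (S.card : ℝ) * w ≤ 76 * ((q0 * q1 * q2 * q3 * q4).divisors.card : ℝ) ^ 2 * E := by
    calc (S.card : ℝ) * w ≤ 76 * ((q2 * q3).divisors.card : ℝ) ^ 2 * (L ^ 4 / (q2 ^ 2 * q3) + L ^ 3 / q2 + L ^ 2) * q4 ^ 2 * w :=
          mul_le_mul_of_nonneg_right m1 hw0
      _ = 76 * ((q2 * q3).divisors.card : ℝ) ^ 2 * E := by rw [hE]; ring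
      _ ≤ _ := by
        have : 0 ≤ E := by positivity
        gcongr
  constructor
  · refine key.trans ?_
    calc _ ≤ 76 * ((q0 * q1 * q2 * q3 * q4).divisors.card : ℝ) ^ 2 * _ := mul_le_mul_of_nonneg_left b1 (by positivity)
      _ = _ := by ring
  · rcases S.eq_empty_or_nonempty with h | h
    · rw [h, Finset.card_empty, Nat.cast_zero, zero_mul]; positivity
    · refine key.trans ?_
      calc _ ≤ 76 * ((q0 * q1 * q2 * q3 * q4).divisors.card : ℝ) ^ 2 * _ :=
            mul_le_mul_of_nonneg_left (b2 (m2 (h.image _))) (by positivity)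
        _ = _ := by ring

lemma class_bd (P : Finset ℕ) (hP : ∀ p ∈ P, p.Prime ∧ p ≠ 2 ∧ p ≠ 3) (κ : ℕ → ℕ) (hκ : ∀ p ∈ P, κ p < 6)
    (X : ℝ) (hX : 0 < X) (S : Finset BCF)
    (hS : ∀ x ∈ S, disc x ≠ 0 ∧ |(disc x : ℝ)| < ((∏ p ∈ P, p : ℕ) : ℝ) ^ 8 * X ∧ ∀ p ∈ P, ty p x = κ p)
    (hne : ∀ x ∈ S, ∀ y ∈ S, x ≠ y → ¬ SLeq x y) :
    (S.card : ℝ) * ∏ p ∈ P, wt p (κ p) ≤ 228 * ((∏ p ∈ P, p).divisors.card : ℝ) ^ 2 *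
      (((∏ p ∈ P, p : ℕ) : ℝ) * X + (((∏ p ∈ P, p : ℕ) : ℝ))⁻¹) ∧
    (S.card : ℝ) * ∏ p ∈ P, wt p (κ p) ≤ 228 * ((∏ p ∈ P, p).divisors.card : ℝ) ^ 2 *
      (((∏ p ∈ P, p : ℕ) : ℝ) ^ 2 * X) := by
  by_cases h5 : ∃ p ∈ P, κ p = 5
  · obtain ⟨p, hp, hp5⟩ := h5
    have : ∏ p ∈ P, wt p (κ p) = 0 := Finset.prod_eq_zero hp (by rw [hp5]; simp [wt])
    rw [this, mul_zero]
    constructor <;> positivity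
  have hκ5 : ∀ p ∈ P, κ p < 5 := by
    intro p hp
    have := hκ p hp
    have : κ p ≠ 5 := fun h => h5 ⟨p, hp, h⟩
    omega
  have hPp : ∀ p ∈ P, p.Prime := fun p hp => (hP p hp).1
  have hsqf := sqf_P hPp
  have hprod : ∏ p ∈ P, p = qq P κ 0 * qq P κ 1 * qq P κ 2 * qq P κ 3 * qq P κ 4 := prod5 P κ hκ5 (fun p => p)
  have hdq := fun i {p : ℕ} (hp : p.Prime) => dvd_qq hPp κ i hp
  rw [wt_prod P κ hκ5]
  have hPi : ∀ p : ℕ, p.Prime → p ∣ ∏ p ∈ P, p → p ∈ P := by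
    intro p hp h
    obtain ⟨a, ha, hpa⟩ := (Prime.dvd_finset_prod_iff hp.prime _).1 h
    rwa [(Nat.prime_dvd_prime_iff_eq hp (hPp a ha)).1 hpa]
  have hcast : ((∏ p ∈ P, p : ℕ) : ℝ) = (qq P κ 0 : ℝ) * qq P κ 1 * qq P κ 2 * qq P κ 3 * qq P κ 4 := by
    rw [hprod]; push_cast; ring
  have h2 : ¬ 2 ∣ ∏ p ∈ P, p := fun h => (hP 2 (hPi 2 Nat.prime_two h)).2.1 rfl
  have h3 : ¬ 3 ∣ ∏ p ∈ P, p := fun h => (hP 3 (hPi 3 Nat.prime_three h)).2.2 rfl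
  rw [hcast] at hS ⊢
  rw [hprod] at h2 h3 hsqf ⊢
  refine class_core _ _ _ _ _ hsqf h2 h3 X hX S ?_ hne
  intro x hx
  obtain ⟨e1, e2, e3⟩ := hS x hx
  have hty : ∀ i (p : ℕ), p.Prime → p ∣ qq P κ i → ty p x = i := by
    intro i p hp h
    obtain ⟨u, v⟩ := (hdq i hp).1 h
    rw [e3 p u, v]
  exact ⟨e1, e2, fun p hp h => ty0 (hty 0 p hp h), fun p hp h => ty1 (hty 1 p hp h), fun p hp h => ty4 (hty 4 p hp h),
    fun p hp h => ty2 (hty 2 p hp h), fun p hp h => ty3 (hty 3 p hp h)⟩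

end BCF

namespace BCF

lemma div_bd (δ : ℝ) (hδ : 0 < δ) : ∃ C : ℝ, 0 < C ∧ ∀ s : Finset ℕ, (∀ p ∈ s, p.Prime) →
    (2:ℝ) ^ s.card ≤ C * ((∏ p ∈ s, p : ℕ) : ℝ) ^ δ := by
  set M := ⌈(2:ℝ) ^ (1 / δ)⌉₊ with hM
  refine ⟨2 ^ M, by positivity, fun s hs => ?_⟩
  have h1 : ∀ p ∈ s, (2:ℝ) ≤ (if p < M then 2 else 1) * (p : ℝ) ^ δ := by
    intro p hp
    have hp1 : (1:ℝ) ≤ p := by exact_mod_cast (hs p hp).one_le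
    split_ifs with h
    · have := Real.one_le_rpow hp1 hδ.le
      linarith
    · have h2 : (2:ℝ) ^ (1 / δ) ≤ p := (Nat.le_ceil _).trans (by exact_mod_cast not_lt.1 h)
      have h3 := Real.rpow_le_rpow (by positivity) h2 hδ.le
      rw [← Real.rpow_mul (by norm_num), one_div_mul_cancel hδ.ne', Real.rpow_one] at h3
      linarith
  calc (2:ℝ) ^ s.card = ∏ p ∈ s, (2:ℝ) := by simp
    _ ≤ ∏ p ∈ s, ((if p < M then 2 else 1) * (p : ℝ) ^ δ) := Finset.prod_le_prod (fun _ _ => by norm_num) h1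
    _ = (2:ℝ) ^ (s.filter (· < M)).card * ((∏ p ∈ s, p : ℕ) : ℝ) ^ δ := by
      rw [Finset.prod_mul_distrib, Finset.prod_ite]
      simp only [Finset.prod_const, one_pow, mul_one]
      rw [Nat.cast_prod, Real.finsetProd_rpow _ _ (fun _ _ => Nat.cast_nonneg _)]
    _ ≤ 2 ^ M * ((∏ p ∈ s, p : ℕ) : ℝ) ^ δ := by
      gcongr
      · norm_num
      · calc (s.filter (· < M)).card ≤ (Finset.range M).card :=
            Finset.card_le_card (fun p hp => Finset.mem_range.2 (Finset.mem_filter.1 hp).2)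
          _ = M := Finset.card_range M

lemma card_div {P : Finset ℕ} (hP : ∀ p ∈ P, p.Prime) : (∏ p ∈ P, p).divisors.card = 2 ^ P.card := by
  have h := sqf_P hP
  rw [Nat.card_divisors h.ne_zero]
  have e : (∏ p ∈ P, p).primeFactors = P := Nat.primeFactors_prod hP
  rw [e]
  refine Finset.prod_eq_pow_card fun p hp => ?_
  have := Nat.factorization_eq_one_of_squarefree h (hP p hp) (Finset.dvd_prod_of_mem (fun p => p) hp)
  rw [this]

lemma sum_key (P : Finset ℕ) (hP : ∀ p ∈ P, p.Prime ∧ p ≠ 2 ∧ p ≠ 3)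
    (X : ℝ) (hX : 0 < X) (S : Finset BCF)
    (hS : ∀ x ∈ S, disc x ≠ 0 ∧ |(disc x : ℝ)| < ((∏ p ∈ P, p : ℕ) : ℝ) ^ 8 * X)
    (hne : ∀ x ∈ S, ∀ y ∈ S, x ≠ y → ¬ SLeq x y) :
    ∑ x ∈ S, ∏ p ∈ P, wt p (ty p x) ≤ 6 ^ P.card * (228 * (2 ^ P.card : ℝ) ^ 2 *
      (((∏ p ∈ P, p : ℕ) : ℝ) * X + (((∏ p ∈ P, p : ℕ) : ℝ))⁻¹)) ∧
    ∑ x ∈ S, ∏ p ∈ P, wt p (ty p x) ≤ 6 ^ P.card * (228 * (2 ^ P.card : ℝ) ^ 2 *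
      (((∏ p ∈ P, p : ℕ) : ℝ) ^ 2 * X)) := by
  set key : BCF → (P → Fin 6) := fun x p => ⟨ty p x, ty_le p x⟩ with hkey
  have hcard : (Finset.univ : Finset (P → Fin 6)).card = 6 ^ P.card := by
    simp
  have hD : ((∏ p ∈ P, p).divisors.card : ℝ) = 2 ^ P.card := by
    rw [card_div fun p hp => (hP p hp).1]; push_cast; rfl
  have cl : ∀ k : P → Fin 6, _ := fun k => class_bd P hP (fun p => if h : p ∈ P then k ⟨p, h⟩ else 0)
    (fun p hp => by simp only [dif_pos hp]; exact (k _).2) X hX (S.filter fun x => key x = k) (by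
      intro x hx
      rw [Finset.mem_filter] at hx
      refine ⟨(hS x hx.1).1, (hS x hx.1).2, fun p hp => ?_⟩
      simp only [dif_pos hp]
      rw [← hx.2]) (by
      intro x hx y hy
      exact hne x (Finset.mem_filter.1 hx).1 y (Finset.mem_filter.1 hy).1)
  have fib : ∀ k : P → Fin 6, ∑ x ∈ S with key x = k, ∏ p ∈ P, wt p (ty p x) =
      ((S.filter fun x => key x = k).card : ℝ) * ∏ p ∈ P, wt p (if h : p ∈ P then k ⟨p, h⟩ else 0 : ℕ) := by
    intro k
    rw [← nsmul_eq_mul]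
    apply Finset.sum_eq_card_nsmul
    intro x hx
    refine Finset.prod_congr rfl fun p hp => ?_
    simp only [dif_pos hp]
    rw [← (Finset.mem_filter.1 hx).2]
  rw [hD] at cl
  rw [← Finset.sum_fiberwise S key]
  constructor
  · calc _ ≤ (Finset.univ : Finset (P → Fin 6)).card • _ := Finset.sum_le_card_nsmul _ _ _ fun k _ => by
          rw [fib k]; exact (cl k).1
      _ = _ := by rw [hcard, nsmul_eq_mul]; push_cast; rfl
  · calc _ ≤ (Finset.univ : Finset (P → Fin 6)).card • _ := Finset.sum_le_card_nsmul _ _ _ fun k _ => by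
          rw [fib k]; exact (cl k).2
      _ = _ := by rw [hcard, nsmul_eq_mul]; push_cast; rfl

lemma wt_nonneg (p t : ℕ) : 0 ≤ wt p t := by unfold wt; split_ifs <;> positivity

lemma total (q : ℕ) (hq : Squarefree q) (X : ℝ) (hX : 0 < X) (S : Finset BCF)
    (hS : ∀ x ∈ S, inDual x ∧ disc x ≠ 0 ∧ |(disc x : ℝ)| < (q : ℝ) ^ 8 * X)
    (hne : ∀ x ∈ S, ∀ y ∈ S, x ≠ y → ¬ SLeq x y) :
    ∑ x ∈ S, ‖PhiHat' q x‖ ≤ 228 * 6 ^ 8 * ((2:ℝ) ^ q.primeFactors.card) ^ 10 * ((q : ℝ) * X + (q : ℝ)⁻¹) ∧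
    ∑ x ∈ S, ‖PhiHat' q x‖ ≤ 228 * 6 ^ 8 * ((2:ℝ) ^ q.primeFactors.card) ^ 10 * ((q : ℝ) ^ 2 * X) := by
  have hq0 : 0 < q := Nat.pos_of_ne_zero hq.ne_zero
  set P := q.primeFactors.filter (fun p => p ≠ 2 ∧ p ≠ 3) with hPdef
  set R := q.primeFactors.filter (fun p => ¬ (p ≠ 2 ∧ p ≠ 3)) with hRdef
  have hpf : ∏ p ∈ q.primeFactors, p = q := Nat.prod_primeFactors_of_squarefree hq
  have hP : ∀ p ∈ P, p.Prime ∧ p ≠ 2 ∧ p ≠ 3 := by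
    intro p hp
    rw [hPdef, Finset.mem_filter] at hp
    exact ⟨Nat.prime_of_mem_primeFactors hp.1, hp.2⟩
  have hPR : (∏ p ∈ P, p) * (∏ p ∈ R, p) = q := by
    rw [hPdef, hRdef, Finset.prod_filter_mul_prod_filter_not, hpf]
  have hR6 : ∏ p ∈ R, p ≤ 6 := by
    have : R ⊆ {2, 3} := by
      intro p hp
      rw [hRdef, Finset.mem_filter] at hp
      simp only [Finset.mem_insert, Finset.mem_singleton]
      tauto
    calc ∏ p ∈ R, p ≤ ∏ p ∈ ({2, 3} : Finset ℕ), p := by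
          apply Finset.prod_le_prod_of_subset_of_one_le' this
          intro p hp _
          simp only [Finset.mem_insert, Finset.mem_singleton] at hp
          omega
      _ = 6 := by simp
  set Q := ∏ p ∈ P, p with hQ
  have hQ0 : 0 < Q := Finset.prod_pos fun p hp => (hP p hp).1.pos
  have hQq : (Q : ℝ) ≤ q := by
    exact_mod_cast Nat.le_of_dvd hq0 ⟨_, hPR.symm⟩
  have hqQ : (q : ℝ) ≤ 6 * Q := by
    have : q ≤ 6 * Q := by rw [← hPR, mul_comm]; exact Nat.mul_le_mul_right _ hR6
    exact_mod_cast this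
  have hQr : (0:ℝ) < Q := by exact_mod_cast hQ0
  have hqr : (0:ℝ) < q := by exact_mod_cast hq0
  have hcardP : P.card ≤ q.primeFactors.card := Finset.card_filter_le _ _
  have hphi : ∀ x ∈ S, ‖PhiHat' q x‖ ≤ 32 ^ P.card * ∏ p ∈ P, wt p (ty p x) := by
    intro x hx
    obtain ⟨hd, -⟩ := hS x hx
    rw [← hpf, Phi_prod _ (fun p hp => Nat.prime_of_mem_primeFactors hp) x hd, norm_prod,
      ← Finset.prod_filter_mul_prod_filter_not q.primeFactors (fun p => p ≠ 2 ∧ p ≠ 3)]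
    have b1 : ∏ p ∈ P, ‖PhiHat' p x‖ ≤ ∏ p ∈ P, (32 * wt p (ty p x)) :=
      Finset.prod_le_prod (fun _ _ => norm_nonneg _) fun p hp => Phi_local (hP p hp).1 x hd
    have b2 : ∏ p ∈ R, ‖PhiHat' p x‖ ≤ 1 := Finset.prod_le_one (fun _ _ => norm_nonneg _) fun p hp =>
      Phi_le_one p (Nat.prime_of_mem_primeFactors (Finset.mem_filter.1 hp).1).pos x hd
    rw [Finset.prod_mul_distrib, Finset.prod_const] at b1
    calc _ ≤ ∏ p ∈ P, ‖PhiHat' p x‖ := mul_le_of_le_one_right (Finset.prod_nonneg fun _ _ => norm_nonneg _) b2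
      _ ≤ _ := b1
  have hsum : ∑ x ∈ S, ‖PhiHat' q x‖ ≤ 32 ^ P.card * ∑ x ∈ S, ∏ p ∈ P, wt p (ty p x) := by
    rw [Finset.mul_sum]; exact Finset.sum_le_sum hphi
  obtain ⟨k1, k2⟩ := sum_key P hP (6 ^ 8 * X) (by positivity) S (by
    intro x hx
    obtain ⟨-, h1, h2⟩ := hS x hx
    refine ⟨h1, h2.trans_le ?_⟩
    calc (q : ℝ) ^ 8 * X ≤ (6 * Q : ℝ) ^ 8 * X := by gcongr
      _ = _ := by ring) hne
  have hpow : (32:ℝ) ^ P.card * (6 ^ P.card * (2 ^ P.card) ^ 2) ≤ ((2:ℝ) ^ q.primeFactors.card) ^ 10 := by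
    calc (32:ℝ) ^ P.card * (6 ^ P.card * (2 ^ P.card) ^ 2) = 768 ^ P.card := by
          rw [← pow_mul, mul_comm P.card 2, pow_mul, ← mul_pow, ← mul_pow]; norm_num
      _ ≤ 1024 ^ P.card := by gcongr; norm_num
      _ ≤ 1024 ^ q.primeFactors.card := by gcongr; norm_num
      _ = _ := by rw [← pow_mul, mul_comm _ 10, pow_mul]; norm_num
  have hcomb : ∀ E F : ℝ, 0 ≤ E → E ≤ F → ∑ x ∈ S, ∏ p ∈ P, wt p (ty p x) ≤ 6 ^ P.card * (228 * (2 ^ P.card : ℝ) ^ 2 * E) →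
      ∑ x ∈ S, ‖PhiHat' q x‖ ≤ 228 * ((2:ℝ) ^ q.primeFactors.card) ^ 10 * F := by
    intro E F hE0 hEF h
    calc _ ≤ _ := hsum
      _ ≤ 32 ^ P.card * (6 ^ P.card * (228 * (2 ^ P.card : ℝ) ^ 2 * E)) := by gcongr
      _ = 228 * ((32:ℝ) ^ P.card * (6 ^ P.card * (2 ^ P.card) ^ 2)) * E := by ring
      _ ≤ 228 * ((2:ℝ) ^ q.primeFactors.card) ^ 10 * F := by gcongr
  constructor
  · refine (hcomb _ (6 ^ 8 * ((q : ℝ) * X + (q : ℝ)⁻¹)) (by positivity) ?_ k1).trans (le_of_eq (by ring))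
    have h1 : (Q : ℝ) * (6 ^ 8 * X) ≤ 6 ^ 8 * ((q : ℝ) * X) := by
      have : (Q : ℝ) * X ≤ q * X := by gcongr
      linarith
    have h2 : (Q : ℝ)⁻¹ ≤ 6 * (q : ℝ)⁻¹ := by
      rw [inv_le_iff_one_le_mul₀ hQr, ]
      rw [show 6 * (q : ℝ)⁻¹ * Q = 6 * Q / q by ring, one_le_div hqr]
      exact hqQ
    have h3 : 0 < (q : ℝ)⁻¹ := by positivity
    linarith
  · refine (hcomb _ (6 ^ 8 * ((q : ℝ) ^ 2 * X)) (by positivity) ?_ k2).trans (le_of_eq (by ring))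
    have : (Q : ℝ) ^ 2 * X ≤ q ^ 2 * X := by gcongr
    linarith

lemma final_thm :
    ∀ ε : ℝ, 0 < ε → ∃ C : ℝ,
      ∀ q : ℕ, Squarefree q → ∀ X : ℝ, 0 < X →
      ∀ S : Finset BCF,
        (∀ x ∈ S, inDual x ∧ disc x ≠ 0 ∧ (|disc x| : ℝ) < (q : ℝ) ^ 8 * X) →
        (∀ x ∈ S, ∀ y ∈ S, x ≠ y → ¬ SLeq x y) →
        (∑ x ∈ S, ‖PhiHat' q x‖ / (stabCard x : ℝ) ≤ C * (q : ℝ) ^ ((2:ℝ) + ε) * X) ∧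
        (∑ x ∈ S, ‖PhiHat' q x‖ / (stabCard x : ℝ)
          ≤ C * ((q : ℝ) ^ ((1:ℝ) + ε) * X + (q : ℝ) ^ (-(1:ℝ) + ε))) := by
  intro ε hε
  obtain ⟨C, hC, hdiv⟩ := div_bd (ε / 10) (by positivity)
  refine ⟨228 * 6 ^ 8 * C ^ 10, fun q hq X hX S hS hne => ?_⟩
  have hq0 : (0:ℝ) < q := by exact_mod_cast Nat.pos_of_ne_zero hq.ne_zero
  obtain ⟨t1, t2⟩ := total q hq X hX S hS hne
  have hd := hdiv q.primeFactors (fun p hp => Nat.prime_of_mem_primeFactors hp)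
  rw [Nat.prod_primeFactors_of_squarefree hq] at hd
  have hpow : ((2:ℝ) ^ q.primeFactors.card) ^ 10 ≤ C ^ 10 * (q : ℝ) ^ ε := by
    calc _ ≤ (C * (q : ℝ) ^ (ε / 10)) ^ 10 := by gcongr
      _ = C ^ 10 * (q : ℝ) ^ ε := by
        rw [mul_pow, ← Real.rpow_natCast ((q : ℝ) ^ (ε / 10)) 10, ← Real.rpow_mul hq0.le]
        norm_num
  have hst : ∑ x ∈ S, ‖PhiHat' q x‖ / (stabCard x : ℝ) ≤ ∑ x ∈ S, ‖PhiHat' q x‖ := by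
    refine Finset.sum_le_sum fun x _ => ?_
    rcases Nat.eq_zero_or_pos (stabCard x) with h | h
    · rw [h]; simp
    · exact div_le_self (norm_nonneg _) (by exact_mod_cast h)
  have e2 : (q : ℝ) ^ ((2:ℝ) + ε) = (q : ℝ) ^ 2 * (q : ℝ) ^ ε := by
    rw [Real.rpow_add hq0]; norm_num
  have e1 : (q : ℝ) ^ ((1:ℝ) + ε) = (q : ℝ) * (q : ℝ) ^ ε := by
    rw [Real.rpow_add hq0, Real.rpow_one]
  have e3 : (q : ℝ) ^ (-(1:ℝ) + ε) = (q : ℝ)⁻¹ * (q : ℝ) ^ ε := by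
    rw [Real.rpow_add hq0, Real.rpow_neg_one]
  rw [e1, e2, e3]
  constructor
  · calc _ ≤ _ := hst
      _ ≤ _ := t2
      _ ≤ 228 * 6 ^ 8 * (C ^ 10 * (q : ℝ) ^ ε) * ((q : ℝ) ^ 2 * X) := by gcongr
      _ = _ := by ring
  · calc _ ≤ _ := hst
      _ ≤ _ := t1
      _ ≤ 228 * 6 ^ 8 * (C ^ 10 * (q : ℝ) ^ ε) * ((q : ℝ) * X + (q : ℝ)⁻¹) := by gcongr
      _ = _ := by ring

end BCF

open BCF in
/-- Theorem 3.5: bounds for the dual coefficients in the 3-torsion problem. -/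
theorem dual_coefficient_bound_torsion :
    ∀ ε : ℝ, 0 < ε → ∃ C : ℝ,
      ∀ q : ℕ, Squarefree q → ∀ X : ℝ, 0 < X →
      ∀ S : Finset BCF,
        (∀ x ∈ S, inDual x ∧ disc x ≠ 0 ∧ (|disc x| : ℝ) < (q : ℝ) ^ 8 * X) →
        (∀ x ∈ S, ∀ y ∈ S, x ≠ y → ¬ SLeq x y) →
        (∑ x ∈ S, ‖PhiHat' q x‖ / (stabCard x : ℝ) ≤ C * (q : ℝ) ^ ((2:ℝ) + ε) * X) ∧
        (∑ x ∈ S, ‖PhiHat' q x‖ / (stabCard x : ℝ)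
          ≤ C * ((q : ℝ) ^ ((1:ℝ) + ε) * X + (q : ℝ) ^ (-(1:ℝ) + ε))) := by
  exact final_thm
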